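/- arXiv:2110.10530 — 5 statements merged into one kernel-verified Lean document; each statement's English description precedes it below -/
import Mathlib

section
/- For any connected graph G on n vertices in which every vertex has degree at least 3, the burning number of G satisfies b(G) ≤ ⌈√n⌉ + 2. -/
open SimpleGraph

/-- A graph is `k`-burnable if there is a sequence of `k` vertices `v 0, …, v (k-1)`
(`v i` being set on fire at step `i+1`) whose closed balls of radii `k-1-i` cover the graph. -/
def Burnable {V : Type*} (G : SimpleGraph V) (k : ℕ) : Prop :=
  ∃ v : Fin k → V, ∀ u : V, ∃ i : Fin k,
    G.Reachable (v i) u ∧ G.dist (v i) u ≤ k - 1 - (i : ℕ)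

/-- The burning number of a graph: the least `k` such that `G` is `k`-burnable. -/
noncomputable def burningNumber {V : Type*} (G : SimpleGraph V) : ℕ :=
  sInf {k | Burnable G k}

open Finset in
/-- The pairs `(a, y)` with `a ∉ S` and `y ≤ N` such that `S` meets the interval `(a, y]`. -/
def gapPairs (S : Finset ℕ) (N : ℕ) : Finset (ℕ × ℕ) :=
  {q ∈ range N ×ˢ range (N + 1) | q.1 ∉ S ∧ ∃ x ∈ S, q.1 < x ∧ x ≤ q.2}

lemma mem_gapPairs {S : Finset ℕ} {N : ℕ} {q : ℕ × ℕ} :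
    q ∈ gapPairs S N ↔ q.2 ≤ N ∧ q.1 ∉ S ∧ ∃ x ∈ S, q.1 < x ∧ x ≤ q.2 := by
  simp only [gapPairs, Finset.mem_filter, Finset.mem_product, Finset.mem_range]
  constructor
  · rintro ⟨⟨_, h⟩, h'⟩
    exact ⟨by omega, h'⟩
  · rintro ⟨h, h1, x, hx, h2, h3⟩
    exact ⟨⟨by omega, by omega⟩, h1, x, hx, h2, h3⟩

lemma gapPairs_mono (S : Finset ℕ) {M N : ℕ} (h : M ≤ N) : gapPairs S M ⊆ gapPairs S N := by
  intro q
  simp only [mem_gapPairs]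
  exact fun hq => ⟨hq.1.trans h, hq.2⟩

lemma gapPairs_range (n N : ℕ) : gapPairs (Finset.range n) N = ∅ := by
  ext q
  simp only [mem_gapPairs, Finset.mem_range, Finset.notMem_empty, iff_false]
  rintro ⟨h1, h2, x, h3, h4, h5⟩
  omega

lemma card_gapPairs_erase_top {S : Finset ℕ} {N b c : ℕ} (hb : b ∈ S) (hbN : b ≤ N)
    (hgap : ∀ a ∈ S, a < b → a < c) :
    (gapPairs (S.erase b) N).card + (b - c) ≤ (gapPairs S N).card + (N - b) := by
  classical
  have hsub : (Finset.Ico c b).image (fun a => (a, b)) ⊆ gapPairs S N := by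
    intro q hq
    simp only [Finset.mem_image, Finset.mem_Ico] at hq
    obtain ⟨a, ha, rfl⟩ := hq
    rw [mem_gapPairs]
    refine ⟨hbN, fun h => ?_, b, hb, ha.2, le_rfl⟩
    have := hgap a h ha.2
    omega
  have hsub' : gapPairs (S.erase b) N ⊆
      (gapPairs S N \ (Finset.Ico c b).image (fun a => (a, b))) ∪
        (Finset.Ioc b N).image (fun y => (b, y)) := by
    rintro ⟨a, y⟩ hq
    simp only [mem_gapPairs, Finset.mem_erase] at hq
    obtain ⟨h1, h2, x, ⟨h3, h3'⟩, h4, h5⟩ := hq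
    simp only [Finset.mem_union, Finset.mem_sdiff, mem_gapPairs, Finset.mem_image,
      Finset.mem_Ico, Finset.mem_Ioc, Prod.mk.injEq]
    by_cases hab : a = b
    · right
      exact ⟨y, ⟨by omega, h1⟩, hab.symm, rfl⟩
    · left
      refine ⟨⟨h1, fun h => h2 ⟨hab, h⟩, x, h3', h4, h5⟩, ?_⟩
      rintro ⟨a', ha', rfl, rfl⟩
      have := hgap x h3' (by omega)
      omega
  have hinj : Function.Injective (fun a : ℕ => (a, b)) := fun x y h => (Prod.mk.inj h).1
  have hinj' : Function.Injective (fun y : ℕ => (b, y)) := fun x y h => (Prod.mk.inj h).2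
  have h1 := (Finset.card_le_card hsub').trans (Finset.card_union_le _ _)
  have h2 := Finset.card_le_card hsub
  rw [Finset.card_sdiff_of_subset hsub] at h1
  rw [Finset.card_image_of_injective _ hinj, Nat.card_Ico] at h1 h2
  rw [Finset.card_image_of_injective _ hinj', Nat.card_Ioc] at h1
  omega

lemma card_gapPairs_erase_pred {S : Finset ℕ} {N s b : ℕ}
    (hgap : ∀ a ∈ S, s < a → b ≤ a) :
    (gapPairs (S.erase s) N).card ≤ (gapPairs S N).card + (N + 1 - b) := by
  classical
  have hsub' : gapPairs (S.erase s) N ⊆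
      gapPairs S N ∪ (Finset.Icc b N).image (fun y => (s, y)) := by
    rintro ⟨a, y⟩ hq
    simp only [mem_gapPairs, Finset.mem_erase] at hq
    obtain ⟨h1, h2, x, ⟨h3, h3'⟩, h4, h5⟩ := hq
    simp only [Finset.mem_union, mem_gapPairs, Finset.mem_image,
      Finset.mem_Icc, Prod.mk.injEq]
    by_cases hab : a = s
    · right
      have := hgap x h3' (by omega)
      exact ⟨y, ⟨by omega, h1⟩, hab.symm, rfl⟩
    · left
      exact ⟨h1, fun h => h2 ⟨hab, h⟩, x, h3', h4, h5⟩
  have hinj' : Function.Injective (fun y : ℕ => (s, y)) := fun x y h => (Prod.mk.inj h).2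
  have h1 := (Finset.card_le_card hsub').trans (Finset.card_union_le _ _)
  rw [Finset.card_image_of_injective _ hinj', Nat.card_Icc] at h1
  omega

/-- `u` and `c` have a common ancestor, under the parent map `p`, witnessing that their distance
is at most `r`. -/
def Near {W : Type*} (p : W → W) (c : W) (r : ℕ) (u : W) : Prop :=
  ∃ i j, i + j ≤ r ∧ p^[i] u = p^[j] c

open Classical in
/-- The vertices of `X` descending from `v` in the forest with parent map `p` and depth `d`. -/
noncomputable def descendants {W : Type*} (p : W → W) (d : W → ℕ) (X : Finset W) (v : W) :
    Finset W :=
  {u ∈ X | ∃ j ≤ d u, p^[j] u = v}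

lemma mem_descendants {W : Type*} {p : W → W} {d : W → ℕ} {X : Finset W} {u v : W} :
    u ∈ descendants p d X v ↔ u ∈ X ∧ ∃ j ≤ d u, p^[j] u = v := by
  simp [descendants]

lemma depth_iterate {W : Type*} {p : W → W} {d : W → ℕ} (hd : ∀ v, d (p v) = d v - 1)
    (j : ℕ) (v : W) : d (p^[j] v) = d v - j := by
  induction j with
  | zero => simp
  | succ j ih => rw [Function.iterate_succ_apply', hd, ih]; omega

lemma iterate_mem {W : Type*} {p : W → W} {X : Finset W} (hX : ∀ u ∈ X, p u ∈ X)
    {v : W} (hv : v ∈ X) (j : ℕ) : p^[j] v ∈ X := by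
  induction j with
  | zero => simpa
  | succ j ih => rw [Function.iterate_succ_apply']; exact hX _ ih

lemma descendants_closed {W : Type*} {p : W → W} {d : W → ℕ} (hd : ∀ v, d (p v) = d v - 1)
    (hroot : ∀ u v, d u = 0 → d v = 0 → u = v) {X : Finset W} (v u : W)
    (hu : u ∈ X) (hu' : u ∉ descendants p d X v) : p u ∉ descendants p d X v := by
  contrapose! hu'
  rw [mem_descendants] at hu' ⊢
  obtain ⟨_, j, hj, h⟩ := hu'
  rw [hd] at hj
  by_cases h0 : d u = 0
  · have : p u = u := hroot _ _ (by rw [hd]; omega) h0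
    rw [this] at h
    exact ⟨hu, j, by omega, h⟩
  · exact ⟨hu, j + 1, by omega, by rwa [Function.iterate_succ_apply]⟩

lemma descendants_iterate_mono {W : Type*} {p : W → W} {d : W → ℕ}
    (hd : ∀ v, d (p v) = d v - 1) {X : Finset W} {l : W} {i k : ℕ} (hik : i ≤ k) (hk : k ≤ d l) :
    descendants p d X (p^[i] l) ⊆ descendants p d X (p^[k] l) := by
  intro u hu
  rw [mem_descendants] at hu ⊢
  obtain ⟨hu, j, hj, h⟩ := hu
  have h1 := congrArg d h
  rw [depth_iterate hd, depth_iterate hd] at h1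
  refine ⟨hu, k - i + j, by omega, ?_⟩
  rw [Function.iterate_add_apply, h, ← Function.iterate_add_apply]
  congr 1
  omega

lemma near_of_mem_descendants {W : Type*} {p : W → W} {d : W → ℕ}
    (hd : ∀ v, d (p v) = d v - 1) {X : Finset W} {l : W} (hl : ∀ u ∈ X, d u ≤ d l)
    {i r : ℕ} (hi : i ≤ d l) (hir : i ≤ r) {u : W} (hu : u ∈ descendants p d X (p^[i] l)) :
    Near p (p^[i] l) r u := by
  rw [mem_descendants] at hu
  obtain ⟨hu, j, hj, h⟩ := hu
  have h1 := congrArg d h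
  rw [depth_iterate hd, depth_iterate hd] at h1
  have := hl u hu
  exact ⟨j, 0, by omega, h⟩

lemma card_descendants_iterate {W : Type*} {p : W → W} {d : W → ℕ}
    (hd : ∀ v, d (p v) = d v - 1) {X : Finset W} (hX : ∀ u ∈ X, p u ∈ X) {l : W} (hlX : l ∈ X)
    {i k : ℕ} (hik : i ≤ k) (hk : k ≤ d l) :
    (descendants p d X (p^[i] l)).card + (k - i) ≤ (descendants p d X (p^[k] l)).card := by
  induction k, hik using Nat.le_induction with
  | base => simp
  | succ k hik ih =>
    have ih := ih (by omega)
    have : descendants p d X (p^[k] l) ⊂ descendants p d X (p^[k + 1] l) := by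
      rw [Finset.ssubset_iff_of_subset (descendants_iterate_mono hd (by omega) hk)]
      refine ⟨p^[k + 1] l, ?_, ?_⟩
      · rw [mem_descendants]
        exact ⟨iterate_mem hX hlX _, 0, by omega, rfl⟩
      · rw [mem_descendants]
        rintro ⟨_, j, hj, h⟩
        have h1 := congrArg d h
        rw [depth_iterate hd, depth_iterate hd, depth_iterate hd] at h1
        omega
    have := Finset.card_lt_card this
    omega

lemma lt_card_descendants {W : Type*} {p : W → W} {d : W → ℕ}
    (hd : ∀ v, d (p v) = d v - 1) {X : Finset W} (hX : ∀ u ∈ X, p u ∈ X) {l : W} (hlX : l ∈ X)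
    {k : ℕ} (hk : k ≤ d l) : k < (descendants p d X (p^[k] l)).card := by
  have h := card_descendants_iterate hd hX hlX (Nat.zero_le k) hk
  have : 0 < (descendants p d X (p^[0] l)).card :=
    Finset.card_pos.2 ⟨l, mem_descendants.2 ⟨hlX, 0, by omega, rfl⟩⟩
  omega

/-- If the ball of radius `r` around the `r`-th ancestor of a deepest vertex misses some
descendant of the `m`-th ancestor, then the first ancestor where this happens has many
descendants. -/
lemma exists_obstruction {W : Type*} {p : W → W} {d : W → ℕ}
    (hd : ∀ v, d (p v) = d v - 1) {X : Finset W} (hX : ∀ u ∈ X, p u ∈ X)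
    {l : W} (hlX : l ∈ X) (hl : ∀ u ∈ X, d u ≤ d l) {r m : ℕ} (hm : m ≤ d l) (hr : r ≤ d l)
    (h : ¬ ∀ u ∈ descendants p d X (p^[m] l), Near p (p^[r] l) r u) :
    ∃ h, r < h ∧ h ≤ m ∧ (∀ u ∈ descendants p d X (p^[h - 1] l), Near p (p^[r] l) r u) ∧
      2 * r + 2 ≤ (descendants p d X (p^[h] l)).card := by
  classical
  have hex : ∃ m, ¬ ∀ u ∈ descendants p d X (p^[m] l), Near p (p^[r] l) r u := ⟨m, h⟩
  have hmin : ∀ k < Nat.find hex, ∀ u ∈ descendants p d X (p^[k] l), Near p (p^[r] l) r u :=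
    fun k hk => not_not.1 (Nat.find_min hex hk)
  have hspec := Nat.find_spec hex
  have hle : Nat.find hex ≤ m := Nat.find_min' hex h
  generalize Nat.find hex = k at *
  have hrk : r < k := by
    by_contra hcon
    exact hspec fun u hu => near_of_mem_descendants hd hl hr le_rfl
      (descendants_iterate_mono hd (by omega) hr hu)
  refine ⟨k, hrk, hle, hmin _ (by omega), ?_⟩
  push Not at hspec
  obtain ⟨u, hu, hnear⟩ := hspec
  obtain ⟨huX, q, hq, hqu⟩ := mem_descendants.1 hu
  have hq2 : 2 * r + 1 ≤ q + k := by
    by_contra hcon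
    refine hnear ⟨q, k - r, by omega, ?_⟩
    rw [hqu, ← Function.iterate_add_apply]
    congr 1
    omega
  have hdu := congrArg d hqu
  rw [depth_iterate hd, depth_iterate hd] at hdu
  set A := (Finset.range (k + 1)).image fun i => p^[i] l
  set B := (Finset.range q).image fun i => p^[i] u
  have hA : A.card = k + 1 := by
    rw [Finset.card_image_of_injOn, Finset.card_range]
    intro i hi j hj hij
    simp only [Finset.coe_range, Set.mem_Iio] at hi hj
    have h1 := congrArg d hij
    simp only [depth_iterate hd] at h1
    omega
  have hB : B.card = q := by
    rw [Finset.card_image_of_injOn, Finset.card_range]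
    intro i hi j hj hij
    simp only [Finset.coe_range, Set.mem_Iio] at hi hj
    have h1 := congrArg d hij
    simp only [depth_iterate hd] at h1
    omega
  have hAB : Disjoint A B := by
    rw [Finset.disjoint_left]
    intro x hx hx'
    simp only [A, B, Finset.mem_image, Finset.mem_range] at hx hx'
    obtain ⟨i, hi, rfl⟩ := hx
    obtain ⟨j, hj, hij⟩ := hx'
    have h1 := congrArg d hij
    simp only [depth_iterate hd] at h1
    exact hnear (hmin i (by omega) u (mem_descendants.2 ⟨huX, j, by omega, hij⟩))
  have hsub : A ∪ B ⊆ descendants p d X (p^[k] l) := by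
    intro x hx
    simp only [A, B, Finset.mem_union, Finset.mem_image, Finset.mem_range] at hx
    rw [mem_descendants]
    obtain ⟨i, hi, rfl⟩ | ⟨i, hi, rfl⟩ := hx
    · refine ⟨iterate_mem hX hlX i, k - i, by rw [depth_iterate hd]; omega, ?_⟩
      rw [← Function.iterate_add_apply]
      congr 1
      omega
    · refine ⟨iterate_mem hX huX i, q - i, by rw [depth_iterate hd]; omega, ?_⟩
      rw [← hqu, ← Function.iterate_add_apply]
      congr 1
      omega
  have := Finset.card_le_card hsub
  rw [Finset.card_union_of_disjoint hAB, hA, hB] at this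
  omega

/-- A ball of radius `r` covers a set of at least `g` vertices of `X` whose removal leaves a set
closed under the parent map `p`. -/
def Removable {W : Type*} (p : W → W) (X : Finset W) (r g : ℕ) : Prop :=
  ∃ (c : W) (Y : Finset W), Y ⊆ X ∧ (∀ u ∈ X, u ∉ Y → p u ∉ Y) ∧ (∀ u ∈ Y, Near p c r u) ∧
    g ≤ Y.card

lemma removable_dichotomy {W : Type*} {p : W → W} {d : W → ℕ}
    (hd : ∀ v, d (p v) = d v - 1) (hroot : ∀ u v, d u = 0 → d v = 0 → u = v)
    {X : Finset W} (hX : ∀ u ∈ X, p u ∈ X) (hne : X.Nonempty) (R : ℕ) :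
    (∃ c, ∀ u ∈ X, Near p c R u) ∨
    ∃ M, R + 1 ≤ M ∧ (Removable p X R M) ∧ (∀ b, M ≤ 2 * b + 1 → Removable p X b M) ∧
      ∀ s, 2 * s + 1 < M → Removable p X s (R + 2 + 2 * s - M) := by
  obtain ⟨l, hlX, hl⟩ := X.exists_max_image d hne
  have htop : ∀ u ∈ X, u ∈ descendants p d X (p^[d l] l) := fun u hu =>
    mem_descendants.2 ⟨hu, d u, le_rfl, hroot _ _ (by rw [depth_iterate hd]; omega)
      (by rw [depth_iterate hd]; omega)⟩
  rw [or_iff_not_imp_left]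
  intro hno
  push Not at hno
  have hR : R ≤ d l := by
    by_contra hcon
    obtain ⟨u, hu, hu'⟩ := hno (p^[d l] l)
    exact hu' (near_of_mem_descendants hd hl le_rfl (by omega) (htop u hu))
  obtain ⟨h, hRh, hh, hcov, -⟩ := exists_obstruction hd hX hlX hl le_rfl hR (by
    intro hcon
    obtain ⟨u, hu, hu'⟩ := hno (p^[R] l)
    exact hu' (hcon u (htop u hu)))
  have hrem : ∀ {c r g k}, (∀ u ∈ descendants p d X (p^[k] l), Near p c r u) →
      g ≤ (descendants p d X (p^[k] l)).card → Removable p X r g := fun {c r g k} h1 h2 =>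
    ⟨c, _, fun u hu => (mem_descendants.1 hu).1,
      fun u hu hu' => descendants_closed hd hroot _ u hu hu', h1, h2⟩
  have hM := lt_card_descendants hd hX hlX (show h - 1 ≤ d l by omega)
  refine ⟨_, by omega, hrem hcov le_rfl, fun b hb => ?_, fun s hs => ?_⟩
  · by_cases hbh : h - 1 ≤ b
    · exact hrem (fun u hu => near_of_mem_descendants hd hl (by omega) hbh hu) le_rfl
    · refine hrem (c := p^[b] l) ?_ le_rfl
      by_contra hcon
      obtain ⟨k, hk1, hk2, -, hk3⟩ := exists_obstruction hd hX hlX hl (by omega) (by omega) hcon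
      have := card_descendants_iterate hd hX hlX hk2 (by omega)
      omega
  · by_cases hbh : h - 1 ≤ s
    · exact hrem (fun u hu => near_of_mem_descendants hd hl (by omega) hbh hu) (by omega)
    · by_cases hcon : ∀ u ∈ descendants p d X (p^[h - 1] l), Near p (p^[s] l) s u
      · exact hrem hcon (by omega)
      · obtain ⟨k, hk1, hk2, hk4, hk3⟩ :=
          exists_obstruction hd hX hlX hl (by omega) (by omega) hcon
        have := card_descendants_iterate hd hX hlX hk2 (by omega)
        have := lt_card_descendants hd hX hlX (show k - 1 ≤ d l by omega)
        exact hrem hk4 (by omega)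

lemma exists_cover {W : Type*} [Nonempty W] {p : W → W} {d : W → ℕ}
    (hd : ∀ v, d (p v) = d v - 1) (hroot : ∀ u v, d u = 0 → d v = 0 → u = v)
    (S : Finset ℕ) : ∀ (N : ℕ) (X : Finset W), (∀ r ∈ S, r ≤ N) → (∀ u ∈ X, p u ∈ X) →
      2 * X.card + (gapPairs S N).card ≤ 3 * ∑ r ∈ S, r →
      ∃ c : ℕ → W, ∀ u ∈ X, ∃ r ∈ S, Near p (c r) r u := by
  classical
  induction S using Finset.strongInduction with
  | H S ih =>
  intro N X hN hX hcard
  by_cases hne : X.Nonempty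
  swap
  · rw [Finset.not_nonempty_iff_eq_empty] at hne
    subst hne
    exact ⟨fun _ => Classical.arbitrary W, by simp⟩
  have hS : S.Nonempty := by
    by_contra hcon
    rw [Finset.not_nonempty_iff_eq_empty] at hcon
    subst hcon
    have := hne.card_pos
    rw [Finset.sum_empty] at hcard
    omega
  obtain ⟨R, hRS, hR⟩ := S.exists_max_image id hS
  simp only [id] at hR
  have hcard' : 2 * X.card + (gapPairs S R).card ≤ 3 * ∑ r ∈ S, r :=
    le_trans (by gcongr; exact gapPairs_mono S (hN R hRS)) hcard
  have step : ∀ r ∈ S, ∀ g, Removable p X r g →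
      (gapPairs (S.erase r) R).card + 3 * r ≤ 2 * g + (gapPairs S R).card →
      ∃ c : ℕ → W, ∀ u ∈ X, ∃ r ∈ S, Near p (c r) r u := by
    rintro r hr g ⟨c₀, Y, hYX, hcl, hcov, hg⟩ hle
    have hsum := Finset.add_sum_erase S (fun r => r) hr
    have hX' := Finset.card_sdiff_add_card_eq_card hYX
    obtain ⟨c, hc⟩ := ih (S.erase r) (Finset.erase_ssubset hr) R (X \ Y)
      (fun s hs => hR s (Finset.mem_of_mem_erase hs))
      (fun u hu => by
        rw [Finset.mem_sdiff] at hu ⊢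
        exact ⟨hX u hu.1, hcl u hu.1 hu.2⟩) (by omega)
    refine ⟨Function.update c r c₀, fun u hu => ?_⟩
    by_cases huY : u ∈ Y
    · exact ⟨r, hr, by simpa using hcov u huY⟩
    · obtain ⟨s, hs, hs'⟩ := hc u (Finset.mem_sdiff.2 ⟨hu, huY⟩)
      rw [Finset.mem_erase] at hs
      exact ⟨s, hs.2, by rwa [Function.update_of_ne hs.1]⟩
  obtain ⟨c, hc⟩ | ⟨M, hM, hremR, hremb, hrems⟩ := removable_dichotomy hd hroot hX hne R
  · exact ⟨fun _ => c, fun u hu => ⟨R, hRS, hc u hu⟩⟩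
  by_cases hbig : 2 * R + 1 < M
  · refine step R hRS M hremR ?_
    have := card_gapPairs_erase_top (c := R) hRS le_rfl fun a _ h => h
    omega
  have hbne : (S.filter fun b => M ≤ 2 * b + 1).Nonempty :=
    ⟨R, Finset.mem_filter.2 ⟨hRS, by omega⟩⟩
  obtain ⟨b, hb, hbmin⟩ := Finset.exists_min_image _ id hbne
  simp only [id, Finset.mem_filter] at hb hbmin
  have hbR := hR b hb.1
  by_cases hs : (S.filter fun s => s < b).Nonempty
  · obtain ⟨s, hs, hsmax⟩ := Finset.exists_max_image _ id hs
    simp only [id, Finset.mem_filter] at hs hsmax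
    have hsM : 2 * s + 1 < M := by
      by_contra hcon
      have := hbmin s ⟨hs.1, by omega⟩
      omega
    by_cases hcase : R + b + (s + 1) ≤ 2 * M
    · refine step b hb.1 M (hremb b hb.2) ?_
      have := card_gapPairs_erase_top (c := s + 1) hb.1 hbR
        fun a ha hab => Nat.lt_succ_of_le (hsmax a ⟨ha, hab⟩)
      omega
    · refine step s hs.1 _ (hrems s hsM) ?_
      have := card_gapPairs_erase_pred (S := S) (N := R) (s := s) (b := b) fun a ha hsa => by
        by_contra hcon
        have := hsmax a ⟨ha, by omega⟩
        omega
      omega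
  · refine step b hb.1 M (hremb b hb.2) ?_
    have := card_gapPairs_erase_top (c := 0) hb.1 hbR
      fun a ha hab => absurd ⟨a, Finset.mem_filter.2 ⟨ha, hab⟩⟩ hs
    omega

/-- A connected graph on at most `3 * m * (m + 1) / 4` vertices is covered by balls of radii
`0, …, m`. -/
lemma SimpleGraph.Connected.exists_ball_cover {W : Type*} [Fintype W] {H : SimpleGraph W}
    (hH : H.Connected) (m : ℕ) (hcard : 4 * Fintype.card W ≤ 3 * (m * (m + 1))) :
    ∃ c : ℕ → W, ∀ u, ∃ r ≤ m, H.dist (c r) u ≤ r := by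
  classical
  obtain ⟨ρ⟩ := hH.nonempty
  have hparent : ∀ v, ∃ w, H.dist w ρ = H.dist v ρ - 1 ∧ H.dist v w ≤ 1 := by
    intro v
    obtain ⟨q, hq⟩ := hH.exists_walk_length_eq_dist v ρ
    cases q with
    | nil => exact ⟨ρ, by simp⟩
    | @cons _ w _ hadj q =>
      refine ⟨w, ?_, (dist_eq_one_iff_adj.2 hadj).le⟩
      have h1 := dist_le q
      have h2 := hH.dist_triangle (u := v) (v := w) (w := ρ)
      rw [dist_eq_one_iff_adj.2 hadj] at h2
      rw [Walk.length_cons] at hq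
      omega
  choose p hp hp1 using hparent
  have hiter : ∀ (j : ℕ) (v : W), H.dist v (p^[j] v) ≤ j := by
    intro j v
    induction j with
    | zero => simp
    | succ j ih =>
      rw [Function.iterate_succ_apply']
      have h2 := hH.dist_triangle (u := v) (v := p^[j] v) (w := p (p^[j] v))
      have := hp1 (p^[j] v)
      omega
  have : Nonempty W := ⟨ρ⟩
  obtain ⟨c, hc⟩ := exists_cover (p := p) (d := fun v => H.dist v ρ) hp
    (fun u v hu hv => (hH.dist_eq_zero_iff.1 hu).trans (hH.dist_eq_zero_iff.1 hv).symm)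
    (Finset.range (m + 1)) m Finset.univ (fun r hr => Nat.le_of_lt_succ (Finset.mem_range.1 hr))
    (fun _ _ => Finset.mem_univ _) (by
      rw [gapPairs_range, Finset.card_empty, Finset.card_univ]
      have := Finset.sum_range_id_mul_two (m + 1)
      rw [Nat.add_sub_cancel, mul_comm (m + 1)] at this
      omega)
  refine ⟨c, fun u => ?_⟩
  obtain ⟨r, hr, i, j, hij, h⟩ := hc u (Finset.mem_univ u)
  refine ⟨r, Nat.le_of_lt_succ (Finset.mem_range.1 hr), ?_⟩
  have h1 := hiter i u
  have h2 := hiter j (c r)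
  have h3 := hH.dist_triangle (u := c r) (v := p^[j] (c r)) (w := u)
  rw [← h, H.dist_comm (u := p^[i] u)] at h3
  rw [← h] at h2
  omega

open Classical in
/-- The closed neighbourhood of a set of vertices. -/
noncomputable def closedNbhd {V : Type*} [Fintype V] (G : SimpleGraph V) (I : Finset V) :
    Finset V :=
  {v | v ∈ I ∨ ∃ w ∈ I, G.Adj w v}

open Classical in
/-- The vertices outside `I`, adjacent to `I`, without neighbours outside the closed
neighbourhood of `I`. -/
noncomputable def deadLeaves {V : Type*} [Fintype V] (G : SimpleGraph V) (I : Finset V) :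
    Finset V :=
  {v ∈ closedNbhd G I | v ∉ I ∧ ∀ w, G.Adj v w → w ∈ closedNbhd G I}

lemma mem_closedNbhd {V : Type*} [Fintype V] {G : SimpleGraph V} {I : Finset V} {v : V} :
    v ∈ closedNbhd G I ↔ v ∈ I ∨ ∃ w ∈ I, G.Adj w v := by
  simp [closedNbhd]

lemma mem_deadLeaves {V : Type*} [Fintype V] {G : SimpleGraph V} {I : Finset V} {v : V} :
    v ∈ deadLeaves G I ↔
      v ∈ closedNbhd G I ∧ v ∉ I ∧ ∀ w, G.Adj v w → w ∈ closedNbhd G I := by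
  simp [deadLeaves]

lemma closedNbhd_mono {V : Type*} [Fintype V] {G : SimpleGraph V} {I J : Finset V}
    (h : I ⊆ J) : closedNbhd G I ⊆ closedNbhd G J := by
  intro v
  simp only [mem_closedNbhd]
  exact Or.imp (fun hv => h hv) fun ⟨w, hw, hv⟩ => ⟨w, h hw, hv⟩

lemma deadLeaves_subset {V : Type*} [Fintype V] {G : SimpleGraph V} {I J : Finset V}
    (h : I ⊆ J) (hJ : ∀ x ∈ J, x ∉ I → ∃ y ∉ closedNbhd G I, x = y ∨ G.Adj x y) :
    deadLeaves G I ⊆ deadLeaves G J := by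
  intro v
  simp only [mem_deadLeaves]
  rintro ⟨h1, h2, h3⟩
  refine ⟨closedNbhd_mono h h1, fun hv => ?_, fun w hw => closedNbhd_mono h (h3 w hw)⟩
  obtain ⟨y, hy, rfl | hvy⟩ := hJ v hv h2
  · exact hy h1
  · exact hy (h3 y hvy)

lemma SimpleGraph.Connected.induce_insert {V : Type*} [DecidableEq V] {G : SimpleGraph V}
    {I : Finset V} (hI : (G.induce (I : Set V)).Connected) {w x : V} (hw : w ∈ I)
    (hwx : G.Adj w x) : (G.induce ((insert x I : Finset V) : Set V)).Connected := by
  have h := induce_union_connected hI.preconnected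
    (induce_pair_connected_of_adj hwx).preconnected ⟨w, by simp [hw]⟩
  convert h using 2
  all_goals
    ext v
    simp
    grind

/-- One step of the Kleitman–West growth of a tree with many leaves. -/
lemma exists_larger_closedNbhd {V : Type*} [Fintype V] {G : SimpleGraph V}
    [DecidableRel G.Adj] (hG : G.Connected) (hdeg : ∀ v : V, 3 ≤ G.degree v) {I : Finset V}
    (hI : (G.induce (I : Set V)).Connected)
    (hcard : 3 * I.card ≤ 2 * (closedNbhd G I).card + (deadLeaves G I).card)
    (hne : closedNbhd G I ≠ Finset.univ) :
    ∃ J : Finset V, (G.induce (J : Set V)).Connected ∧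
      3 * J.card ≤ 2 * (closedNbhd G J).card + (deadLeaves G J).card ∧
      (closedNbhd G I).card < (closedNbhd G J).card := by
  classical
  have hleaf : ∀ x ∈ closedNbhd G I, ∀ y ∉ closedNbhd G I, G.Adj x y →
      x ∉ I ∧ ∃ w ∈ I, G.Adj w x := by
    intro x hx y hy hxy
    have hxI : x ∉ I := fun h => hy (mem_closedNbhd.2 (Or.inr ⟨x, h, hxy⟩))
    exact ⟨hxI, (mem_closedNbhd.1 hx).resolve_left hxI⟩
  have hself : ∀ J : Finset V, J ⊆ closedNbhd G J :=
    fun J v hv => mem_closedNbhd.2 (Or.inl hv)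
  have hnbr : ∀ (J : Finset V) (x : V), x ∈ J → G.neighborFinset x ⊆ closedNbhd G J :=
    fun J x hx v hv => mem_closedNbhd.2 (Or.inr ⟨x, hx, by simpa using hv⟩)
  by_cases hexp : ∃ x ∈ closedNbhd G I, 2 ≤ (G.neighborFinset x \ closedNbhd G I).card
  · obtain ⟨x, hx, hx2⟩ := hexp
    obtain ⟨y, hy⟩ := Finset.card_pos.1 (show 0 < (G.neighborFinset x \ closedNbhd G I).card by
      omega)
    simp only [Finset.mem_sdiff, mem_neighborFinset] at hy
    obtain ⟨hxI, w, hw, hwx⟩ := hleaf x hx y hy.2 hy.1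
    have hdead := Finset.card_le_card (deadLeaves_subset (G := G) (Finset.subset_insert x I) (by
      intro v hv hvI
      obtain rfl : v = x := by simpa [hvI] using hv
      exact ⟨y, hy.2, Or.inr hy.1⟩))
    have hN : closedNbhd G I ∪ (G.neighborFinset x \ closedNbhd G I) ⊆
        closedNbhd G (insert x I) :=
      Finset.union_subset (closedNbhd_mono (Finset.subset_insert x I))
        (Finset.sdiff_subset.trans (hnbr _ x (Finset.mem_insert_self x I)))
    have hN := Finset.card_le_card hN
    rw [Finset.card_union_of_disjoint Finset.disjoint_sdiff] at hN
    refine ⟨insert x I, hI.induce_insert hw hwx, ?_, by omega⟩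
    rw [Finset.card_insert_of_notMem hxI]
    omega
  push Not at hexp
  obtain ⟨x, hx, y, hy, hxy⟩ : ∃ x ∈ closedNbhd G I, ∃ y ∉ closedNbhd G I, G.Adj x y := by
    obtain ⟨v₀, hv₀⟩ := hI.nonempty
    obtain ⟨u, hu⟩ : ∃ u, u ∉ closedNbhd G I := by
      by_contra! hcon
      exact hne (Finset.eq_univ_of_forall hcon)
    obtain ⟨q⟩ := hG.preconnected v₀ u
    obtain ⟨e, -, he1, he2⟩ := q.exists_boundary_dart (closedNbhd G I : Set V)
      (by exact_mod_cast hself I hv₀) (by exact_mod_cast hu)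
    exact ⟨e.fst, by exact_mod_cast he1, e.snd, by exact_mod_cast he2, e.adj⟩
  obtain ⟨hxI, w, hw, hwx⟩ := hleaf x hx y hy hxy
  by_cases hz : ∃ z ∈ closedNbhd G I, z ≠ x ∧ G.Adj z y
  · obtain ⟨z, hz, hzx, hzy⟩ := hz
    obtain ⟨hzI, -⟩ := hleaf z hz y hy hzy
    have hsub := closedNbhd_mono (G := G) (Finset.subset_insert x I)
    have hyN : y ∈ closedNbhd G (insert x I) :=
      hnbr _ x (Finset.mem_insert_self x I) (by simpa using hxy)
    have hdead : insert z (deadLeaves G I) ⊆ deadLeaves G (insert x I) := by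
      refine Finset.insert_subset ?_ (deadLeaves_subset (Finset.subset_insert x I) ?_)
      · refine mem_deadLeaves.2 ⟨hsub hz, by simp [hzx, hzI], fun v hv => ?_⟩
        by_contra hcon
        have hvy : v ≠ y := fun h => hcon (h ▸ hyN)
        have h2 : ({v, y} : Finset V) ⊆ G.neighborFinset z \ closedNbhd G I := by
          intro a ha
          simp only [Finset.mem_insert, Finset.mem_singleton] at ha
          obtain rfl | rfl := ha
          · simpa using ⟨hv, fun h => hcon (hsub h)⟩
          · simpa using ⟨hzy, hy⟩
        have h2 := Finset.card_le_card h2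
        rw [Finset.card_pair hvy] at h2
        have := hexp z hz
        omega
      · intro v hv hvI
        obtain rfl : v = x := by simpa [hvI] using hv
        exact ⟨y, hy, Or.inr hxy⟩
    have hdead := Finset.card_le_card hdead
    rw [Finset.card_insert_of_notMem
      (fun h => hy ((mem_deadLeaves.1 h).2.2 y hzy))] at hdead
    have hN := Finset.card_le_card (Finset.insert_subset hyN hsub)
    rw [Finset.card_insert_of_notMem hy] at hN
    refine ⟨insert x I, hI.induce_insert hw hwx, ?_, by omega⟩
    rw [Finset.card_insert_of_notMem hxI]
    omega
  · push Not at hz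
    have hyx : y ∉ insert x I := by
      rw [Finset.mem_insert]
      rintro (rfl | h)
      · exact hy hx
      · exact hy (hself I h)
    have hsubI : I ⊆ insert y (insert x I) :=
      (Finset.subset_insert x I).trans (Finset.subset_insert y _)
    have hdead := Finset.card_le_card (deadLeaves_subset (G := G) hsubI (by
      intro v hv hvI
      obtain rfl | rfl : v = y ∨ v = x := by simpa [hvI] using hv
      · exact ⟨v, hy, Or.inl rfl⟩
      · exact ⟨y, hy, Or.inr hxy⟩))
    have hout : (G.neighborFinset y).erase x ⊆ Finset.univ \ insert y (closedNbhd G I) := by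
      intro v hv
      simp only [Finset.mem_erase, mem_neighborFinset] at hv
      simp only [Finset.mem_sdiff, Finset.mem_univ, true_and, Finset.mem_insert, not_or]
      exact ⟨hv.2.ne', fun h => hz v h hv.1 hv.2.symm⟩
    have hdisj : Disjoint (insert y (closedNbhd G I)) ((G.neighborFinset y).erase x) :=
      Finset.disjoint_of_subset_right hout Finset.disjoint_sdiff
    have hN : insert y (closedNbhd G I) ∪ (G.neighborFinset y).erase x ⊆
        closedNbhd G (insert y (insert x I)) :=
      Finset.union_subset (Finset.insert_subset (hself _ (Finset.mem_insert_self y _))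
        (closedNbhd_mono hsubI))
        ((Finset.erase_subset _ _).trans (hnbr _ y (Finset.mem_insert_self y _)))
    have hN := Finset.card_le_card hN
    rw [Finset.card_union_of_disjoint hdisj, Finset.card_insert_of_notMem hy,
      Finset.card_erase_of_mem (by simpa using hxy.symm), card_neighborFinset_eq_degree] at hN
    have := hdeg y
    refine ⟨insert y (insert x I),
      (hI.induce_insert hw hwx).induce_insert (Finset.mem_insert_self x I) hxy, ?_, by omega⟩
    rw [Finset.card_insert_of_notMem hyx, Finset.card_insert_of_notMem hxI]
    omega

/-- A connected graph of minimum degree at least three has a connected dominating set containing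
at most three quarters of its vertices. -/
lemma exists_connected_dominating {V : Type*} [Fintype V] {G : SimpleGraph V}
    [DecidableRel G.Adj] (hG : G.Connected) (hdeg : ∀ v : V, 3 ≤ G.degree v) :
    ∃ I : Finset V, (G.induce (I : Set V)).Connected ∧ (∀ v, v ∈ I ∨ ∃ w ∈ I, G.Adj w v) ∧
      4 * I.card ≤ 3 * Fintype.card V := by
  classical
  obtain ⟨v₀⟩ := hG.nonempty
  let good : Finset V → Prop := fun I => (G.induce (I : Set V)).Connected ∧
    3 * I.card ≤ 2 * (closedNbhd G I).card + (deadLeaves G I).card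
  have hgood : (Finset.univ.filter good).Nonempty := by
    refine ⟨{v₀}, Finset.mem_filter.2 ⟨Finset.mem_univ _, ?_, ?_⟩⟩
    · rw [Finset.coe_singleton]
      exact Connected.of_subsingleton
    · have h : G.neighborFinset v₀ ⊆ closedNbhd G {v₀} := fun v hv =>
        mem_closedNbhd.2 (Or.inr ⟨v₀, by simp, by simpa using hv⟩)
      have h := Finset.card_le_card h
      rw [card_neighborFinset_eq_degree] at h
      have := hdeg v₀
      rw [Finset.card_singleton]
      omega
  obtain ⟨I, hI, hmax⟩ := Finset.exists_max_image _ (fun I => (closedNbhd G I).card) hgood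
  simp only [Finset.mem_filter, Finset.mem_univ, true_and] at hI hmax
  have huniv : closedNbhd G I = Finset.univ := by
    by_contra hne
    obtain ⟨J, h1, h2, h3⟩ := exists_larger_closedNbhd hG hdeg hI.1 hI.2 hne
    have := hmax J ⟨h1, h2⟩
    omega
  refine ⟨I, hI.1, fun v => mem_closedNbhd.1 (huniv ▸ Finset.mem_univ v), ?_⟩
  have h1 : deadLeaves G I ⊆ Iᶜ := fun v hv => by simpa using (mem_deadLeaves.1 hv).2.1
  have h1 := Finset.card_le_card h1
  have h2 := Finset.card_add_card_compl I
  have h3 := hI.2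
  rw [huniv, Finset.card_univ] at h3
  omega

theorem burning_of_min_degree_three {V : Type*} [Fintype V] (G : SimpleGraph V)
    [DecidableRel G.Adj] (hG : G.Connected) (hdeg : ∀ v : V, 3 ≤ G.degree v) :
    burningNumber G ≤ ⌈Real.sqrt (Fintype.card V)⌉₊ + 2 := by
  obtain ⟨I, hI, hdom, hcard⟩ := exists_connected_dominating hG hdeg
  set m := ⌈Real.sqrt (Fintype.card V)⌉₊ with hm
  have hsq : Fintype.card V ≤ m * m := by
    have h := (Real.sqrt_le_left (Nat.cast_nonneg m)).1 (Nat.le_ceil _)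
    rw [sq] at h
    exact_mod_cast h
  obtain ⟨c, hc⟩ := hI.exists_ball_cover m (by
    simp only [Finset.coe_sort_coe, Fintype.card_coe]
    nlinarith)
  refine Nat.sInf_le ⟨fun i => (c (m - i)).1, fun u => ?_⟩
  obtain ⟨w, hw, hwu⟩ : ∃ w ∈ I, G.dist w u ≤ 1 := by
    obtain h | ⟨w, hw, hwu⟩ := hdom u
    · exact ⟨u, h, by simp⟩
    · exact ⟨w, hw, (dist_eq_one_iff_adj.2 hwu).le⟩
  obtain ⟨r, hr, hdist⟩ := hc ⟨w, hw⟩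
  refine ⟨⟨m - r, by omega⟩, hG.preconnected _ _, ?_⟩
  simp only [show m - (m - r) = r by omega]
  obtain ⟨q, hq⟩ := hI.exists_walk_length_eq_dist (c r) ⟨w, hw⟩
  have h1 := dist_le (q.map (Embedding.induce (I : Set V)).toHom)
  rw [Walk.length_map, hq] at h1
  have h2 := hG.dist_triangle (u := (c r).1) (v := w) (w := u)
  have h3 : G.dist (c r).1 w ≤ r := h1.trans hdist
  omega
end

section
/- For every k ∈ ℕ there exists N ∈ ℕ such that every tree T on n ≥ N vertices whose growth is at most k satisfies b(T) ≤ ⌈√n⌉ + 1. -/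
open SimpleGraph

/-- `G` has growth at most `k`: every vertex of `G` is within distance `k`
of some path in `G`. -/
def GrowthLE {V : Type*} (G : SimpleGraph V) (k : ℕ) : Prop :=
  ∃ (a b : V) (P : G.Walk a b), P.IsPath ∧ ∀ x : V, ∃ y ∈ P.support, G.dist y x ≤ k

open Finset in
/-- A ball of radius `r` centred at position `c` of a spine whose branches have heights `h`
covers the branch at `j` iff `j + h j ≤ c + r` and `c + h j ≤ j + r`. If more than `3 * k` radii
are available, one of them can be used, starting at `p`, without wasting any vertex. -/
lemma exists_lossless_ball {k : ℕ} {h : ℕ → ℕ} (hh : ∀ j, h j ≤ k) (R : Finset ℕ)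
    (hR : ∀ r ∈ R, k ≤ r) (hcard : 3 * k < #R) (p : ℕ) :
    ∃ r ∈ R, ∃ c q, p ≤ q ∧
      (∀ j, p ≤ j → j < q → j + h j ≤ c + r ∧ c + h j ≤ j + r) ∧
      2 * r + 1 ≤ ∑ j ∈ Ico p q, (1 + h j) := by
  have hne : R.Nonempty := card_pos.mp (by omega)
  obtain ⟨M, hM, hmax⟩ := R.exists_max_image id hne
  simp only [id] at hmax
  have hkM := hR M hM
  by_cases hw : 2 * k ≤ ∑ j ∈ Ico p (p + (2 * M + 1 - 2 * k)), h j
  · refine ⟨M, hM, p + M - k, p + (2 * M + 1 - 2 * k), by omega, fun j hj hjq => ?_, ?_⟩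
    · have := hh j
      omega
    · rw [sum_add_distrib]
      simp only [sum_const, Nat.card_Ico, smul_eq_mul, mul_one]
      omega
  -- `a` is the overhang needed on the left
  obtain ⟨i, hi, himax⟩ := (range (k + 1)).exists_max_image (fun i => h (p + i) - i) ⟨0, by simp⟩
  obtain ⟨a, ha⟩ : ∃ a, a = h (p + i) - i := ⟨_, rfl⟩
  have hak : a ≤ k := by have := hh (p + i); omega
  have hleft : ∀ j, p ≤ j → h j + p ≤ a + j := by
    intro j hj
    by_cases hjk : j - p < k + 1
    · have := himax (j - p) (by simpa using hjk)
      rw [show p + (j - p) = j by omega] at this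
      omega
    · have := hh j
      omega
  obtain ⟨r, hr, hgood⟩ : ∃ r ∈ R, ∀ j, p ≤ j → j ≤ p + 2 * r - a → j + h j ≤ p + 2 * r - a := by
    by_contra! hbad
    have hsub : (R.filter (fun r => r + k ≤ M)).image (fun r => p + 2 * r - a) ⊆
        (Ico p (p + (2 * M + 1 - 2 * k))).biUnion (fun j => Ico j (j + h j)) := by
      intro e he
      simp only [mem_image, mem_filter] at he
      obtain ⟨r, ⟨hr, hrM⟩, rfl⟩ := he
      obtain ⟨j, hj1, hj2, hj3⟩ := hbad r hr
      simp only [mem_biUnion, mem_Ico]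
      exact ⟨j, by omega, by omega⟩
    have h1 := (card_le_card hsub).trans card_biUnion_le
    simp only [Nat.card_Ico, add_tsub_cancel_left] at h1
    rw [card_image_of_injOn] at h1
    · have h2 : #(R.filter (fun r => ¬ r + k ≤ M)) ≤ k := by
        have : R.filter (fun r => ¬ r + k ≤ M) ⊆ Ioc (M - k) M := by
          intro r hr
          simp only [mem_filter, mem_Ioc] at hr ⊢
          have := hmax r hr.1
          omega
        have := card_le_card this
        simp only [Nat.card_Ioc] at this
        omega
      have h3 := card_filter_add_card_filter_not (s := R) (fun r => r + k ≤ M)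
      omega
    · intro x hx y hy hxy
      simp only [coe_filter, Set.mem_ofPred_eq] at hx hy hxy
      have := hR x hx.1
      have := hR y hy.1
      omega
  have hkr := hR r hr
  refine ⟨r, hr, p + r - a, p + 2 * r - a + 1, by omega, fun j hj hjq => ?_, ?_⟩
  · have := hleft j hj
    have := hgood j hj (by omega)
    omega
  · rw [sum_add_distrib]
    simp only [sum_const, Nat.card_Ico, smul_eq_mul, mul_one]
    have : a ≤ ∑ j ∈ Ico p (p + 2 * r - a + 1), h j := by
      rcases Nat.eq_zero_or_pos a with h0 | h0
      · omega
      · have hi' : p + i ∈ Ico p (p + 2 * r - a + 1) := by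
          have := hh (p + i)
          simp only [mem_Ico]
          omega
        have := single_le_sum (f := h) (fun _ _ => Nat.zero_le _) hi'
        omega
    omega

open Finset in
/-- Balls with radii in `R` can be lined up to cover an interval of a spine with branches of
heights `h ≤ k`, wasting only a bounded number of vertices. -/
lemma exists_interval_cover {k : ℕ} {h : ℕ → ℕ} (hh : ∀ j, h j ≤ k) (R : Finset ℕ)
    (hR : ∀ r ∈ R, k ≤ r) (p : ℕ) :
    ∃ (c : ℕ → ℕ) (q : ℕ), p ≤ q ∧
      (∀ j, p ≤ j → j < q → ∃ r ∈ R, j + h j ≤ c r + r ∧ c r + h j ≤ j + r) ∧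
      ∑ r ∈ R, (2 * r + 1) ≤ ∑ j ∈ Ico p q, (1 + h j) + 2 * k * min #R (3 * k) := by
  induction hn : #R generalizing R p with
  | zero =>
    rw [card_eq_zero] at hn
    subst hn
    exact ⟨id, p, le_rfl, fun j h1 h2 => by omega, by simp⟩
  | succ n ih =>
    obtain ⟨r, hr, c₀, q₀, hpq, hcov, hsum⟩ : ∃ r ∈ R, ∃ c q, p ≤ q ∧
        (∀ j, p ≤ j → j < q → j + h j ≤ c + r ∧ c + h j ≤ j + r) ∧
        2 * r + 1 + 2 * k * min n (3 * k) ≤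
          ∑ j ∈ Ico p q, (1 + h j) + 2 * k * min (n + 1) (3 * k) := by
      by_cases hc : 3 * k < #R
      · obtain ⟨r, hr, c, q, h1, h2, h3⟩ := exists_lossless_ball hh R hR hc p
        refine ⟨r, hr, c, q, h1, h2, ?_⟩
        rw [min_eq_right (by omega), min_eq_right (by omega)]
        omega
      · obtain ⟨r, hr⟩ : R.Nonempty := card_pos.mp (by omega)
        have hkr := hR r hr
        refine ⟨r, hr, p + r - k, p + (2 * r + 1 - 2 * k), by omega, fun j hj hjq => ?_, ?_⟩
        · have := hh j
          omega
        · rw [min_eq_left (by omega), min_eq_left (by omega), sum_add_distrib, mul_add]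
          simp only [sum_const, Nat.card_Ico, smul_eq_mul, mul_one]
          omega
    obtain ⟨c, q, hq, hcov', hsum'⟩ := ih (R.erase r) (fun x hx => hR x (mem_of_mem_erase hx)) q₀
      (by rw [card_erase_of_mem hr]; omega)
    refine ⟨Function.update c r c₀, q, hpq.trans hq, fun j hj hjq => ?_, ?_⟩
    · rcases lt_or_ge j q₀ with hlt | hge
      · exact ⟨r, hr, by simpa using hcov j hj hlt⟩
      · obtain ⟨s, hs, hs'⟩ := hcov' j hge hjq
        exact ⟨s, mem_of_mem_erase hs, by simpa [ne_of_mem_erase hs] using hs'⟩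
    · rw [← sum_Ico_consecutive _ hpq hq, ← add_sum_erase R _ hr]
      omega

lemma SimpleGraph.Walk.dist_getVert_le {V : Type*} {G : SimpleGraph V} {u v : V}
    (P : G.Walk u v) {i j : ℕ} (hij : i ≤ j) :
    G.dist (P.getVert i) (P.getVert j) ≤ j - i := by
  have key : ∀ n, ∃ w : G.Walk (P.getVert i) (P.getVert (i + n)), w.length ≤ n := by
    intro n
    induction n with
    | zero => exact ⟨.nil, by simp⟩
    | succ n ih =>
      obtain ⟨w, hw⟩ := ih
      rcases lt_or_ge (i + n) P.length with hlt | hge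
      · exact ⟨w.concat (P.adj_getVert_succ hlt), by simpa using hw⟩
      · have heq : P.getVert (i + n) = P.getVert (i + (n + 1)) := by
          rw [P.getVert_of_length_le hge, P.getVert_of_length_le (by omega)]
        exact ⟨w.copy rfl heq, by rw [Walk.length_copy]; omega⟩
  obtain ⟨w, hw⟩ := key (j - i)
  simpa only [Nat.add_sub_cancel' hij] using (dist_le w).trans hw

lemma SimpleGraph.Connected.exists_dist_eq_of_le {V : Type*} {G : SimpleGraph V}
    (hG : G.Connected) {u x : V} {t : ℕ} (ht : t ≤ G.dist u x) :
    ∃ y, G.dist u y = t ∧ t + G.dist y x = G.dist u x := by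
  obtain ⟨w, hw⟩ := hG.exists_walk_length_eq_dist u x
  have h1 := w.dist_getVert_le (Nat.zero_le t)
  have h2 := w.dist_getVert_le (hw ▸ ht : t ≤ w.length)
  rw [w.getVert_zero] at h1
  rw [w.getVert_length] at h2
  have h3 := hG.dist_triangle (u := u) (v := w.getVert t) (w := x)
  exact ⟨w.getVert t, by omega, by omega⟩

open Finset in
/-- A path all of whose vertices are within distance `k` of the rest of the graph carries disjoint
branches, of heights `h ≤ k`, that cover the graph. -/
lemma exists_branch_heights {V : Type*} [Fintype V] {G : SimpleGraph V} (hG : G.Connected)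
    {k : ℕ} {a b : V} (P : G.Walk a b) (hP : P.IsPath)
    (hk : ∀ x : V, ∃ y ∈ P.support, G.dist y x ≤ k) :
    ∃ h : ℕ → ℕ, (∀ j, h j ≤ k) ∧
      (∀ x, ∃ j ≤ P.length, G.dist (P.getVert j) x ≤ h j) ∧
      ∑ j ∈ range (P.length + 1), (1 + h j) ≤ Fintype.card V := by
  classical
  have hproj : ∀ x, ∃ j ≤ P.length,
      (∀ i ≤ P.length, G.dist (P.getVert j) x ≤ G.dist (P.getVert i) x) ∧
      ∀ i < j, G.dist (P.getVert j) x < G.dist (P.getVert i) x := by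
    intro x
    have hex : ∃ j, j ≤ P.length ∧
        ∀ i ≤ P.length, G.dist (P.getVert j) x ≤ G.dist (P.getVert i) x := by
      obtain ⟨j, hj, hmin⟩ := (range (P.length + 1)).exists_min_image
        (fun i => G.dist (P.getVert i) x) ⟨0, by simp⟩
      simp only [mem_range, Nat.lt_succ_iff] at hj hmin
      exact ⟨j, hj, hmin⟩
    obtain ⟨hj, hmin⟩ := Nat.find_spec hex
    refine ⟨Nat.find hex, hj, hmin, fun i hi => ?_⟩
    by_contra! hle
    exact Nat.find_min hex hi ⟨by omega, fun l hl => hle.trans (hmin l hl)⟩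
  choose f hfle hfmin hflt using hproj
  have hfeq : ∀ x j, j ≤ P.length →
      (∀ i ≤ P.length, G.dist (P.getVert j) x ≤ G.dist (P.getVert i) x) →
      (∀ i < j, G.dist (P.getVert j) x < G.dist (P.getVert i) x) → f x = j := by
    intro x j hj hmin hlt
    rcases lt_trichotomy (f x) j with h | h | h
    · exact absurd (hlt _ h) (not_lt.mpr (hfmin x j hj))
    · exact h
    · exact absurd (hflt x j h) (not_lt.mpr (hmin _ (hfle x)))
  have hclose : ∀ x, G.dist (P.getVert (f x)) x ≤ k := by
    intro x
    obtain ⟨y, hy, hyx⟩ := hk x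
    obtain ⟨i, rfl, hi⟩ := Walk.mem_support_iff_exists_getVert.mp hy
    exact (hfmin x i hi).trans hyx
  refine ⟨fun j => (univ.filter (fun x => f x = j)).sup (fun x => G.dist (P.getVert j) x),
    fun j => Finset.sup_le fun x hx => ?_, fun x => ⟨f x, hfle x, ?_⟩, ?_⟩
  · rw [← (mem_filter.mp hx).2]
    exact hclose x
  · exact le_sup (f := fun y => G.dist (P.getVert (f x)) y) (by simp)
  · rw [← card_univ, card_eq_sum_card_fiberwise (f := f) (t := range (P.length + 1))
      (fun x _ => by simpa [Nat.lt_succ_iff] using hfle x)]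
    refine sum_le_sum fun j hj => ?_
    have hj : j ≤ P.length := Nat.lt_succ_iff.mp (mem_range.mp hj)
    have hself : f (P.getVert j) = j := by
      refine hfeq _ j hj (fun i _ => by simp) fun i hi => ?_
      rw [dist_self]
      refine hG.pos_dist_of_ne fun heq => hi.ne ?_
      exact hP.getVert_injOn (by simp; omega) (by simpa using hj) heq
    obtain ⟨x, hx, hsup⟩ := exists_mem_eq_sup (univ.filter (fun x => f x = j))
      ⟨P.getVert j, by simp [hself]⟩ (fun x => G.dist (P.getVert j) x)
    beta_reduce
    rw [hsup]
    obtain rfl : f x = j := (mem_filter.mp hx).2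
    have himg : range (1 + G.dist (P.getVert (f x)) x) ⊆
        (univ.filter (fun y => f y = f x)).image (fun y => G.dist (P.getVert (f x)) y) := by
      intro t ht
      obtain ⟨y, hy, hyx⟩ := hG.exists_dist_eq_of_le (u := P.getVert (f x)) (x := x) (t := t)
        (by rw [mem_range] at ht; omega)
      refine mem_image.mpr ⟨y, mem_filter.mpr ⟨mem_univ _, ?_⟩, hy⟩
      refine hfeq y _ (hfle x) (fun i hi => ?_) (fun i hi => ?_)
      · have := hfmin x i hi
        have := hG.dist_triangle (u := P.getVert i) (v := y) (w := x)
        omega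
      · have := hflt x i hi
        have := hG.dist_triangle (u := P.getVert i) (v := y) (w := x)
        omega
    simpa using (card_le_card himg).trans card_image_le

lemma sum_Ico_two_mul_add_one {k m : ℕ} (hkm : k ≤ m) :
    ∑ r ∈ Finset.Ico k m, (2 * r + 1) + k ^ 2 = m ^ 2 := by
  induction m, hkm using Nat.le_induction with
  | base => simp
  | succ m hm ih =>
    rw [Finset.sum_Ico_succ_top hm]
    linarith

lemma burnable_succ_of_growthLE {V : Type*} [Fintype V] {G : SimpleGraph V} (hG : G.Connected)
    {k m : ℕ} (hgrowth : GrowthLE G k) (hkm : k ≤ m) (hm : 7 * k ^ 2 ≤ 2 * m)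
    (hcard : Fintype.card V ≤ m ^ 2) : Burnable G (m + 1) := by
  obtain ⟨a, b, P, hP, hk⟩ := hgrowth
  obtain ⟨h, hh, hnear, hsum⟩ := exists_branch_heights hG P hP hk
  obtain ⟨c, q, -, hcov, hcsum⟩ := exists_interval_cover hh (Finset.Ico k (m + 1))
    (fun r hr => (Finset.mem_Ico.mp hr).1) 0
  have hq : P.length < q := by
    by_contra! hle
    have h1 := Finset.sum_le_sum_of_subset (f := fun j => 1 + h j)
      (Finset.range_mono (hle.trans P.length.le_succ))
    have h2 := sum_Ico_two_mul_add_one (hkm.trans m.le_succ)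
    have h3 : 2 * k * min (Finset.Ico k (m + 1)).card (3 * k) ≤ 2 * k * (3 * k) :=
      Nat.mul_le_mul_left _ (min_le_right _ _)
    rw [← Finset.range_eq_Ico] at hcsum
    nlinarith
  refine ⟨fun i => P.getVert (c (m - i)), fun u => ?_⟩
  obtain ⟨j, hj, hju⟩ := hnear u
  obtain ⟨r, hr, hr1, hr2⟩ := hcov j (Nat.zero_le j) (by omega)
  have hrm : r ≤ m := Nat.lt_succ_iff.mp (Finset.mem_Ico.mp hr).2
  refine ⟨⟨m - r, by omega⟩, hG.preconnected _ _, ?_⟩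
  simp only [Nat.sub_sub_self hrm, Nat.add_sub_cancel]
  have htri := hG.dist_triangle (u := P.getVert (c r)) (v := P.getVert j) (w := u)
  rcases le_total (c r) j with hle | hle
  · have := P.dist_getVert_le hle
    omega
  · have := P.dist_getVert_le hle
    rw [dist_comm] at this
    omega

theorem burning_of_bounded_growth_large (k : ℕ) :
    ∃ N : ℕ, ∀ (V : Type) [Fintype V] (T : SimpleGraph V),
      T.IsTree → GrowthLE T k → N ≤ Fintype.card V →
      burningNumber T ≤ ⌈Real.sqrt (Fintype.card V)⌉₊ + 1 := by
  refine ⟨(4 * k ^ 2 + k) ^ 2, fun V _ T hT hgrowth hN => ?_⟩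
  have hcard : Fintype.card V ≤ ⌈Real.sqrt (Fintype.card V)⌉₊ ^ 2 := by
    have := Real.sqrt_le_iff.mp (Nat.le_ceil (Real.sqrt (Fintype.card V)))
    exact_mod_cast this.2
  have hm := (Nat.pow_le_pow_iff_left two_ne_zero).mp (hN.trans hcard)
  exact Nat.sInf_le (burnable_succ_of_growthLE hT.connected hgrowth (by omega) (by omega) hcard)
end

section
/- For any k ∈ ℕ, if every tree of growth at most k on at most (2k² + 4k + 3)² vertices satisfies b(T) ≤ ⌈√|V(T)|⌉, then every tree of growth at most k satisfies b(T) ≤ ⌈√|V(T)|⌉. -/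
open SimpleGraph

namespace BurningReduction

/-- Sum of the column heights `h p` over the positions `p < x`. -/
def colSum (h : ℕ → ℕ) (x : ℕ) : ℕ := ∑ p ∈ Finset.range x, h p

theorem colSum_mono (h : ℕ → ℕ) {x y : ℕ} (hxy : x ≤ y) : colSum h x ≤ colSum h y :=
  Finset.sum_le_sum_of_subset (Finset.range_mono hxy)

/-- How far the boundary `T` has to be moved to the left so that no interval
`[p - h p, p + h p]` starting to the left of the new boundary reaches `T`. -/
def boundaryLoss (h : ℕ → ℕ) (k T : ℕ) : ℕ :=
  (Finset.range (T + k)).sup fun p => if p < T + h p ∧ T ≤ p + h p then T + h p - p else 0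

theorem boundaryLoss_le {h : ℕ → ℕ} {k : ℕ} (hk : ∀ p, h p ≤ k) (T : ℕ) :
    boundaryLoss h k T ≤ 2 * k := by
  refine Finset.sup_le fun p _ => ?_
  have := hk p
  split_ifs <;> omega

theorem le_boundaryLoss {h : ℕ → ℕ} {k : ℕ} (hk : ∀ p, h p ≤ k) {T p : ℕ}
    (h1 : p < T + h p) (h2 : T ≤ p + h p) : T + h p - p ≤ boundaryLoss h k T := by
  have hp : p ∈ Finset.range (T + k) := by
    have := hk p
    simp only [Finset.mem_range]; omega
  have := Finset.le_sup (f := fun p => if p < T + h p ∧ T ≤ p + h p then T + h p - p else 0) hp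
  simpa [boundaryLoss, h1, h2] using this

theorem boundaryLoss_le_sum {h : ℕ → ℕ} {k : ℕ} (hk : ∀ p, h p ≤ k) {T a b : ℕ}
    (ha : a + k ≤ T) (hb : T + k ≤ b) :
    boundaryLoss h k T ≤
      ∑ p ∈ Finset.Ico a b, if p < T + h p ∧ T ≤ p + h p then T + h p - p else 0 := by
  refine Finset.sup_le fun p _ => ?_
  by_cases hp : p < T + h p ∧ T ≤ p + h p
  · have hmem : p ∈ Finset.Ico a b := by
      have := hk p
      simp only [Finset.mem_Ico]; omega
    exact Finset.single_le_sum
      (f := fun p => if p < T + h p ∧ T ≤ p + h p then T + h p - p else 0)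
      (fun _ _ => Nat.zero_le _) hmem
  · simp [hp]

theorem exists_of_boundaryLoss_ne_zero {h : ℕ → ℕ} {k : ℕ} {T : ℕ}
    (hT : boundaryLoss h k T ≠ 0) : ∃ p, p < T + h p ∧ T ≤ p + h p := by
  by_contra! hcon
  apply hT
  rw [← Nat.le_zero]
  refine Finset.sup_le fun p _ => ?_
  rw [if_neg]
  rintro ⟨h1, h2⟩
  exact absurd h2 (by simpa using hcon p h1)

section Column

variable (C : Finset ℕ) (s p q : ℕ)

theorem injOn_half :
    Set.InjOn (fun r => (s + 2 * r + 2 + q - p) / 2)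
      (C.filter fun r => p < s + 2 * r + 1 + q ∧ s + 2 * r + 1 ≤ p + q) := by
  intro r hr r' hr' heq
  simp only [Finset.coe_filter, Set.mem_ofPred_eq] at hr hr' heq
  omega

theorem image_half_subset :
    (C.filter fun r => p < s + 2 * r + 1 + q ∧ s + 2 * r + 1 ≤ p + q).image
      (fun r => (s + 2 * r + 2 + q - p) / 2) ⊆ Finset.Icc 1 q := by
  intro x hx
  simp only [Finset.mem_image, Finset.mem_filter] at hx
  obtain ⟨r, hr, rfl⟩ := hx
  simp only [Finset.mem_Icc]
  omega

theorem card_filter_crossing_le :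
    (C.filter fun r => p < s + 2 * r + 1 + q ∧ s + 2 * r + 1 ≤ p + q).card ≤ q := by
  rw [← Finset.card_image_of_injOn (injOn_half C s p q)]
  simpa using Finset.card_le_card (image_half_subset C s p q)

theorem sum_filter_crossing_le :
    ∑ r ∈ C.filter (fun r => p < s + 2 * r + 1 + q ∧ s + 2 * r + 1 ≤ p + q),
      (s + 2 * r + 1 + q - p) ≤ (q + 1) * q := by
  calc _ ≤ ∑ r ∈ C.filter (fun r => p < s + 2 * r + 1 + q ∧ s + 2 * r + 1 ≤ p + q),
        2 * ((s + 2 * r + 2 + q - p) / 2) := Finset.sum_le_sum fun r hr => by omega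
    _ = ∑ x ∈ (C.filter fun r => p < s + 2 * r + 1 + q ∧ s + 2 * r + 1 ≤ p + q).image
        (fun r => (s + 2 * r + 2 + q - p) / 2), 2 * x :=
        (Finset.sum_image (f := fun x => 2 * x) (injOn_half C s p q)).symm
    _ ≤ ∑ x ∈ Finset.Icc 1 q, 2 * x :=
        Finset.sum_le_sum_of_subset (image_half_subset C s p q)
    _ ≤ ∑ x ∈ Finset.range (q + 1), 2 * x := Finset.sum_le_sum_of_subset fun x hx => by
        simp only [Finset.mem_Icc] at hx
        simp only [Finset.mem_range]; omega
    _ = (q + 1) * q := by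
        rw [← Finset.mul_sum, mul_comm, Finset.sum_range_id_mul_two, Nat.add_sub_cancel]

end Column

section Losses

variable {h : ℕ → ℕ} {k ρ R s : ℕ} {C : Finset ℕ}

theorem card_le_of_forall_boundaryLoss_ne_zero (hk : ∀ p, h p ≤ k)
    (hC : ∀ r ∈ C, ρ ≤ r ∧ r ≤ R) (hbad : ∀ r ∈ C, boundaryLoss h k (s + 2 * r + 1) ≠ 0) :
    C.card ≤ ∑ p ∈ Finset.Ico (s + 2 * ρ + 1 - k) (s + 2 * R + 1 + k), h p := by
  calc C.card = ∑ r ∈ C, 1 := by simp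
    _ ≤ ∑ r ∈ C, ∑ p ∈ Finset.Ico (s + 2 * ρ + 1 - k) (s + 2 * R + 1 + k),
        (if p < s + 2 * r + 1 + h p ∧ s + 2 * r + 1 ≤ p + h p then 1 else 0) := by
        refine Finset.sum_le_sum fun r hr => ?_
        obtain ⟨p, h1, h2⟩ := exists_of_boundaryLoss_ne_zero (hbad r hr)
        have hmem : p ∈ Finset.Ico (s + 2 * ρ + 1 - k) (s + 2 * R + 1 + k) := by
          have := hk p
          have := hC r hr
          simp only [Finset.mem_Ico]; omega
        have := Finset.single_le_sum
          (f := fun p => if p < s + 2 * r + 1 + h p ∧ s + 2 * r + 1 ≤ p + h p then 1 else 0)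
          (fun _ _ => Nat.zero_le _) hmem
        simpa [h1, h2] using this
    _ = ∑ p ∈ Finset.Ico (s + 2 * ρ + 1 - k) (s + 2 * R + 1 + k),
        (C.filter fun r => p < s + 2 * r + 1 + h p ∧ s + 2 * r + 1 ≤ p + h p).card := by
        rw [Finset.sum_comm]
        simp only [Finset.card_filter]
    _ ≤ _ := Finset.sum_le_sum fun p _ => card_filter_crossing_le C s p (h p)

theorem sum_boundaryLoss_le (hk : ∀ p, h p ≤ k) (hkρ : k ≤ ρ)
    (hC : ∀ r ∈ C, ρ ≤ r ∧ r ≤ R) :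
    ∑ r ∈ C, boundaryLoss h k (s + 2 * r + 1) ≤
      (k + 1) * ∑ p ∈ Finset.Ico (s + 2 * ρ + 1 - k) (s + 2 * R + 1 + k), h p := by
  calc _ ≤ ∑ r ∈ C, ∑ p ∈ Finset.Ico (s + 2 * ρ + 1 - k) (s + 2 * R + 1 + k),
        (if p < s + 2 * r + 1 + h p ∧ s + 2 * r + 1 ≤ p + h p
          then s + 2 * r + 1 + h p - p else 0) := by
        refine Finset.sum_le_sum fun r hr => boundaryLoss_le_sum hk ?_ ?_ <;>
        · have := hC r hr
          omega
    _ = ∑ p ∈ Finset.Ico (s + 2 * ρ + 1 - k) (s + 2 * R + 1 + k),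
        ∑ r ∈ C.filter (fun r => p < s + 2 * r + 1 + h p ∧ s + 2 * r + 1 ≤ p + h p),
          (s + 2 * r + 1 + h p - p) := by
        rw [Finset.sum_comm]
        simp only [Finset.sum_filter]
    _ ≤ ∑ p ∈ Finset.Ico (s + 2 * ρ + 1 - k) (s + 2 * R + 1 + k), (k + 1) * h p :=
        Finset.sum_le_sum fun p _ => (sum_filter_crossing_le C s p (h p)).trans
          (Nat.mul_le_mul_right _ (Nat.succ_le_succ (hk p)))
    _ = _ := by rw [Finset.mul_sum]

end Losses

/-- The column at position `p` of height `h p` lies in the interval of radius `r` around `c`. -/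
def ColumnCovered (h : ℕ → ℕ) (p c r : ℕ) : Prop := p + h p ≤ c + r ∧ c + h p ≤ p + r

/-- Intervals whose radii form the set `U` cover all columns starting to the left of `s`, where
the total length of the intervals exceeds `s` by `l`, and the columns located well before the
next boundary have total height at least `l + σ`. -/
structure PartialCover (h : ℕ → ℕ) (k ρ : ℕ) (U : Finset ℕ) (s l σ : ℕ) : Prop where
  length : s + l = ∑ r ∈ U, (2 * r + 1)
  cover : ∃ c : ℕ → ℕ, ∀ p, p < s + h p → ∃ r ∈ U, ColumnCovered h p (c r) r
  slack : l + σ ≤ colSum h (s + 2 * ρ + 1 - k)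

/-- The `M` largest radii up to `R` cover a prefix `[0, e)` of columns which is heavy enough. -/
def HasHeavyPrefix (h : ℕ → ℕ) (R : ℕ) : Prop :=
  ∃ (M : ℕ) (c : ℕ → ℕ) (e : ℕ), 1 ≤ M ∧ M ≤ R + 1 ∧
    (∀ p < e, ∃ r ∈ Finset.Ico (R + 1 - M) (R + 1), ColumnCovered h p (c r) r) ∧
    ∑ r ∈ Finset.Ico (R + 1 - M) (R + 1), (2 * r + 1) ≤ e + colSum h e

theorem PartialCover.empty {h : ℕ → ℕ} (hp : ∀ p, h p ≤ p) (k ρ : ℕ) :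
    PartialCover h k ρ ∅ 0 0 0 where
  length := by simp
  cover := ⟨id, fun p hlt => by have := hp p; omega⟩
  slack := Nat.zero_le _

theorem exists_cover_insert {h : ℕ → ℕ} {U : Finset ℕ} {s r : ℕ} (Q : ℕ → Prop) (hr : r ∉ U)
    (hcov : ∃ c : ℕ → ℕ, ∀ p, p < s + h p → ∃ r ∈ U, ColumnCovered h p (c r) r)
    (hQ : ∀ p, Q p → p + h p < s + 2 * r + 1) :
    ∃ c : ℕ → ℕ, ∀ p, Q p → ∃ r' ∈ insert r U, ColumnCovered h p (c r') r' := by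
  obtain ⟨c, hc⟩ := hcov
  refine ⟨Function.update c r (s + r), fun p hp => ?_⟩
  by_cases hps : p < s + h p
  · obtain ⟨r', hr', hcc⟩ := hc p hps
    refine ⟨r', Finset.mem_insert_of_mem hr', ?_⟩
    rwa [Function.update_of_ne (by rintro rfl; exact hr hr')]
  · refine ⟨r, Finset.mem_insert_self _ _, ?_⟩
    have := hQ p hp
    simp only [Function.update_self, ColumnCovered]
    omega

section Greedy

variable {h : ℕ → ℕ} {k ρ R s l σ : ℕ} {U : Finset ℕ}

theorem PartialCover.step (hk : ∀ p, h p ≤ k) (hρ : R + 2 * k ≤ 2 * ρ)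
    (st : PartialCover h k ρ U s l σ) {r : ℕ} (hr : r ∉ U) (hr1 : ρ ≤ r) (hr2 : r ≤ R)
    (hloss : boundaryLoss h k (s + 2 * r + 1) ≤
      σ + ∑ p ∈ Finset.Ico (s + 2 * ρ + 1 - k) (s + 2 * R + 1 + k), h p) :
    PartialCover h k ρ (insert r U) (s + 2 * r + 1 - boundaryLoss h k (s + 2 * r + 1))
      (l + boundaryLoss h k (s + 2 * r + 1))
      (σ + ∑ p ∈ Finset.Ico (s + 2 * ρ + 1 - k) (s + 2 * R + 1 + k), h p
        - boundaryLoss h k (s + 2 * r + 1)) := by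
  have hle := boundaryLoss_le hk (s + 2 * r + 1)
  refine ⟨?_, exists_cover_insert (fun p => p < _ + h p) hr st.cover fun p hp => ?_, ?_⟩
  · rw [Finset.sum_insert hr, ← st.length]
    omega
  · by_contra hcon
    have := le_boundaryLoss hk (T := s + 2 * r + 1) (p := p) (by omega) (by omega)
    omega
  · have hsplit : colSum h (s + 2 * ρ + 1 - k) +
        ∑ p ∈ Finset.Ico (s + 2 * ρ + 1 - k) (s + 2 * R + 1 + k), h p =
        colSum h (s + 2 * R + 1 + k) := Finset.sum_range_add_sum_Ico _ (by omega)
    have hmono := colSum_mono h (x := s + 2 * R + 1 + k)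
      (y := s + 2 * r + 1 - boundaryLoss h k (s + 2 * r + 1) + 2 * ρ + 1 - k) (by omega)
    have := st.slack
    omega

/-- If `i + 1` of the `M` largest radii are unused and there is enough slack, then always using
the radius with the least boundary loss leads to a heavy prefix. -/
theorem HasHeavyPrefix.of_partialCover (hk : ∀ p, h p ≤ k) (hρ : R + 2 * k ≤ 2 * ρ) :
    ∀ (i : ℕ) (U : Finset ℕ) (s l σ M : ℕ), PartialCover h k ρ U s l σ → M ≤ R + 1 →
      ρ ≤ R + 1 - M → U ⊆ Finset.Ico (R + 1 - M) (R + 1) →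
      (Finset.Ico (R + 1 - M) (R + 1) \ U).card = i + 1 →
      k ^ 2 + 1 ≤ σ + k + (k - (i + 1)) ^ 2 → HasHeavyPrefix h R := by
  intro i
  induction i with
  | zero =>
    intro U s l σ M st hM hρM hU hcard hσ
    obtain ⟨r, hr⟩ := Finset.card_eq_one.mp hcard
    have hmem : r ∈ Finset.Ico (R + 1 - M) (R + 1) \ U := hr ▸ Finset.mem_singleton_self r
    rw [Finset.mem_sdiff, Finset.mem_Ico] at hmem
    have hins : insert r U = Finset.Ico (R + 1 - M) (R + 1) := by
      rw [← Finset.union_sdiff_of_subset hU, hr, Finset.union_comm, Finset.insert_eq]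
    obtain ⟨c, hc⟩ := exists_cover_insert (fun p => p < s + 2 * r + 1 - k) hmem.2 st.cover
      fun p hp => by have := hk p; omega
    rw [hins] at hc
    refine ⟨M, c, s + 2 * r + 1 - k, by omega, hM, hc, ?_⟩
    have hσk : k ≤ σ := by
      rcases k with _ | k
      · omega
      · simp only [zero_add, Nat.add_sub_cancel] at hσ
        nlinarith
    rw [← hins, Finset.sum_insert hmem.2, ← st.length]
    have hmono := colSum_mono h (x := s + 2 * ρ + 1 - k) (y := s + 2 * r + 1 - k) (by omega)
    have := st.slack
    omega
  | succ j ih =>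
    intro U s l σ M st hM hρM hU hcard hσ
    obtain ⟨r, hrC, hrmin⟩ := Finset.exists_min_image (Finset.Ico (R + 1 - M) (R + 1) \ U)
      (fun r => boundaryLoss h k (s + 2 * r + 1)) (Finset.card_pos.mp (by omega))
    have hC : ∀ r ∈ Finset.Ico (R + 1 - M) (R + 1) \ U, ρ ≤ r ∧ r ≤ R := by
      intro r hr
      rw [Finset.mem_sdiff, Finset.mem_Ico] at hr
      omega
    have hkρ : k ≤ ρ := by have := hC r hrC; omega
    have hsum := (Finset.card_nsmul_le_sum _ _ _ hrmin).trans (sum_boundaryLoss_le hk hkρ hC)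
    rw [hcard, smul_eq_mul] at hsum
    have hℓ := boundaryLoss_le hk (s + 2 * r + 1)
    have hstep := st.step hk hρ (Finset.mem_sdiff.mp hrC).2 (hC r hrC).1 (hC r hrC).2
    have hcard' : (Finset.Ico (R + 1 - M) (R + 1) \ insert r U).card = j + 1 := by
      rw [Finset.sdiff_insert, Finset.card_erase_of_mem hrC, hcard, Nat.add_sub_cancel]
    have hsub : insert r U ⊆ Finset.Ico (R + 1 - M) (R + 1) :=
      Finset.insert_subset (Finset.mem_sdiff.mp hrC).1 hU
    generalize boundaryLoss h k (s + 2 * r + 1) = ℓ at *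
    generalize ∑ p ∈ Finset.Ico (s + 2 * ρ + 1 - k) (s + 2 * R + 1 + k), h p = y at *
    have key : ℓ ≤ σ + y ∧ k ^ 2 + 1 ≤ (σ + y - ℓ) + k + (k - (j + 1)) ^ 2 := by
      rcases le_or_gt (j + 2) k with hjk | hjk
      · obtain ⟨t, rfl⟩ := Nat.exists_eq_add_of_le hjk
        have e1 : j + 2 + t - (j + 1 + 1) = t := by omega
        have e2 : j + 2 + t - (j + 1) = t + 1 := by omega
        rw [e1] at hσ
        rw [e2]
        have hy : ℓ ≤ y + 2 * t + 1 := by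
          by_contra! hcon
          nlinarith
        have hσt : 2 * t + 1 ≤ σ := by nlinarith
        refine ⟨by omega, ?_⟩
        have : σ ≤ σ + y - ℓ + (2 * t + 1) := by omega
        nlinarith
      · have hy : ℓ ≤ y := by
          by_contra! hcon
          nlinarith
        have e1 : k - (j + 1 + 1) = 0 := by omega
        rw [e1] at hσ
        have : σ ≤ σ + y - ℓ := by omega
        exact ⟨by omega, by nlinarith⟩
    exact ih _ _ _ _ M (hstep key.1) hM hρM hsub hcard' key.2

/-- Using the largest radius without boundary loss, or the largest radius if there is none,
increases the slack until it is sufficient, unless a heavy prefix is found on the way. -/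
theorem exists_partialCover (hk : ∀ p, h p ≤ k) (hp : ∀ p, h p ≤ p) (hρ : R + 2 * k ≤ 2 * ρ)
    (hN : k ^ 2 + 1 + k + ρ ≤ R) :
    ∀ t, t + k ≤ k ^ 2 + 1 → HasHeavyPrefix h R ∨
      ∃ (U : Finset ℕ) (s l σ M : ℕ), PartialCover h k ρ U s l σ ∧
        U ⊆ Finset.Ico (R + 1 - M) (R + 1) ∧ U.card = t ∧ M + ρ ≤ R + 1 ∧ t ≤ σ ∧ M ≤ σ + 1 := by
  intro t
  induction t with
  | zero =>
    intro _
    exact Or.inr ⟨∅, 0, 0, 0, 0, PartialCover.empty hp k ρ, by simp, by simp, by omega, by omega,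
      by omega⟩
  | succ t ih =>
    intro ht
    obtain hwin | ⟨U, s, l, σ, M, st, hU, hcard, hMρ, htσ, hMσ⟩ := ih (by omega)
    · exact Or.inl hwin
    have hUR : ∀ r ∈ U, R + 1 - M ≤ r ∧ r ≤ R := fun r hr => by
      have := Finset.mem_Ico.mp (hU hr)
      omega
    have hUρ : U ⊆ Finset.Ico ρ (R + 1) := hU.trans (Finset.Ico_subset_Ico_left (by omega))
    set C := Finset.Ico ρ (R + 1) \ U with hCdef
    have hCmem : ∀ r ∈ C, (ρ ≤ r ∧ r ≤ R) ∧ r ∉ U := by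
      intro r hr
      rw [hCdef, Finset.mem_sdiff, Finset.mem_Ico] at hr
      exact ⟨⟨hr.1.1, Nat.le_of_lt_succ hr.1.2⟩, hr.2⟩
    have hCcard : C.card = R + 1 - ρ - t := by
      rw [hCdef, Finset.card_sdiff_of_subset hUρ, Nat.card_Ico, hcard]
    have hkρ : k ≤ ρ := by omega
    have hsub : ∀ r, r ≤ R → insert r U ⊆ Finset.Ico (R + 1 - max M (R + 1 - r)) (R + 1) := by
      intro r hrR x hx
      rw [Finset.mem_insert] at hx
      rw [Finset.mem_Ico]
      rcases hx with rfl | hx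
      · omega
      · have := hUR x hx; omega
    have htail : ∀ r ∈ C, R - r ≤ (C.filter (r < ·)).card + t := by
      intro r hr
      have hcov : Finset.Ioc r R ⊆ C.filter (r < ·) ∪ U := by
        intro x hx
        have := (hCmem r hr).1
        rw [Finset.mem_Ioc] at hx
        simp only [hCdef, Finset.mem_union, Finset.mem_filter, Finset.mem_sdiff, Finset.mem_Ico]
        by_cases hxU : x ∈ U
        · exact Or.inr hxU
        · exact Or.inl ⟨⟨⟨by omega, by omega⟩, hxU⟩, hx.1⟩
      have := (Finset.card_le_card hcov).trans (Finset.card_union_le _ _)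
      rwa [Nat.card_Ioc, hcard] at this
    by_cases hgood : ∃ r ∈ C, boundaryLoss h k (s + 2 * r + 1) = 0
    · obtain ⟨r, hr, hrmax⟩ := Finset.exists_max_image
        (C.filter fun r => boundaryLoss h k (s + 2 * r + 1) = 0) id
        (hgood.imp fun r hr => Finset.mem_filter.mpr hr)
      obtain ⟨hrC, hr0⟩ := Finset.mem_filter.mp hr
      obtain ⟨⟨hρr, hrR⟩, hrU⟩ := hCmem r hrC
      have st' := st.step hk hρ hrU hρr hrR (by omega)
      have hblocked := card_le_of_forall_boundaryLoss_ne_zero (s := s) (C := C.filter (r < ·)) hk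
        (fun x hx => (hCmem x (Finset.mem_filter.mp hx).1).1) fun x hx hx0 => by
          rw [Finset.mem_filter] at hx
          exact absurd (hrmax x (Finset.mem_filter.mpr ⟨hx.1, hx0⟩)) (not_le_of_gt hx.2)
      have htl := htail r hrC
      have hl := st.slack
      have hmono := colSum_mono h (x := s + 2 * ρ + 1 - k) (y := s + 2 * r + 1) (by omega)
      rw [hr0] at st'
      simp only [Nat.sub_zero, Nat.add_zero] at st'
      generalize ∑ p ∈ Finset.Ico (s + 2 * ρ + 1 - k) (s + 2 * R + 1 + k), h p = y at *
      have hM' : max M (R + 1 - r) ≤ R + 1 := by omega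
      by_cases hall : insert r U = Finset.Ico (R + 1 - max M (R + 1 - r)) (R + 1)
      · left
        obtain ⟨c, hc⟩ := st'.cover
        refine ⟨max M (R + 1 - r), c, s + 2 * r + 1, by omega, hM', fun p hp => ?_, ?_⟩
        · rw [← hall]
          exact hc p (by omega)
        · rw [← hall, ← st'.length]
          omega
      · right
        have hlt := Finset.card_lt_card ((hsub r hrR).ssubset_of_ne hall)
        rw [Finset.card_insert_of_notMem hrU, hcard, Nat.card_Ico] at hlt
        exact ⟨_, _, _, _, _, st', hsub r hrR,
          by rw [Finset.card_insert_of_notMem hrU, hcard], by omega, by omega, by omega⟩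
    · push Not at hgood
      right
      obtain ⟨r, hrC, hrmax⟩ := Finset.exists_max_image C id (Finset.card_pos.mp (by omega))
      obtain ⟨⟨hρr, hrR⟩, hrU⟩ := hCmem r hrC
      have hy := card_le_of_forall_boundaryLoss_ne_zero hk (fun x hx => (hCmem x hx).1) hgood
      have hloss := boundaryLoss_le hk (s + 2 * r + 1)
      have hfilter : C.filter (r < ·) = ∅ :=
        Finset.filter_eq_empty_iff.mpr fun x hx => not_lt_of_ge (hrmax x hx)
      have htl := htail r hrC
      rw [hfilter, Finset.card_empty] at htl
      have st' := st.step hk hρ hrU hρr hrR (by omega)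
      exact ⟨_, _, _, _, _, st', hsub r hrR,
        by rw [Finset.card_insert_of_notMem hrU, hcard], by omega, by omega, by omega⟩

end Greedy

/-- Some of the largest radii cover a prefix which is heavy enough, provided that the heights are
bounded and grow slowly. -/
theorem hasHeavyPrefix {h : ℕ → ℕ} {k R : ℕ} (hk : ∀ p, h p ≤ k) (hp : ∀ p, h p ≤ p)
    (hR : 2 * k ^ 2 + 4 * k + 3 ≤ R) : HasHeavyPrefix h R := by
  have hkk : k ≤ k ^ 2 + 1 := by nlinarith
  have hρ : R + 2 * k ≤ 2 * (R - (k ^ 2 + 1 + k)) := by omega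
  obtain hwin | ⟨U, s, l, σ, M, st, hU, hcard, hMρ, htσ, hMσ⟩ :=
    exists_partialCover hk hp hρ (by omega) (k ^ 2 + 1 - k) (by omega)
  · exact hwin
  have fin : ∀ M', M' + (R - (k ^ 2 + 1 + k)) ≤ R + 1 → U ⊆ Finset.Ico (R + 1 - M') (R + 1) →
      U.card < M' → HasHeavyPrefix h R := by
    intro M' hM' hU' hlt
    refine HasHeavyPrefix.of_partialCover hk hρ (M' - U.card - 1) U s l σ M' st (by omega)
      (by omega) hU' ?_ (by omega)
    rw [Finset.card_sdiff_of_subset hU', Nat.card_Ico]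
    omega
  have hle := Finset.card_le_card hU
  rw [Nat.card_Ico] at hle
  rcases eq_or_lt_of_le hle with heq | hlt
  · refine fin (M + 1) (by omega) (hU.trans (Finset.Ico_subset_Ico_left (by omega))) (by omega)
  · exact fin M hMρ hU (by omega)

/-- The vertices `p 0, …, p m` form a path within distance `k` of every vertex. -/
structure IsSpine {V : Type*} (G : SimpleGraph V) (k : ℕ) (p : ℕ → V) (m : ℕ) : Prop where
  adj : ∀ i < m, G.Adj (p i) (p (i + 1))
  inj : Set.InjOn p (Set.Iic m)
  cover : ∀ x, ∃ i ≤ m, G.dist (p i) x ≤ k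

/-- Every vertex `x` hangs at depth `d x ≤ k` below the vertex `p (π x)` of the path
`p 0, …, p m`, and `par x` is the next vertex on the way to it. -/
structure IsComb {V : Type*} (G : SimpleGraph V) (k : ℕ) (p : ℕ → V) (m : ℕ) (π d : V → ℕ)
    (par : V → V) : Prop where
  adj : ∀ i < m, G.Adj (p i) (p (i + 1))
  proj_le : ∀ x, π x ≤ m
  depth_le : ∀ x, d x ≤ k
  eq_of_depth : ∀ x, d x = 0 → p (π x) = x
  proj_spine : ∀ i ≤ m, π (p i) = i
  depth_spine : ∀ i ≤ m, d (p i) = 0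
  par_adj : ∀ x, d x ≠ 0 → G.Adj (par x) x
  par_proj : ∀ x, d x ≠ 0 → π (par x) = π x
  par_depth : ∀ x, d x ≠ 0 → d (par x) + 1 = d x

section Spine

variable {V : Type*} {G : SimpleGraph V} {k m : ℕ} {p : ℕ → V}

theorem GrowthLE.exists_isSpine (hG : GrowthLE G k) : ∃ p m, IsSpine G k p m := by
  obtain ⟨a, b, P, hP, hx⟩ := hG
  refine ⟨P.getVert, P.length, fun i hi => P.adj_getVert_succ hi, hP.getVert_injOn, fun x => ?_⟩
  obtain ⟨y, hy, hyx⟩ := hx x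
  obtain ⟨i, rfl, hi⟩ := Walk.mem_support_iff_exists_getVert.mp hy
  exact ⟨i, hi, hyx⟩

theorem exists_isPath_of_injOn (m : ℕ) (hadj : ∀ i < m, G.Adj (p i) (p (i + 1)))
    (hinj : Set.InjOn p (Set.Iic m)) :
    ∃ w : G.Walk (p 0) (p m), w.IsPath ∧ ∀ x, x ∈ w.support ↔ ∃ i ≤ m, p i = x := by
  induction m with
  | zero => exact ⟨Walk.nil, Walk.IsPath.nil, fun x => by simp [eq_comm]⟩
  | succ m ih =>
    obtain ⟨w, hw, hs⟩ := ih (fun i hi => hadj i (by omega))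
      (hinj.mono (Set.Iic_subset_Iic.mpr (by omega)))
    refine ⟨w.concat (hadj m (by omega)), hw.concat ?_ _, fun x => ?_⟩
    · rw [hs]
      rintro ⟨i, hi, heq⟩
      have := hinj (Set.mem_Iic.mpr (by omega)) (Set.mem_Iic.mpr le_rfl) heq
      omega
    · rw [Walk.support_concat, List.mem_append, hs, List.mem_singleton]
      constructor
      · rintro (⟨i, hi, rfl⟩ | rfl)
        · exact ⟨i, by omega, rfl⟩
        · exact ⟨m + 1, le_rfl, rfl⟩
      · rintro ⟨i, hi, rfl⟩
        rcases Nat.le_succ_iff.mp hi with hi | rfl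
        · exact Or.inl ⟨i, hi, rfl⟩
        · exact Or.inr rfl

theorem IsSpine.growthLE (hp : IsSpine G k p m) : GrowthLE G k := by
  obtain ⟨w, hw, hs⟩ := exists_isPath_of_injOn m hp.adj hp.inj
  refine ⟨_, _, w, hw, fun x => ?_⟩
  obtain ⟨i, hi, hix⟩ := hp.cover x
  exact ⟨p i, (hs _).mpr ⟨i, hi, rfl⟩, hix⟩

theorem IsSpine.lt_card [Fintype V] (hp : IsSpine G k p m) : m < Fintype.card V := by
  classical
  have hinj : Set.InjOn p (Finset.range (m + 1)) := fun i hi j hj =>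
    hp.inj (by simpa [Nat.lt_succ_iff] using hi) (by simpa [Nat.lt_succ_iff] using hj)
  have := Finset.card_le_univ ((Finset.range (m + 1)).image p)
  rwa [Finset.card_image_of_injOn hinj, Finset.card_range] at this

theorem exists_adj_dist_add_one (hG : G.Connected) {u v : V} (huv : G.dist u v ≠ 0) :
    ∃ w, G.Adj w v ∧ G.dist u w + 1 = G.dist u v := by
  obtain ⟨q, hq⟩ := hG.exists_walk_length_eq_dist v u
  rw [G.dist_comm] at huv ⊢
  cases q with
  | nil => simp at huv
  | @cons _ w _ hadj q =>
    refine ⟨w, hadj.symm, ?_⟩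
    have h1 := dist_le q
    have h2 := hG.dist_triangle (u := v) (v := w) (w := u)
    rw [dist_eq_one_iff_adj.mpr hadj] at h2
    rw [Walk.length_cons] at hq
    rw [G.dist_comm (u := u)]
    omega

theorem IsSpine.exists_isComb (hG : G.Connected) (hp : IsSpine G k p m) :
    ∃ π d par, IsComb G k p m π d par := by
  have hex : ∀ x, ∃ i ≤ m, (∀ j ≤ m, G.dist (p i) x ≤ G.dist (p j) x) ∧
      ∀ j < i, G.dist (p i) x < G.dist (p j) x := by
    classical
    intro x
    have hmin : ∃ i, i ≤ m ∧ ∀ j ≤ m, G.dist (p i) x ≤ G.dist (p j) x := by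
      obtain ⟨i, hi, hmin⟩ := Finset.exists_min_image (Finset.range (m + 1))
        (fun i => G.dist (p i) x) ⟨0, by simp⟩
      simp only [Finset.mem_range, Nat.lt_succ_iff] at hi hmin
      exact ⟨i, hi, hmin⟩
    refine ⟨Nat.find hmin, (Nat.find_spec hmin).1, (Nat.find_spec hmin).2, fun j hj => ?_⟩
    by_contra! hcon
    have hle := (Nat.find_spec hmin).1
    exact Nat.find_min hmin hj ⟨by omega, fun i hi => hcon.trans ((Nat.find_spec hmin).2 i hi)⟩
  choose π hπm hπ1 hπ2 using hex
  have huniq : ∀ x i, i ≤ m → (∀ j ≤ m, G.dist (p i) x ≤ G.dist (p j) x) →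
      (∀ j < i, G.dist (p i) x < G.dist (p j) x) → π x = i := by
    intro x i hi h1 h2
    rcases lt_trichotomy (π x) i with hlt | heq | hlt
    · exact absurd (hπ1 x i hi) (not_le_of_gt (h2 _ hlt))
    · exact heq
    · exact absurd (h1 _ (hπm x)) (not_le_of_gt (hπ2 x _ hlt))
  have hpar : ∀ x, ∃ y, G.dist (p (π x)) x ≠ 0 →
      G.Adj y x ∧ G.dist (p (π x)) y + 1 = G.dist (p (π x)) x := by
    intro x
    by_cases hx : G.dist (p (π x)) x = 0
    · exact ⟨x, fun h => absurd hx h⟩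
    · obtain ⟨y, hy⟩ := exists_adj_dist_add_one hG hx
      exact ⟨y, fun _ => hy⟩
  choose par hpar using hpar
  have hparπ : ∀ x, G.dist (p (π x)) x ≠ 0 → π (par x) = π x := by
    intro x hx
    obtain ⟨hadj, hd⟩ := hpar x hx
    have htri : ∀ j, G.dist (p j) x ≤ G.dist (p j) (par x) + 1 := fun j => by
      have := hG.dist_triangle (u := p j) (v := par x) (w := x)
      rwa [dist_eq_one_iff_adj.mpr hadj] at this
    refine huniq _ _ (hπm x) (fun j hj => ?_) fun j hj => ?_
    · have := hπ1 x j hj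
      have := htri j
      omega
    · have := hπ2 x j hj
      have := htri j
      omega
  have hspine : ∀ i ≤ m, π (p i) = i := by
    intro i hi
    have := hπ1 (p i) i hi
    rw [dist_self, Nat.le_zero, hG.dist_eq_zero_iff] at this
    exact hp.inj (hπm _) hi this
  refine ⟨π, fun x => G.dist (p (π x)) x, par, hp.adj, hπm, fun x => ?_, fun x hx => ?_, hspine,
    fun i hi => ?_, fun x hx => (hpar x hx).1, hparπ, fun x hx => ?_⟩
  · obtain ⟨i, hi, hx⟩ := hp.cover x
    exact (hπ1 x i hi).trans hx
  · exact hG.dist_eq_zero_iff.mp hx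
  · simp only [hspine i hi, dist_self]
  · simp only [hparπ x hx]
    exact (hpar x hx).2

end Spine

section Comb

variable {V : Type*} {G : SimpleGraph V} {k m : ℕ} {p : ℕ → V} {π d : V → ℕ} {par : V → V}

theorem IsComb.spine_dist (hc : IsComb G k p m π d par) {a b : ℕ} (hab : a ≤ b) (hb : b ≤ m) :
    G.Reachable (p a) (p b) ∧ G.dist (p a) (p b) ≤ b - a := by
  suffices ∃ w : G.Walk (p a) (p b), w.length ≤ b - a by
    obtain ⟨w, hw⟩ := this
    exact ⟨w.reachable, (dist_le w).trans hw⟩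
  induction b, hab using Nat.le_induction with
  | base => exact ⟨Walk.nil, by simp⟩
  | succ b hab ih =>
    obtain ⟨w, hw⟩ := ih (by omega)
    refine ⟨w.concat (hc.adj b (by omega)), ?_⟩
    rw [Walk.length_concat]
    omega

theorem IsComb.exists_walk (hc : IsComb G k p m π d par) (x : V) :
    ∃ w : G.Walk (p (π x)) x, w.length = d x := by
  generalize hd : d x = n
  induction n generalizing x with
  | zero => exact ⟨Walk.nil.copy rfl (hc.eq_of_depth x hd), by simp⟩
  | succ n ih =>
    have h0 : d x ≠ 0 := by omega
    have hpd := hc.par_depth x h0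
    obtain ⟨w, hw⟩ := ih (par x) (by omega)
    exact ⟨(w.copy (by rw [hc.par_proj x h0]) rfl).concat (hc.par_adj x h0), by simp [hw]⟩

theorem IsComb.connected (hc : IsComb G k p m π d par) : G.Connected := by
  have h0 : ∀ x, G.Reachable (p 0) x := fun x =>
    (hc.spine_dist (Nat.zero_le _) (hc.proj_le x)).1.trans (hc.exists_walk x).choose.reachable
  exact (connected_iff_exists_forall_reachable G).mpr ⟨p 0, h0⟩

theorem IsComb.dist_spine_le (hc : IsComb G k p m π d par) (x : V) {i : ℕ} (hi : i ≤ m) :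
    G.dist (p i) x ≤ (i - π x) + (π x - i) + d x := by
  obtain ⟨w, hw⟩ := hc.exists_walk x
  have h1 := dist_le w
  have h2 := hc.connected.dist_triangle (u := p i) (v := p (π x)) (w := x)
  have h3 : G.dist (p i) (p (π x)) ≤ (i - π x) + (π x - i) := by
    rcases le_total i (π x) with hle | hle
    · have := (hc.spine_dist hle (hc.proj_le x)).2
      omega
    · have := (hc.spine_dist hle hi).2
      rw [G.dist_comm]
      omega
  omega

theorem IsComb.isSpine (hc : IsComb G k p m π d par) : IsSpine G k p m where
  adj := hc.adj
  inj i hi j hj hij := by rw [← hc.proj_spine i hi, hij, hc.proj_spine j hj]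
  cover x := ⟨π x, hc.proj_le x, by
    have := hc.dist_spine_le x (hc.proj_le x)
    have := hc.depth_le x
    omega⟩

theorem IsComb.iterate_par (hc : IsComb G k p m π d par) (x : V) {j : ℕ} (hj : j ≤ d x) :
    π (par^[j] x) = π x ∧ d (par^[j] x) + j = d x := by
  induction j with
  | zero => simp
  | succ j ih =>
    obtain ⟨h1, h2⟩ := ih (by omega)
    have h0 : d (par^[j] x) ≠ 0 := by omega
    rw [Function.iterate_succ_apply', hc.par_proj _ h0, h1]
    have := hc.par_depth _ h0
    exact ⟨rfl, by omega⟩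

/-- If a branch is longer than the part of the spine before it, and this is not the case for the
branches before, then rerouting the spine through this branch makes the spine longer. -/
theorem IsComb.exists_longer_spine (hc : IsComb G k p m π d par) {x : V} (hx : π x < d x)
    (hbefore : ∀ u, π u < π x → d u ≤ π u) : ∃ p' m', IsSpine G k p' m' ∧ m < m' := by
  have hxm := hc.proj_le x
  have hpath : ∀ j < d x, π (par^[j] x) = π x ∧ d (par^[j] x) + j = d x := fun j hj =>
    hc.iterate_par x hj.le
  have hend : par^[d x] x = p (π x) := by
    obtain ⟨h1, h2⟩ := hc.iterate_par x le_rfl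
    rw [← h1, hc.eq_of_depth _ (by omega)]
  refine ⟨fun j => if j < d x then par^[j] x else p (π x + (j - d x)), d x + (m - π x),
    ⟨fun j hj => ?_, fun i hi j hj hij => ?_, fun u => ?_⟩, by omega⟩
  · rcases lt_trichotomy (j + 1) (d x) with hlt | heq | hlt
    · have := hpath j (by omega)
      simp only [hlt, show j < d x by omega, if_true]
      rw [Function.iterate_succ_apply']
      exact (hc.par_adj _ (by omega)).symm
    · have := hpath j (by omega)
      simp only [show j < d x by omega, if_true, heq, lt_irrefl, if_false, Nat.sub_self,
        Nat.add_zero]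
      rw [← hend, ← heq, Function.iterate_succ_apply']
      exact (hc.par_adj _ (by omega)).symm
    · simp only [show ¬ j < d x by omega, show ¬ j + 1 < d x by omega, if_false]
      rw [show π x + (j + 1 - d x) = π x + (j - d x) + 1 by omega]
      exact hc.adj _ (by omega)
  · rw [Set.mem_Iic] at hi hj
    have hd := congrArg d hij
    have hπ := congrArg π hij
    beta_reduce at hd hπ
    split_ifs at hd hπ with h1 h2 h2
    · have := hpath i h1
      have := hpath j h2
      omega
    · have := hpath i h1
      rw [hc.depth_spine _ (by omega)] at hd
      omega
    · have := hpath j h2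
      rw [hc.depth_spine _ (by omega)] at hd
      omega
    · rw [hc.proj_spine _ (by omega), hc.proj_spine _ (by omega)] at hπ
      omega
  · have hum := hc.proj_le u
    have huk := hc.depth_le u
    have hxk := hc.depth_le x
    rcases lt_or_ge (π u) (π x) with hlt | hge
    · refine ⟨d x, by omega, ?_⟩
      simp only [lt_irrefl, if_false, Nat.sub_self, Nat.add_zero]
      have := hc.dist_spine_le u hxm
      have := hbefore u hlt
      omega
    · refine ⟨d x + (π u - π x), by omega, ?_⟩
      simp only [show ¬ d x + (π u - π x) < d x by omega, if_false]
      rw [show π x + (d x + (π u - π x) - d x) = π u by omega]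
      have := hc.dist_spine_le u hum
      omega

theorem exists_isComb_depth_le [Fintype V] (hG : G.Connected) (hk : GrowthLE G k) :
    ∃ p m π d par, IsComb G k p m π d par ∧ ∀ x, d x ≤ π x := by
  classical
  obtain ⟨p₀, m₀, hp₀⟩ := GrowthLE.exists_isSpine hk
  have hbound : ∀ n, (∃ p, IsSpine G k p n) → n ≤ Fintype.card V := fun n ⟨_, hp⟩ => hp.lt_card.le
  obtain ⟨p, hp⟩ := Nat.findGreatest_spec (P := fun n => ∃ p, IsSpine G k p n)
    (hbound m₀ ⟨p₀, hp₀⟩) ⟨p₀, hp₀⟩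
  obtain ⟨π, d, par, hc⟩ := hp.exists_isComb hG
  refine ⟨p, _, π, d, par, hc, ?_⟩
  by_contra! hcon
  have hcon' : ∃ i x, π x = i ∧ π x < d x := hcon.elim fun x hx => ⟨π x, x, rfl, hx⟩
  obtain ⟨x, hxi, hx⟩ := Nat.find_spec hcon'
  obtain ⟨p', m', hp', hm'⟩ := hc.exists_longer_spine hx fun u hu => by
    by_contra! hlt
    exact Nat.find_min hcon' (hxi ▸ hu) ⟨u, rfl, hlt⟩
  exact Nat.findGreatest_is_greatest hm' (hbound m' ⟨p', hp'⟩) ⟨p', hp'⟩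

end Comb

/-- The depth of the deepest vertex hanging below the `i`-th vertex of the spine. -/
def height {V : Type*} [Fintype V] (π d : V → ℕ) (i : ℕ) : ℕ :=
  (Finset.univ.filter (π · = i)).sup d

section Height

variable {V : Type*} [Fintype V] {G : SimpleGraph V} {k m : ℕ} {p : ℕ → V} {π d : V → ℕ}
  {par : V → V}

theorem depth_le_height (π d : V → ℕ) (x : V) : d x ≤ height π d (π x) :=
  Finset.le_sup (f := d) (by simp)

theorem height_le {i B : ℕ} (hB : ∀ x, π x = i → d x ≤ B) : height π d i ≤ B :=
  Finset.sup_le fun x hx => hB x (Finset.mem_filter.mp hx).2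

theorem IsComb.exists_depth_eq (hc : IsComb G k p m π d par) {i j : ℕ} (hi : i ≤ m)
    (hj : j ≤ height π d i) : ∃ x, π x = i ∧ d x = j := by
  obtain ⟨x, hx, hxs⟩ := Finset.exists_mem_eq_sup (Finset.univ.filter (π · = i))
    ⟨p i, by simp [hc.proj_spine i hi]⟩ d
  rw [height, hxs] at hj
  obtain ⟨h1, h2⟩ := hc.iterate_par x (j := d x - j) (by omega)
  exact ⟨_, h1.trans (Finset.mem_filter.mp hx).2, by omega⟩

theorem IsComb.add_colSum_le_card (hc : IsComb G k p m π d par) {e : ℕ} (he : e ≤ m + 1) :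
    e + colSum (height π d) e ≤ (Finset.univ.filter (π · < e)).card := by
  have hmaps : Set.MapsTo π (Finset.univ.filter (π · < e)) (Finset.range e) := by
    intro x hx
    simpa using hx
  rw [Finset.card_eq_sum_card_fiberwise hmaps, colSum]
  calc e + ∑ i ∈ Finset.range e, height π d i
      = ∑ i ∈ Finset.range e, (height π d i + 1) := by
        rw [Finset.sum_add_distrib]; simp [add_comm]
    _ ≤ _ := Finset.sum_le_sum fun i hi => ?_
  rw [Finset.mem_range] at hi
  rw [← Finset.card_range (height π d i + 1)]
  refine (Finset.card_le_card fun j hj => ?_).trans (Finset.card_image_le (f := d))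
  obtain ⟨x, hx, hxj⟩ := hc.exists_depth_eq (i := i) (by omega)
    (Nat.lt_succ_iff.mp (Finset.mem_range.mp hj))
  exact Finset.mem_image.mpr ⟨x, by simp [hx, hi], hxj⟩

end Height

theorem IsComb.induce {V : Type*} {G : SimpleGraph V} {k m : ℕ} {p : ℕ → V} {π d : V → ℕ}
    {par : V → V} (hc : IsComb G k p m π d par) {e : ℕ} (he : e ≤ m) :
    ∃ p' π' d' par', IsComb (G.induce {x | e ≤ π x}) k p' (m - e) π' d' par' := by
  classical
  refine ⟨fun i => ⟨p (min (e + i) m), ?_⟩, fun x => π x - e, fun x => d x,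
    fun x => if hx : d x = 0 then x else ⟨par x, ?_⟩, fun i hi => ?_, fun x => ?_,
    fun x => hc.depth_le x, fun x hx => ?_, fun i hi => ?_, fun i hi => ?_, fun x hx => ?_,
    fun x hx => ?_, fun x hx => ?_⟩
  · rw [Set.mem_ofPred_eq, hc.proj_spine _ (min_le_right _ _)]
    omega
  · rw [Set.mem_ofPred_eq, hc.par_proj _ hx]
    exact x.2
  · rw [comap_adj]
    simp only [Function.Embedding.subtype_apply]
    rw [show min (e + (i + 1)) m = min (e + i) m + 1 by omega]
    exact hc.adj _ (by omega)
  · have := hc.proj_le x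
    omega
  · have := hc.proj_le x
    have hx2 : e ≤ π x := x.2
    refine Subtype.ext ?_
    simp only
    rw [show min (e + (π x - e)) m = π x by omega]
    exact hc.eq_of_depth _ hx
  · simp only
    rw [hc.proj_spine _ (min_le_right _ _)]
    omega
  · exact hc.depth_spine _ (min_le_right _ _)
  · rw [dif_neg hx, comap_adj]
    exact hc.par_adj _ hx
  · rw [dif_neg hx]
    simp only [hc.par_proj _ hx]
  · rw [dif_neg hx]
    exact hc.par_depth _ hx

theorem burnable_card {V : Type*} [Fintype V] (G : SimpleGraph V) :
    Burnable G (Fintype.card V) :=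
  ⟨(Fintype.equivFin V).symm, fun u => ⟨Fintype.equivFin V u, by simp⟩⟩

theorem burnable_burningNumber {V : Type*} [Fintype V] (G : SimpleGraph V) :
    Burnable G (burningNumber G) :=
  Nat.sInf_mem (s := {k | Burnable G k}) ⟨_, burnable_card G⟩

theorem Burnable.mono {V : Type*} [Nonempty V] {G : SimpleGraph V} {k l : ℕ} (hkl : k ≤ l)
    (hG : Burnable G k) : Burnable G l := by
  obtain ⟨v, hv⟩ := hG
  refine ⟨fun i => if hi : i < k then v ⟨i, hi⟩ else Classical.arbitrary V, fun u => ?_⟩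
  obtain ⟨i, hr, hd⟩ := hv u
  refine ⟨Fin.castLE hkl i, ?_⟩
  simp only [Fin.val_castLE, i.2, dif_pos, Fin.eta]
  exact ⟨hr, by omega⟩

theorem dist_le_dist_induce {V : Type*} {G : SimpleGraph V} {S : Set V}
    {u v : S} (huv : (G.induce S).Reachable u v) : G.dist u v ≤ (G.induce S).dist u v := by
  obtain ⟨w, hw⟩ := huv.exists_walk_length_eq_dist
  rw [← hw]
  exact (dist_le (w.map (Embedding.induce S).toHom)).trans (Walk.length_map _ _).le

theorem sum_Ico_add_sq (a b : ℕ) (hab : a ≤ b) :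
    ∑ r ∈ Finset.Ico a b, (2 * r + 1) + a ^ 2 = b ^ 2 := by
  induction b, hab using Nat.le_induction with
  | base => simp
  | succ b hab ih =>
    rw [Finset.sum_Ico_succ_top hab]
    nlinarith

/-- If the balls of the `M` largest radii around vertices of the spine cover everything that
projects to the first `e` vertices of the spine, it remains to burn the rest. -/
theorem IsComb.burnable {V : Type*} [Fintype V] {G : SimpleGraph V} {k m : ℕ} {p : ℕ → V}
    {π d : V → ℕ} {par : V → V} (hc : IsComb G k p m π d par) {b M e : ℕ} {c : ℕ → ℕ}
    (hM : M ≤ b)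
    (hcov : ∀ i < e, ∃ r ∈ Finset.Ico (b - M) b, ColumnCovered (height π d) i (c r) r)
    (hrest : e ≤ m → Burnable (G.induce {x | e ≤ π x}) (b - M)) : Burnable G b := by
  have hv' : ∃ v' : Fin (b - M) → V, ∀ u, e ≤ π u →
      ∃ i : Fin (b - M), G.dist (v' i) u ≤ b - M - 1 - (i : ℕ) := by
    by_cases he : e ≤ m
    · obtain ⟨v', hv'⟩ := hrest he
      refine ⟨fun i => v' i, fun u hu => ?_⟩
      obtain ⟨i, hr, hd⟩ := hv' ⟨u, hu⟩
      exact ⟨i, (dist_le_dist_induce hr).trans hd⟩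
    · exact ⟨fun _ => p 0, fun u hu => absurd (hu.trans (hc.proj_le u)) he⟩
  obtain ⟨v', hv'⟩ := hv'
  refine ⟨fun i => if hi : (i : ℕ) < M then p (min (c (b - 1 - i)) m)
    else v' ⟨i - M, by omega⟩, fun u => ?_⟩
  simp only [hc.connected.preconnected _ u, true_and]
  rcases lt_or_ge (π u) e with hu | hu
  · obtain ⟨r, hr, h1, h2⟩ := hcov _ hu
    rw [Finset.mem_Ico] at hr
    refine ⟨⟨b - 1 - r, by omega⟩, ?_⟩
    rw [dif_pos (by simp only; omega)]
    simp only
    rw [show b - 1 - (b - 1 - r) = r by omega]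
    have := hc.dist_spine_le u (min_le_right (c r) m)
    have := depth_le_height π d u
    have := hc.proj_le u
    omega
  · obtain ⟨i, hi⟩ := hv' u hu
    have hi' := i.2
    refine ⟨⟨M + i, by omega⟩, ?_⟩
    rw [dif_neg (by simp only; omega)]
    simp only [Nat.add_sub_cancel_left, Fin.eta]
    omega

/-- By removing a heavy prefix covered by the largest balls, trees of bounded growth are reduced to
small trees. -/
theorem burnable_of_card_le_sq {k : ℕ}
    (h : ∀ (V : Type) [Fintype V] (T : SimpleGraph V),
      T.IsTree → GrowthLE T k → Fintype.card V ≤ (2 * k ^ 2 + 4 * k + 3) ^ 2 →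
      burningNumber T ≤ ⌈Real.sqrt (Fintype.card V)⌉₊) (n : ℕ) :
    ∀ (V : Type) [Fintype V] (T : SimpleGraph V), T.IsTree → GrowthLE T k →
      Fintype.card V = n → ∀ b, n ≤ b ^ 2 → Burnable T b := by
  induction n using Nat.strong_induction_on with
  | _ n ih =>
  intro V _ T hT hk hn b hb
  have := hT.connected.nonempty
  by_cases hsmall : n ≤ (2 * k ^ 2 + 4 * k + 3) ^ 2
  · refine Burnable.mono ((h V T hT hk (hn ▸ hsmall)).trans ?_) (burnable_burningNumber T)
    rw [Nat.ceil_le, hn]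
    exact Real.sqrt_le_iff.mpr ⟨by positivity, by exact_mod_cast hb⟩
  obtain ⟨R, rfl, hR⟩ : ∃ R, b = R + 1 ∧ 2 * k ^ 2 + 4 * k + 3 ≤ R := by
    have : 2 * k ^ 2 + 4 * k + 3 < b := by
      refine lt_of_pow_lt_pow_left₀ 2 (Nat.zero_le _) (by omega)
    exact ⟨b - 1, by omega, by omega⟩
  obtain ⟨p, m, π, d, par, hc, hd⟩ := exists_isComb_depth_le hT.connected hk
  obtain ⟨M, c, e, hM1, hM, hcov, hsum⟩ := hasHeavyPrefix (h := height π d) (R := R)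
    (fun i => height_le fun x _ => hc.depth_le x)
    (fun i => height_le fun x hx => hx ▸ hd x) hR
  refine hc.burnable hM hcov fun he => ?_
  obtain ⟨p', π', d', par', hc'⟩ := hc.induce he
  have hsq := sum_Ico_add_sq (R + 1 - M) (R + 1) (by omega)
  have hlt : (R + 1 - M) ^ 2 < (R + 1) ^ 2 := Nat.pow_lt_pow_left (by omega) (by norm_num)
  have hcount := hc.add_colSum_le_card (e := e) (by omega)
  classical
  have hcard : Fintype.card {x | e ≤ π x} + (Finset.univ.filter (π · < e)).card = n := by
    rw [Fintype.card_of_subtype (Finset.univ.filter (e ≤ π ·)) (by simp), ← hn, ← Finset.card_univ,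
      ← Finset.card_filter_add_card_filter_not (s := Finset.univ) (fun x => e ≤ π x)]
    simp
  exact ih _ (by omega) _ _ ⟨hc'.connected, hT.isAcyclic.induce _⟩ hc'.isSpine.growthLE rfl _
    (by omega)

end BurningReduction

theorem burning_conjecture_reduction (k : ℕ)
    (h : ∀ (V : Type) [Fintype V] (T : SimpleGraph V),
      T.IsTree → GrowthLE T k → Fintype.card V ≤ (2 * k ^ 2 + 4 * k + 3) ^ 2 →
      burningNumber T ≤ ⌈Real.sqrt (Fintype.card V)⌉₊) :
    ∀ (V : Type) [Fintype V] (T : SimpleGraph V),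
      T.IsTree → GrowthLE T k →
      burningNumber T ≤ ⌈Real.sqrt (Fintype.card V)⌉₊ := by
  intro V _ T hT hk
  refine Nat.sInf_le (BurningReduction.burnable_of_card_le_sq h _ V T hT hk rfl _ ?_)
  have := Real.sqrt_le_iff.mp (Nat.le_ceil (Real.sqrt (Fintype.card V)))
  exact_mod_cast this.2
end

section
/- For every k ∈ ℕ, either every tree of growth at most k satisfies b(T) ≤ ⌈√|V(T)|⌉, or there exists a tree T of growth at most k with |V(T)| ≤ (4k² + 5k + 4)² such that b(T) > ⌈√|V(T)|⌉. -/
open SimpleGraph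

/-- The spine positions below `J`, together with pendant trees of height `H j` at position `j`, are
covered by balls whose radii are the elements of `R`. -/
def BallsCover (H : ℕ → ℕ) (R : Finset ℕ) (J : ℕ) : Prop :=
  ∃ c : ℕ → ℕ, ∀ j < J, ∃ r ∈ R, j + H j ≤ c r + r ∧ c r + H j ≤ j + r

theorem BallsCover.insert {H : ℕ → ℕ} {R : Finset ℕ} {J J' r a : ℕ} (h : BallsCover H R J)
    (hr : r ∉ R) (ha : a ≤ J + r) (hleft : ∀ j, J ≤ j → H j + J ≤ a + j)
    (hright : ∀ j < J', j + H j + a < J + 2 * r + 1) : BallsCover H (insert r R) J' := by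
  obtain ⟨c, hc⟩ := h
  refine ⟨Function.update c r (J + r - a), fun j hj => ?_⟩
  rcases lt_or_ge j J with hjJ | hjJ
  · obtain ⟨r', hr', h'⟩ := hc j hjJ
    refine ⟨r', Finset.mem_insert_of_mem hr', ?_⟩
    rwa [Function.update_of_ne (by rintro rfl; exact hr hr')]
  · refine ⟨r, Finset.mem_insert_self _ _, ?_⟩
    have h1 := hleft j hjJ
    have h2 := hright j hj
    rw [Function.update_self]
    omega

/-- Balls of radii in `R` cover the positions below `J`, the remaining pendant trees stick out by at
most `a` to the left of `J`, and, counting the pendant vertices (`ℓ j` of them at position `j`) at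
positions below `J + c`, at least `φ` more vertices than required have been used up. -/
structure PartialBurning (ℓ H : ℕ → ℕ) (k c : ℕ) (R : Finset ℕ) (J a φ : ℕ) : Prop where
  cover : BallsCover H R J
  overhang : ∀ j, J ≤ j → H j + J ≤ a + j
  overhang_le : a ≤ k
  budget : ∑ r ∈ R, (2 * r + 1) + φ + a ≤ J + ∑ j ∈ Finset.range (J + c), ℓ j

theorem exists_overhang {ℓ H : ℕ → ℕ} {k : ℕ} (hHl : ∀ j, H j ≤ ℓ j) (hHk : ∀ j, H j ≤ k) (J : ℕ) :
    ∃ a ≤ k, (∀ j, J ≤ j → H j + J ≤ a + j) ∧ a ≤ ∑ j ∈ Finset.Ico J (J + k), ℓ j := by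
  classical
  have hex : ∃ a, ∀ j, J ≤ j → H j + J ≤ a + j := ⟨k, fun j hj => by have := hHk j; omega⟩
  refine ⟨Nat.find hex, Nat.find_min' hex fun j hj => by have := hHk j; omega,
    Nat.find_spec hex, ?_⟩
  rcases Nat.eq_zero_or_pos (Nat.find hex) with h0 | h0
  · omega
  · have := Nat.find_min hex (m := Nat.find hex - 1) (by omega)
    push Not at this
    obtain ⟨j, hj, hlt⟩ := this
    have h1 := hHl j
    have h2 := hHk j
    have h3 : ℓ j ≤ ∑ j ∈ Finset.Ico J (J + k), ℓ j :=
      Finset.single_le_sum (fun _ _ => Nat.zero_le _) (Finset.mem_Ico.2 ⟨hj, by omega⟩)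
    omega

/-- No pendant tree reaches across the left end of position `E`. -/
def CleanCut (H : ℕ → ℕ) (E : ℕ) : Prop := ∀ j, H j + E ≤ j ∨ j + H j < E

theorem sum_range_mono (ℓ : ℕ → ℕ) {x y : ℕ} (h : x ≤ y) :
    ∑ j ∈ Finset.range x, ℓ j ≤ ∑ j ∈ Finset.range y, ℓ j :=
  Finset.sum_le_sum_of_subset (Finset.range_mono h)

theorem sum_range_add_sum_Ico_le (ℓ : ℕ → ℕ) {x y z w : ℕ} (hxy : x ≤ y) (hyz : y ≤ z) (h : z ≤ w) :
    ∑ j ∈ Finset.range x, ℓ j + ∑ j ∈ Finset.Ico y z, ℓ j ≤ ∑ j ∈ Finset.range w, ℓ j := by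
  have := Finset.sum_range_add_sum_Ico ℓ hyz
  have := sum_range_mono ℓ hxy
  have := sum_range_mono ℓ hyz
  have := sum_range_mono ℓ h
  omega

theorem exists_cleanCut {ℓ H : ℕ → ℕ} {k c p m J a : ℕ} {W : Finset ℕ}
    (hHl : ∀ j, H j ≤ ℓ j) (hHk : ∀ j, H j ≤ k) (hak : a ≤ k)
    (hp : c + 2 * k ≤ 2 * p + 1) (hm : 2 * m + 3 * k ≤ 2 * p + c)
    (hW : ∀ r ∈ W, p ≤ r ∧ r < m)
    (hcard : ∑ j ∈ Finset.Ico (J + c) (J + 2 * p + 1 - 2 * k + c), ℓ j < W.card) :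
    ∃ r ∈ W, CleanCut H (J + 2 * r + 1 - a) := by
  classical
  by_contra! hcon
  let F : ℕ → Finset ℕ := fun j => Finset.Ico ((a + j - H j - J + 1) / 2)
    ((a + j - H j - J + 1) / 2 + H j)
  have hsub : W ⊆ (Finset.Ico (J + c) (J + 2 * p + 1 - 2 * k + c)).biUnion F := by
    intro r hr
    have hc := hcon r hr
    unfold CleanCut at hc
    push Not at hc
    obtain ⟨j, h1, h2⟩ := hc
    have := hHk j
    have := hW r hr
    refine Finset.mem_biUnion.2 ⟨j, Finset.mem_Ico.2 ⟨by omega, by omega⟩,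
      Finset.mem_Ico.2 ⟨by omega, by omega⟩⟩
  have h1 := (Finset.card_le_card hsub).trans Finset.card_biUnion_le
  have h2 : ∑ j ∈ Finset.Ico (J + c) (J + 2 * p + 1 - 2 * k + c), (F j).card ≤
      ∑ j ∈ Finset.Ico (J + c) (J + 2 * p + 1 - 2 * k + c), ℓ j :=
    Finset.sum_le_sum fun j _ => by simpa [F] using hHl j
  omega

namespace PartialBurning

variable {ℓ H : ℕ → ℕ} {k c : ℕ} {R : Finset ℕ} {J a φ r : ℕ}

theorem cover_clean (h : PartialBurning ℓ H k c R J a φ) (hr : r ∉ R)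
    (hkr : c + 2 * k ≤ 2 * r + 1) (hclean : CleanCut H (J + 2 * r + 1 - a))  (hck : 3 * k ≤ c) :
    BallsCover H (insert r R) (J + 2 * r + 1 - a) := by
  have := h.overhang_le
  exact h.cover.insert hr (by omega) h.overhang fun j hj => by have := hclean j; omega

theorem cover_insert (h : PartialBurning ℓ H k c R J a φ) (hr : r ∉ R) (hHk : ∀ j, H j ≤ k)
    (hkr : c + 2 * k ≤ 2 * r + 1) (hck : 3 * k ≤ c) :
    BallsCover H (insert r R) (J + 2 * r + 1 - a - k) := by
  have := h.overhang_le
  exact h.cover.insert hr (by omega) h.overhang fun j hj => by have := hHk j; omega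

theorem step_clean (h : PartialBurning ℓ H k c R J a φ) (hr : r ∉ R)
    (hkr : c + 2 * k ≤ 2 * r + 1) (hclean : CleanCut H (J + 2 * r + 1 - a)) (hck : 3 * k ≤ c) :
    PartialBurning ℓ H k c (insert r R) (J + 2 * r + 1 - a) 0
      (φ + ∑ j ∈ Finset.Ico (J + c) (J + 2 * r + 1 - 2 * k + c), ℓ j) where
  cover := h.cover_clean hr hkr hclean hck
  overhang j hj := by have := hclean j; omega
  overhang_le := Nat.zero_le _
  budget := by
    have h1 := h.overhang_le
    have h2 := h.budget
    have h3 := sum_range_add_sum_Ico_le ℓ (le_refl (J + c))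
      (show J + c ≤ J + 2 * r + 1 - 2 * k + c by omega)
      (show _ ≤ J + 2 * r + 1 - a + c by omega)
    rw [Finset.sum_insert hr]
    omega

theorem step_of_le (h : PartialBurning ℓ H k c R J a φ) (hr : r ∉ R) (hHl : ∀ j, H j ≤ ℓ j)
    (hHk : ∀ j, H j ≤ k) (hkr : c + 2 * k ≤ 2 * r + 1) (hck : 3 * k ≤ c) (hφ : k ≤ φ) :
    ∃ a', PartialBurning ℓ H k c (insert r R) (J + 2 * r + 1 - a - k) a' (φ - k) := by
  have h1 := h.overhang_le
  have h2 := h.budget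
  obtain ⟨a', ha', hov, hsum⟩ := exists_overhang hHl hHk (J + 2 * r + 1 - a - k)
  refine ⟨a', h.cover_insert hr hHk hkr hck, hov, ha', ?_⟩
  have h3 := sum_range_add_sum_Ico_le ℓ (show J + c ≤ J + 2 * r + 1 - a - k by omega)
    (Nat.le_add_right (J + 2 * r + 1 - a - k) k)
    (show _ ≤ J + 2 * r + 1 - a - k + c by omega)
  rw [Finset.sum_insert hr]
  omega

theorem step_of_lt_sum (h : PartialBurning ℓ H k c R J a φ) (hr : r ∉ R) (hHl : ∀ j, H j ≤ ℓ j)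
    (hHk : ∀ j, H j ≤ k) (hkr : c + 2 * k ≤ 2 * r + 1) (hck : 3 * k ≤ c)
    (hsum : 2 * k < ∑ j ∈ Finset.Ico (J + c) (J + 2 * r + 1 - 2 * k + c), ℓ j) :
    ∃ a', PartialBurning ℓ H k c (insert r R) (J + 2 * r + 1 - a - k) a' (φ + 1) := by
  have h1 := h.overhang_le
  have h2 := h.budget
  obtain ⟨a', ha', hov, -⟩ := exists_overhang hHl hHk (J + 2 * r + 1 - a - k)
  refine ⟨a', h.cover_insert hr hHk hkr hck, hov, ha', ?_⟩
  have h3 := sum_range_add_sum_Ico_le ℓ (le_refl (J + c))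
    (show J + c ≤ J + 2 * r + 1 - 2 * k + c by omega)
    (show _ ≤ J + 2 * r + 1 - a - k + c by omega)
  rw [Finset.sum_insert hr]
  omega

end PartialBurning

/-- The balls of radii `y, …, m - 1` cover the positions below some `J`, at which there are at least
as many vertices as on a path covered by these balls. -/
def TopRadiiSuffice (ℓ H : ℕ → ℕ) (p m : ℕ) : Prop :=
  ∃ y J, p ≤ y ∧ y < m ∧ BallsCover H (Finset.Ico y m) J ∧
    ∑ r ∈ Finset.Ico y m, (2 * r + 1) ≤ J + ∑ j ∈ Finset.range J, ℓ j

section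

variable {ℓ H : ℕ → ℕ} {k c p m : ℕ}

theorem insert_Ico_sdiff {y r : ℕ} {Q : Finset ℕ} (hQ : Q ⊆ Finset.Ico y m) (hr : r ∈ Q) :
    insert r (Finset.Ico y m \ Q) = Finset.Ico y m \ Q.erase r := by
  rw [Finset.sdiff_erase (hQ hr)]

theorem insert_Ico_sdiff_of_lt {y r : ℕ} {Q : Finset ℕ} (hQ : Q ⊆ Finset.Ico y m) (hr : r < y)
    (hy : y ≤ m) :
    insert r (Finset.Ico y m \ Q) = Finset.Ico r m \ (Q ∪ Finset.Ico (r + 1) y) := by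
  ext x
  have hx : x ∈ Q → y ≤ x ∧ x < m := fun h => Finset.mem_Ico.1 (hQ h)
  simp only [Finset.mem_insert, Finset.mem_sdiff, Finset.mem_Ico, Finset.mem_union]
  by_cases hxQ : x ∈ Q
  · have := hx hxQ
    simp only [hxQ, not_true_eq_false, and_false, or_false, true_or, iff_false]
    omega
  · simp only [hxQ, not_false_eq_true, and_true, false_or]
    omega

theorem PartialBurning.topRadiiSuffice_of_clean {y J a φ r : ℕ} {R : Finset ℕ}
    (h : PartialBurning ℓ H k c R J a φ) (hr : r ∉ R) (hck : 3 * k ≤ c)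
    (hkr : c + 2 * k ≤ 2 * r + 1) (hclean : CleanCut H (J + 2 * r + 1 - a)) (hpy : p ≤ y)
    (hym : y < m) (hR : insert r R = Finset.Ico y m) : TopRadiiSuffice ℓ H p m := by
  have h1 := h.overhang_le
  have h2 := h.budget
  have h3 := sum_range_mono ℓ (show J + c ≤ J + 2 * r + 1 - a by omega)
  refine ⟨y, J + 2 * r + 1 - a, hpy, hym, hR ▸ h.cover_clean hr hkr hclean hck, ?_⟩
  rw [← hR, Finset.sum_insert hr]
  omega

theorem PartialBurning.topRadiiSuffice_of_mul_le (hHl : ∀ j, H j ≤ ℓ j) (hHk : ∀ j, H j ≤ k)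
    (hck : 3 * k ≤ c) (hp : c + 2 * k ≤ 2 * p + 1) {y : ℕ} (hpy : p ≤ y) (hym : y < m) (n : ℕ) :
    ∀ {Q : Finset ℕ} {J a φ : ℕ}, Q.card = n + 1 → Q ⊆ Finset.Ico y m →
      PartialBurning ℓ H k c (Finset.Ico y m \ Q) J a φ → k * (n + 1) ≤ φ →
      TopRadiiSuffice ℓ H p m := by
  induction n with
  | zero =>
    intro Q J a φ hcard hQ h hφ
    obtain ⟨r, rfl⟩ := Finset.card_eq_one.1 hcard
    have hry := Finset.mem_Ico.1 (hQ (Finset.mem_singleton_self r))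
    have hr : r ∉ Finset.Ico y m \ {r} := by simp
    have h1 := h.overhang_le
    have h2 := h.budget
    have h3 := sum_range_mono ℓ (show J + c ≤ J + 2 * r + 1 - a - k by omega)
    have hR : insert r (Finset.Ico y m \ {r}) = Finset.Ico y m := by
      rw [insert_Ico_sdiff hQ (Finset.mem_singleton_self r)]; simp
    refine ⟨y, J + 2 * r + 1 - a - k, hpy, hym,
      hR ▸ h.cover_insert hr hHk (by omega) hck, ?_⟩
    rw [← hR, Finset.sum_insert hr]
    omega
  | succ n ih =>
    intro Q J a φ hcard hQ h hφ
    obtain ⟨r, hrQ⟩ := Finset.card_pos.1 (by omega : 0 < Q.card)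
    have hry := Finset.mem_Ico.1 (hQ hrQ)
    have hφ' : k * (n + 1) + k ≤ φ := by linarith
    obtain ⟨a', h'⟩ := h.step_of_le (r := r) (by simp [hrQ]) hHl hHk (by omega) hck (by omega)
    rw [insert_Ico_sdiff hQ hrQ] at h'
    exact ih (by rw [Finset.card_erase_of_mem hrQ]; omega) ((Finset.erase_subset _ _).trans hQ) h'
      (by omega)

theorem PartialBurning.topRadiiSuffice (hHl : ∀ j, H j ≤ ℓ j) (hHk : ∀ j, H j ≤ k)
    (hck : 3 * k ≤ c) (hp : c + 2 * k ≤ 2 * p + 1) (hc : 2 * m + 3 * k ≤ 2 * p + c)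
    (hm : m = p + (2 * k ^ 2 + 2)) (n : ℕ) :
    ∀ {y : ℕ} {Q : Finset ℕ} {J a φ : ℕ}, m ≤ y + (2 * k ^ 2 + 1) → y ≤ m →
      Q ⊆ Finset.Ico y m → PartialBurning ℓ H k c (Finset.Ico y m \ Q) J a φ → Q.card ≤ 2 * k →
      m ≤ y + φ + min Q.card 1 → 2 * k ^ 2 + 2 + y + Q.card ≤ m + n →
      TopRadiiSuffice ℓ H p m := by
  induction n with
  | zero => intro y Q J a φ hy _ _ _ _ _ hn; omega
  | succ n ih =>
    intro y Q J a φ hy hym hQm h hQk hφ hn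
    obtain hwin | hdepth : TopRadiiSuffice ℓ H p m ∨ m + 2 * k ≤ y + Q.card + 2 * k ^ 2 := by
      rcases Q.eq_empty_or_nonempty with rfl | hQ
      · rw [Finset.card_empty] at hφ ⊢
        rcases le_or_gt k φ with hkφ | hkφ
        · refine .inl <| topRadiiSuffice_of_mul_le hHl hHk hck hp (y := y - 1) (by omega)
            (by omega) 0 (Q := {y - 1}) (J := J) (a := a) (φ := φ) (by simp) ?_ ?_ (by omega)
          · simp; omega
          · convert h using 1
            ext x
            simp
            omega
        · right
          obtain ⟨k', rfl⟩ : ∃ k', k = k' + 1 := ⟨k - 1, by omega⟩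
          rw [min_eq_left (by omega)] at hφ
          nlinarith [Nat.zero_le (k' ^ 2)]
      · have hQ1 := hQ.card_pos
        rcases le_or_gt (k * Q.card) φ with hkφ | hkφ
        · obtain ⟨q, hq⟩ : ∃ q, Q.card = q + 1 := ⟨Q.card - 1, by omega⟩
          exact .inl <| topRadiiSuffice_of_mul_le hHl hHk hck hp (by omega)
            (by have := Finset.mem_Ico.1 (hQm hQ.choose_spec); omega) q hq hQm h (hq ▸ hkφ)
        · right
          have : min Q.card 1 = 1 := by omega
          obtain ⟨k', rfl⟩ : ∃ k', k = k' + 1 := ⟨k - 1, by omega⟩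
          nlinarith
    · exact hwin
    set s := ∑ j ∈ Finset.Ico (J + c) (J + 2 * p + 1 - 2 * k + c), ℓ j with hs
    have hmono : ∀ r, p ≤ r →
        s ≤ ∑ j ∈ Finset.Ico (J + c) (J + 2 * r + 1 - 2 * k + c), ℓ j := fun r hr =>
      Finset.sum_le_sum_of_subset (Finset.Ico_subset_Ico le_rfl (by omega))
    rcases lt_or_ge (2 * k) s with hlt | hge
    · rcases Q.eq_empty_or_nonempty with rfl | ⟨r, hrQ⟩
      · rw [Finset.card_empty] at hφ hn hdepth
        obtain ⟨a', h'⟩ := h.step_of_lt_sum (r := y - 1) (by simp; omega) hHl hHk (by omega) hck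
          (hlt.trans_le (hmono _ (by omega)))
        rw [insert_Ico_sdiff_of_lt (by simp) (by omega) hym,
          show y - 1 + 1 = y by omega, Finset.Ico_self, Finset.union_empty] at h'
        exact ih (by omega) (by omega) (by simp) h' (by simp) (by simp; omega) (by simp; omega)
      · have hry := Finset.mem_Ico.1 (hQm hrQ)
        have hcard := Finset.card_erase_of_mem hrQ
        have := Finset.card_pos.2 ⟨r, hrQ⟩
        obtain ⟨a', h'⟩ := h.step_of_lt_sum (r := r) (by simp [hrQ]) hHl hHk (by omega) hck
          (hlt.trans_le (hmono _ (by omega)))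
        rw [insert_Ico_sdiff hQm hrQ] at h'
        exact ih hy hym ((Finset.erase_subset _ _).trans hQm) h' (by omega) (by omega) (by omega)
    · have hdisj : Disjoint Q (Finset.Ico (y - (s + 1 - Q.card)) y) :=
        Finset.disjoint_left.2 fun x hx hx' => by
          have := Finset.mem_Ico.1 (hQm hx)
          have := Finset.mem_Ico.1 hx'
          omega
      obtain ⟨r, hrW, hclean⟩ := exists_cleanCut (W := Q ∪ Finset.Ico (y - (s + 1 - Q.card)) y)
        (J := J) (a := a) hHl hHk h.overhang_le hp hc
        (by
          intro r hr
          rcases Finset.mem_union.1 hr with hr | hr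
          · have := Finset.mem_Ico.1 (hQm hr)
            omega
          · have := Finset.mem_Ico.1 hr
            omega)
        (by
          rw [Finset.card_union_of_disjoint hdisj, Nat.card_Ico]
          omega)
      rcases Finset.mem_union.1 hrW with hrQ | hry
      · have hry := Finset.mem_Ico.1 (hQm hrQ)
        have hcard := Finset.card_erase_of_mem hrQ
        have := Finset.card_pos.2 ⟨r, hrQ⟩
        rcases (Q.erase r).eq_empty_or_nonempty with hempty | hne
        · refine h.topRadiiSuffice_of_clean (r := r) (y := y) (by simp [hrQ]) hck (by omega) hclean
            (by omega) (by omega) ?_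
          rw [insert_Ico_sdiff hQm hrQ, hempty, Finset.sdiff_empty]
        · have h' := h.step_clean (r := r) (by simp [hrQ]) (by omega) hclean hck
          rw [insert_Ico_sdiff hQm hrQ] at h'
          have := hne.card_pos
          exact ih hy hym ((Finset.erase_subset _ _).trans hQm) h' (by omega) (by omega) (by omega)
      · have hry := Finset.mem_Ico.1 hry
        have hsub : Q ∪ Finset.Ico (r + 1) y ⊆ Finset.Ico r m := by
          refine Finset.union_subset (hQm.trans (Finset.Ico_subset_Ico hry.2.le le_rfl))
            (Finset.Ico_subset_Ico (by omega) hym)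
        have hcard : (Q ∪ Finset.Ico (r + 1) y).card = Q.card + (y - (r + 1)) := by
          rw [Finset.card_union_of_disjoint (hdisj.mono_right
            (Finset.Ico_subset_Ico (by omega) le_rfl)), Nat.card_Ico]
        rcases (Q ∪ Finset.Ico (r + 1) y).eq_empty_or_nonempty with hempty | hne
        · refine h.topRadiiSuffice_of_clean (r := r) (y := r) (by simp; omega) hck (by omega) hclean
            (by omega) (by omega) ?_
          rw [insert_Ico_sdiff_of_lt hQm hry.2 hym, hempty, Finset.sdiff_empty]
        · have h' := h.step_clean (r := r) (by simp; omega) (by omega) hclean hck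
          rw [insert_Ico_sdiff_of_lt hQm hry.2 hym] at h'
          have := hne.card_pos
          have := hmono r (by omega)
          exact ih (by omega) (by omega) hsub h' (by omega) (by omega) (by omega)

end

theorem exists_topRadiiSuffice {ℓ H : ℕ → ℕ} {k m : ℕ} (hHl : ∀ j, H j ≤ ℓ j)
    (hHk : ∀ j, H j ≤ k) (hm : 4 * k ^ 2 + 5 * k + 4 < m) : TopRadiiSuffice ℓ H 1 m := by
  obtain ⟨p, rfl⟩ : ∃ p, m = p + (2 * k ^ 2 + 2) := ⟨m - (2 * k ^ 2 + 2), by omega⟩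
  obtain ⟨a, hak, hov, hsum⟩ := exists_overhang hHl hHk 0
  have hinit : PartialBurning ℓ H k (4 * k ^ 2 + 3 * k + 4)
      (Finset.Ico (p + (2 * k ^ 2 + 2)) (p + (2 * k ^ 2 + 2)) \ ∅) 0 a 0 :=
    ⟨⟨id, by simp⟩, hov, hak, by
      have := sum_range_mono ℓ (show 0 + k ≤ 0 + (4 * k ^ 2 + 3 * k + 4) by omega)
      rw [Finset.range_eq_Ico] at this
      simp at this hsum ⊢
      omega⟩
  obtain ⟨y, J, hy, h⟩ := hinit.topRadiiSuffice hHl hHk (p := p) (by omega) (by omega)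
    (by omega) rfl (2 * k ^ 2 + 2) (by omega) le_rfl (by simp) (by simp) (by simp) (by simp; omega)
  exact ⟨y, J, by omega, h⟩

section

variable {V W : Type*} {G : SimpleGraph V}

theorem burnable_iff (hG : G.Connected) {m : ℕ} :
    Burnable G m ↔ ∃ f : ℕ → V, ∀ u, ∃ r < m, G.dist (f r) u ≤ r := by
  have := hG.nonempty
  constructor
  · rintro ⟨v, hv⟩
    refine ⟨fun r => if h : m - 1 - r < m then v ⟨m - 1 - r, h⟩ else Classical.arbitrary V,
      fun u => ?_⟩
    obtain ⟨i, -, hi⟩ := hv u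
    have him := i.isLt
    refine ⟨m - 1 - i, by omega, ?_⟩
    have h : m - 1 - (m - 1 - i) = i := by omega
    simpa [h] using hi
  · rintro ⟨f, hf⟩
    refine ⟨fun i => f (m - 1 - i), fun u => ?_⟩
    obtain ⟨r, hr, h⟩ := hf u
    have hr' : m - 1 - (m - 1 - r) = r := by omega
    exact ⟨⟨m - 1 - r, by omega⟩, hG _ _, by simpa [hr'] using h⟩

theorem Burnable.mono (hG : G.Connected) {m n : ℕ} (h : Burnable G m) (hmn : m ≤ n) :
    Burnable G n := by
  obtain ⟨f, hf⟩ := (burnable_iff hG).1 h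
  refine (burnable_iff hG).2 ⟨f, fun u => ?_⟩
  obtain ⟨r, hr, h⟩ := hf u
  exact ⟨r, hr.trans_le hmn, h⟩

theorem burnable_of_burningNumber_le [Finite V] (hG : G.Connected) {m : ℕ}
    (h : burningNumber G ≤ m) : Burnable G m := by
  have := Fintype.ofFinite V
  have hne : {k | Burnable G k}.Nonempty :=
    ⟨Fintype.card V, (Fintype.equivFin V).symm, fun u => ⟨Fintype.equivFin V u, by simp⟩⟩
  exact Burnable.mono hG (Nat.sInf_mem hne) h

theorem SimpleGraph.Iso.dist_le {G' : SimpleGraph W} (e : G ≃g G') (hG : G.Connected) (x y : V) :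
    G'.dist (e x) (e y) ≤ G.dist x y := by
  obtain ⟨p, hp⟩ := hG.exists_walk_length_eq_dist x y
  rw [← hp, ← Walk.length_map e.toHom p]
  exact SimpleGraph.dist_le _

theorem Burnable.of_iso {G' : SimpleGraph W} (e : G ≃g G') (hG : G.Connected) {m : ℕ}
    (h : Burnable G m) : Burnable G' m := by
  obtain ⟨f, hf⟩ := (burnable_iff hG).1 h
  refine (burnable_iff (e.connected_iff.1 hG)).2 ⟨e ∘ f, fun u => ?_⟩
  obtain ⟨r, hr, h⟩ := hf (e.symm u)
  refine ⟨r, hr, le_trans ?_ h⟩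
  simpa using e.dist_le hG (f r) (e.symm u)

theorem GrowthLE.of_iso {G' : SimpleGraph W} (e : G ≃g G') (hG : G.Connected) {k : ℕ}
    (h : GrowthLE G k) : GrowthLE G' k := by
  obtain ⟨a, b, P, hP, h⟩ := h
  refine ⟨e a, e b, P.map e.toHom, hP.map e.injective, fun x => ?_⟩
  obtain ⟨y, hy, hyx⟩ := h (e.symm x)
  refine ⟨e y, ?_, le_trans ?_ hyx⟩
  · rw [Walk.support_map]
    exact List.mem_map_of_mem hy
  · simpa using e.dist_le hG y (e.symm x)

theorem SimpleGraph.Walk.dist_add_dist_of_mem_support {x y z : V} (p : G.Walk x y)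
    (hG : G.Connected) (hp : p.length = G.dist x y) (hz : z ∈ p.support) :
    G.dist x z + G.dist z y = G.dist x y := by
  obtain ⟨q, r, rfl⟩ := Walk.mem_support_iff_exists_append.1 hz
  rw [Walk.length_append] at hp
  have := dist_le q
  have := dist_le r
  have := hG.dist_triangle (u := x) (v := z) (w := y)
  omega

theorem SimpleGraph.Walk.dist_getVert_le_s5 {x y : V} (p : G.Walk x y) {i j : ℕ} (hij : i ≤ j) :
    G.dist (p.getVert i) (p.getVert j) ≤ j - i := by
  have h := dist_le ((p.drop i).take (j - i))
  rw [Walk.take_length] at h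
  simp only [Walk.drop_getVert, Nat.add_sub_cancel' hij] at h
  omega

theorem SimpleGraph.Walk.dist_getVert_le_of_le_add {x y : V} (p : G.Walk x y)
    {i j n : ℕ} (h₁ : i ≤ j + n) (h₂ : j ≤ i + n) : G.dist (p.getVert i) (p.getVert j) ≤ n := by
  rcases le_total i j with h | h
  · exact (p.dist_getVert_le_s5 h).trans (by omega)
  · rw [dist_comm]
    exact (p.dist_getVert_le_s5 h).trans (by omega)

theorem SimpleGraph.Connected.dist_le_dist_induce {S : Set V} (hS : (G.induce S).Connected)
    (x y : S) : G.dist x y ≤ (G.induce S).dist x y := by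
  obtain ⟨p, hp⟩ := hS.exists_walk_length_eq_dist x y
  rw [← hp, ← Walk.length_map (Embedding.induce S).toHom p]
  exact SimpleGraph.dist_le _

theorem SimpleGraph.Walk.length_induce {S : Set V} {x y : V} (p : G.Walk x y)
    (hp : ∀ z ∈ p.support, z ∈ S) : (p.induce S hp).length = p.length := by
  exact (Walk.length_map (Embedding.induce S).toHom _).symm.trans
    (congrArg Walk.length (p.map_induce hp))

theorem connected_and_growthLE_induce {S : Set V} {a b : V} {k : ℕ} {q : G.Walk a b}
    (hq : q.IsPath) (hqS : ∀ z ∈ q.support, z ∈ S)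
    (h : ∀ x ∈ S, ∃ y ∈ q.support, ∃ p : G.Walk y x, p.length ≤ k ∧ ∀ z ∈ p.support, z ∈ S) :
    (G.induce S).Connected ∧ GrowthLE (G.induce S) k := by
  constructor
  · rw [connected_iff_exists_forall_reachable]
    refine ⟨⟨a, hqS _ q.start_mem_support⟩, fun ⟨x, hx⟩ => ?_⟩
    obtain ⟨y, hy, p, -, hp⟩ := h x hx
    obtain ⟨q₁, q₂, rfl⟩ := Walk.mem_support_iff_exists_append.1 hy
    refine ⟨(q₁.append p).induce S fun z hz => ?_⟩
    rcases Walk.mem_support_append_iff _ _ |>.1 hz with hz | hz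
    · exact hqS z ((Walk.mem_support_append_iff _ _).2 (.inl hz))
    · exact hp z hz
  · refine ⟨_, _, q.induce S hqS, ?_, fun ⟨x, hx⟩ => ?_⟩
    · rw [← Walk.map_induce q hqS] at hq
      exact hq.of_map
    · obtain ⟨y, hy, p, hpk, hp⟩ := h x hx
      refine ⟨⟨y, hqS y hy⟩, by simpa using hy, ?_⟩
      rw [← p.length_induce hp] at hpk
      exact (SimpleGraph.dist_le _).trans hpk

/-- `v j` is the vertex nearest to `x` among `v 0, …, v L`, the one of largest index if there are
several. -/
def IsLastNearest (G : SimpleGraph V) (v : ℕ → V) (L : ℕ) (x : V) (j : ℕ) : Prop :=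
  j ≤ L ∧ ∀ i ≤ L, G.dist (v j) x ≤ G.dist (v i) x ∧ (j < i → G.dist (v j) x < G.dist (v i) x)

theorem exists_isLastNearest (G : SimpleGraph V) (v : ℕ → V) (L : ℕ) (x : V) :
    ∃ j, IsLastNearest G v L x j := by
  obtain ⟨j, hj, hmin⟩ := Finset.exists_min_image (Finset.range (L + 1))
    (fun i => G.dist (v i) x * (L + 1) + (L - i)) ⟨0, by simp⟩
  have hj := Finset.mem_range.1 hj
  refine ⟨j, by omega, fun i hi => ?_⟩
  have h := hmin i (by simp; omega)
  constructor
  · by_contra! hlt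
    have := Nat.mul_le_mul_right (L + 1) (Nat.succ_le_of_lt hlt)
    rw [Nat.succ_mul] at this
    omega
  · intro hji
    by_contra! hle
    have := Nat.mul_le_mul_right (L + 1) hle
    omega

namespace IsLastNearest

variable {v : ℕ → V} {L j j' : ℕ} {x y : V}

theorem unique (h : IsLastNearest G v L x j) (h' : IsLastNearest G v L x j') : j = j' := by
  have h₁ := h.2 j' h'.1
  have h₂ := h'.2 j h.1
  rcases lt_trichotomy j j' with hlt | rfl | hlt
  · have := h₁.2 hlt
    omega
  · rfl
  · have := h₂.2 hlt
    omega

theorem self (hG : G.Connected) (hv : Set.InjOn v {i | i ≤ L}) (hj : j ≤ L) :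
    IsLastNearest G v L (v j) j := by
  refine ⟨hj, fun i hi => ⟨by simp, fun hji => ?_⟩⟩
  rw [SimpleGraph.dist_self]
  refine hG.pos_dist_of_ne fun h => ?_
  have := hv hi hj h
  omega

theorem of_dist_add_dist (hG : G.Connected) (h : IsLastNearest G v L x j)
    (hy : G.dist (v j) y + G.dist y x = G.dist (v j) x) : IsLastNearest G v L y j := by
  refine ⟨h.1, fun i hi => ?_⟩
  have := h.2 i hi
  have := hG.dist_triangle (u := v i) (v := y) (w := x)
  constructor
  · omega
  · intro hji
    have := (h.2 i hi).2 hji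
    omega

end IsLastNearest

end

theorem sq_add_sum_Ico_odd {y m : ℕ} (h : y ≤ m) :
    y ^ 2 + ∑ r ∈ Finset.Ico y m, (2 * r + 1) = m ^ 2 := by
  induction m, h using Nat.le_induction with
  | base => simp
  | succ m h ih =>
    rw [Finset.sum_Ico_succ_top h, ← add_assoc, ih]
    ring

theorem burnable_of_forall_induce {V : Type*} [Fintype V] {T : SimpleGraph V} {k m : ℕ}
    (hT : T.IsTree) (hk : GrowthLE T k) (hm : 4 * k ^ 2 + 5 * k + 4 < m)
    (hcard : Fintype.card V ≤ m ^ 2)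
    (ih : ∀ S : Set V, (T.induce S).IsTree → GrowthLE (T.induce S) k → ∀ y < m, S.ncard ≤ y ^ 2 →
      Burnable (T.induce S) y) : Burnable T m := by
  classical
  have hconn := hT.connected
  obtain ⟨a, b, P, hP, hPk⟩ := hk
  choose π hπ using exists_isLastNearest T P.getVert P.length
  have hself (j : ℕ) (hj : j ≤ P.length) : π (P.getVert j) = j :=
    (hπ _).unique (.self hconn hP.getVert_injOn hj)
  have hdist (x : V) : T.dist (P.getVert (π x)) x ≤ k := by
    obtain ⟨y, hy, hyx⟩ := hPk x
    obtain ⟨i, rfl, hi⟩ := Walk.mem_support_iff_exists_getVert.1 hy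
    exact ((hπ x).2 i hi).1.trans hyx
  have hgeod (x : V) : ∃ p : T.Walk (P.getVert (π x)) x, p.length = T.dist (P.getVert (π x)) x ∧
      ∀ z ∈ p.support, π z = π x := by
    obtain ⟨p, hp⟩ := hconn.exists_walk_length_eq_dist (P.getVert (π x)) x
    exact ⟨p, hp, fun z hz => (hπ z).unique <|
      (hπ x).of_dist_add_dist hconn (p.dist_add_dist_of_mem_support hconn hp hz)⟩
  let F (j : ℕ) : Finset V := {x | π x = j}
  let H (j : ℕ) : ℕ := (F j).sup fun x => T.dist (P.getVert j) x
  have hH (x : V) : T.dist (P.getVert (π x)) x ≤ H (π x) :=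
    Finset.le_sup (f := fun z => T.dist (P.getVert (π x)) z) (by simp [F])
  have hHk (j : ℕ) : H j ≤ k := by
    refine Finset.sup_le fun x hx => ?_
    obtain rfl : π x = j := by simpa [F] using hx
    exact hdist x
  have hHl (j : ℕ) : H j ≤ (F j).card - 1 := by
    refine Finset.sup_le fun x hx => ?_
    obtain rfl : π x = j := by simpa [F] using hx
    obtain ⟨p, hp, hpπ⟩ := hgeod x
    have hsub : p.support.toFinset ⊆ F (π x) := fun z hz => by
      simpa [F] using hpπ z (List.mem_toFinset.1 hz)
    have h := Finset.card_le_card hsub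
    rw [List.toFinset_card_of_nodup (p.isPath_of_length_eq_dist hp).support_nodup,
      Walk.length_support] at h
    omega
  obtain ⟨y, J, -, hym, ⟨c, hc⟩, hsum⟩ := exists_topRadiiSuffice hHl hHk hm
  have hcover (x : V) (hx : π x < J) :
      ∃ r, y ≤ r ∧ r < m ∧ T.dist (P.getVert (c r)) x ≤ r := by
    obtain ⟨r, hr, h₁, h₂⟩ := hc _ hx
    have hr := Finset.mem_Ico.1 hr
    have h := P.dist_getVert_le_of_le_add (i := c r) (j := π x) (n := r - H (π x))
      (by omega) (by omega)
    have := hconn.dist_triangle (u := P.getVert (c r)) (v := P.getVert (π x)) (w := x)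
    have := hH x
    exact ⟨r, hr.1, hr.2, by omega⟩
  rw [burnable_iff hconn]
  rcases lt_or_ge P.length J with hJ | hJ
  · refine ⟨fun r => P.getVert (c r), fun x => ?_⟩
    obtain ⟨r, -, hrm, hr⟩ := hcover x ((hπ x).1.trans_lt hJ)
    exact ⟨r, hrm, hr⟩
  · let S : Set V := {x | J ≤ π x}
    obtain ⟨hSconn, hSk⟩ : (T.induce S).Connected ∧ GrowthLE (T.induce S) k := by
      refine connected_and_growthLE_induce (hP.drop J) (fun z hz => ?_) fun x hx => ?_
      · obtain ⟨i, rfl, hi⟩ := Walk.mem_support_iff_exists_getVert.1 hz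
        rw [Walk.drop_length] at hi
        change J ≤ π _
        rw [Walk.drop_getVert, hself _ (by omega)]
        omega
      · have hx : J ≤ π x := hx
        obtain ⟨p, hp, hpπ⟩ := hgeod x
        refine ⟨_, ?_, p, hp.trans_le (hdist x), fun z hz => hx.trans_eq (hpπ z hz).symm⟩
        have h := (P.drop J).getVert_mem_support (π x - J)
        rwa [Walk.drop_getVert, Nat.add_sub_cancel' hx] at h
    have hScard : S.ncard ≤ y ^ 2 := by
      have h₁ : (Finset.univ.filter fun x => π x < J).card =
          ∑ j ∈ Finset.range J, ((F j).card - 1 + 1) := by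
        rw [Finset.card_eq_sum_card_fiberwise (f := π) (t := Finset.range J)
          (fun x hx => by simpa using hx)]
        refine Finset.sum_congr rfl fun j hj => ?_
        have hj := Finset.mem_range.1 hj
        have hpos : 0 < (F j).card :=
          Finset.card_pos.2 ⟨P.getVert j, by simpa [F] using hself j (by omega)⟩
        rw [Nat.sub_add_cancel hpos]
        congr 1
        ext x
        simp only [F, Finset.mem_filter, Finset.mem_univ, true_and]
        omega
      have h₂ : S.ncard = (Finset.univ.filter fun x => ¬ π x < J).card := by
        rw [← Set.ncard_coe_finset]
        congr 1
        ext x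
        simp [S]
      have h₃ := Finset.card_filter_add_card_filter_not (s := Finset.univ) (fun x => π x < J)
      have h₄ := sq_add_sum_Ico_odd hym.le
      rw [Finset.sum_add_distrib, Finset.sum_const, Finset.card_range, smul_eq_mul, mul_one] at h₁
      rw [Finset.card_univ] at h₃
      beta_reduce at hsum
      omega
    obtain ⟨f, hf⟩ := (burnable_iff hSconn).1
      (ih S ⟨hSconn, hT.isAcyclic.induce S⟩ hSk y hym hScard)
    refine ⟨fun r => if r < y then f r else P.getVert (c r), fun x => ?_⟩
    rcases lt_or_ge (π x) J with hx | hx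
    · obtain ⟨r, hyr, hrm, hr⟩ := hcover x hx
      exact ⟨r, hrm, by simpa [hyr.not_gt] using hr⟩
    · obtain ⟨r, hry, hr⟩ := hf ⟨x, hx⟩
      refine ⟨r, hry.trans hym, ?_⟩
      simp only [if_pos hry]
      exact (hSconn.dist_le_dist_induce _ _).trans hr

theorem burnable_of_forall_fin {k : ℕ}
    (h : ∀ (n : ℕ) (T : SimpleGraph (Fin n)), T.IsTree → GrowthLE T k →
      n ≤ (4 * k ^ 2 + 5 * k + 4) ^ 2 → burningNumber T ≤ ⌈Real.sqrt n⌉₊) (m : ℕ) :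
    ∀ {V : Type*} [Fintype V] (T : SimpleGraph V), T.IsTree → GrowthLE T k →
      Fintype.card V ≤ m ^ 2 → Burnable T m := by
  induction m using Nat.strong_induction_on with
  | _ m ih =>
    intro V _ T hT hk hcard
    rcases le_or_gt m (4 * k ^ 2 + 5 * k + 4) with hm | hm
    · let e := Iso.map (Fintype.equivFin V) T
      have hT' := e.isTree_iff.1 hT
      have hb := h _ _ hT' (hk.of_iso e hT.connected) (hcard.trans (Nat.pow_le_pow_left hm 2))
      refine (burnable_of_burningNumber_le hT'.connected (hb.trans ?_)).of_iso e.symm hT'.connected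
      rw [Nat.ceil_le, Real.sqrt_le_left (by positivity)]
      exact_mod_cast hcard
    · classical
      refine burnable_of_forall_induce hT hk hm hcard fun S hS hSk y hy hSy => ?_
      refine ih y hy _ hS hSk ?_
      rwa [← Nat.card_eq_fintype_card, Nat.card_coe_set_eq]

theorem burning_conjecture_dichotomy (k : ℕ) :
    (∀ (V : Type) [Fintype V] (T : SimpleGraph V),
      T.IsTree → GrowthLE T k → burningNumber T ≤ ⌈Real.sqrt (Fintype.card V)⌉₊) ∨
    (∃ (n : ℕ) (T : SimpleGraph (Fin n)),
      T.IsTree ∧ GrowthLE T k ∧ n ≤ (4 * k ^ 2 + 5 * k + 4) ^ 2 ∧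
      ⌈Real.sqrt n⌉₊ < burningNumber T) := by
  by_contra! ⟨⟨V, _, T, hT, hk, hlt⟩, h⟩
  refine hlt.not_ge (Nat.sInf_le (burnable_of_forall_fin h _ T hT hk ?_))
  have := (Real.sqrt_le_left (by positivity)).1 (Nat.le_ceil (Real.sqrt (Fintype.card V)))
  exact_mod_cast this
end

section
/- For any connected graph G on n vertices, the burning number of G satisfies b(G) ≤ ⌈√(4n/3)⌉ + 1. -/
open SimpleGraph

/-- A rooted spanning tree of a graph, encoded by its parent function and its depth function.
The root is its own parent. -/
structure RootedSpanningTree {V : Type*} (G : SimpleGraph V) where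
  par : V → V
  depth : V → ℕ
  depth_par : ∀ v, depth (par v) = depth v - 1
  dist_par_le : ∀ v, G.dist (par v) v ≤ 1
  eq_of_depth_eq_zero : ∀ u v, depth u = 0 → depth v = 0 → u = v

/-- A connected graph has a (breadth-first) rooted spanning tree. -/
theorem SimpleGraph.Connected.exists_rootedSpanningTree {V : Type*} {G : SimpleGraph V}
    (hG : G.Connected) : Nonempty (RootedSpanningTree G) := by
  obtain ⟨ρ⟩ := hG.nonempty
  have hpar : ∀ v, ∃ p, G.dist ρ p = G.dist ρ v - 1 ∧ G.dist p v ≤ 1 := by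
    intro v
    obtain ⟨w, hw⟩ := hG.exists_walk_length_eq_dist v ρ
    rw [SimpleGraph.dist_comm] at hw
    cases w with
    | nil => exact ⟨ρ, by simp, by simp⟩
    | @cons _ p _ h w' =>
      have h1 : G.dist p v ≤ 1 := (SimpleGraph.dist_eq_one_iff_adj.2 h.symm).le
      have h2 : G.dist p ρ ≤ w'.length := SimpleGraph.dist_le w'
      have h3 := hG.dist_triangle (u := ρ) (v := p) (w := v)
      rw [SimpleGraph.dist_comm] at h2
      rw [SimpleGraph.Walk.length_cons] at hw
      exact ⟨p, by omega, h1⟩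
  choose p hp1 hp2 using hpar
  refine ⟨⟨p, fun v => G.dist ρ v, hp1, hp2, fun u v hu hv => ?_⟩⟩
  rw [hG.dist_eq_zero_iff] at hu hv
  exact hu.symm.trans hv

namespace RootedSpanningTree

variable {V : Type*} {G : SimpleGraph V} (T : RootedSpanningTree G)

/-- The ancestor of `v` at depth `m`, or `v` itself if `v` has depth at most `m`. -/
def anc (m : ℕ) (v : V) : V := T.par^[T.depth v - m] v

theorem depth_iterate_par (i : ℕ) (v : V) : T.depth (T.par^[i] v) = T.depth v - i := by
  induction i with
  | zero => simp
  | succ i ih => rw [Function.iterate_succ_apply', T.depth_par, ih]; omega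

theorem depth_anc {m : ℕ} {v : V} (h : m ≤ T.depth v) : T.depth (T.anc m v) = m := by
  rw [anc, depth_iterate_par]; omega

theorem anc_of_depth_le {m : ℕ} {v : V} (h : T.depth v ≤ m) : T.anc m v = v := by
  rw [anc, Nat.sub_eq_zero_of_le h]; rfl

theorem anc_anc {m m' : ℕ} (h : m ≤ m') (v : V) : T.anc m (T.anc m' v) = T.anc m v := by
  rcases le_total m' (T.depth v) with h' | h'
  · rw [anc, T.depth_anc h', anc, anc, ← Function.iterate_add_apply]
    congr 1; omega
  · rw [T.anc_of_depth_le h']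

theorem anc_par {m : ℕ} {v : V} (h : m < T.depth v) : T.anc m (T.par v) = T.anc m v := by
  rw [anc, anc, T.depth_par, ← Function.iterate_succ_apply]
  congr 1; omega

theorem anc_zero (u v : V) : T.anc 0 u = T.anc 0 v :=
  T.eq_of_depth_eq_zero _ _ (T.depth_anc (Nat.zero_le _)) (T.depth_anc (Nat.zero_le _))

theorem dist_iterate_par_le (hG : G.Connected) (i : ℕ) (v : V) :
    G.dist (T.par^[i] v) v ≤ i := by
  induction i with
  | zero => simp
  | succ i ih =>
    have h1 := T.dist_par_le (T.par^[i] v)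
    have h2 := hG.dist_triangle (u := T.par (T.par^[i] v)) (v := T.par^[i] v) (w := v)
    rw [Function.iterate_succ_apply']
    omega

theorem dist_anc_le (hG : G.Connected) (m : ℕ) (v : V) :
    G.dist (T.anc m v) v ≤ T.depth v - m :=
  T.dist_iterate_par_le hG _ _

open Classical in
/-- The depth of the lowest common ancestor. -/
noncomputable def lca (u v : V) : ℕ :=
  Nat.findGreatest (fun m => T.anc m u = T.anc m v) (min (T.depth u) (T.depth v))

theorem lca_le_left (u v : V) : T.lca u v ≤ T.depth u :=
  by classical exact (Nat.findGreatest_le _).trans (min_le_left _ _)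

theorem lca_le_right (u v : V) : T.lca u v ≤ T.depth v :=
  by classical exact (Nat.findGreatest_le _).trans (min_le_right _ _)

theorem anc_lca (u v : V) : T.anc (T.lca u v) u = T.anc (T.lca u v) v := by
  classical
  exact Nat.findGreatest_spec (P := fun m => T.anc m u = T.anc m v) (Nat.zero_le _)
    (T.anc_zero u v)

theorem anc_eq_of_le_lca {m : ℕ} {u v : V} (h : m ≤ T.lca u v) : T.anc m u = T.anc m v := by
  rw [← T.anc_anc h u, T.anc_lca, T.anc_anc h v]

theorem le_lca {m : ℕ} {u v : V} (hu : m ≤ T.depth u) (hv : m ≤ T.depth v)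
    (h : T.anc m u = T.anc m v) : m ≤ T.lca u v := by
  classical
  exact Nat.le_findGreatest (le_min hu hv) h

/-- A set is covered by a ball of radius `r` as soon as all its vertices are at tree distance at
most `2 * r` from its deepest vertex. -/
theorem exists_center (hG : G.Connected) (r : ℕ) (S : Set V) (u : V)
    (hu : ∀ v ∈ S, T.depth v ≤ T.depth u)
    (h : ∀ v ∈ S, T.depth u + T.depth v ≤ 2 * r + 2 * T.lca u v) :
    ∃ c, ∀ v ∈ S, G.dist c v ≤ r := by
  refine ⟨T.anc (T.depth u - r) u, fun v hv => ?_⟩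
  have h1 := hu v hv
  have h2 := h v hv
  rcases le_total (T.depth u - r) (T.lca u v) with hl | hl
  · rw [T.anc_eq_of_le_lca hl]
    have := T.dist_anc_le hG (T.depth u - r) v
    omega
  · have h3 := T.dist_anc_le hG (T.lca u v) (T.anc (T.depth u - r) u)
    rw [T.anc_anc hl, T.depth_anc (Nat.sub_le _ _), T.anc_lca, SimpleGraph.dist_comm] at h3
    have h4 := T.dist_anc_le hG (T.lca u v) v
    have h5 := hG.dist_triangle (u := T.anc (T.depth u - r) u) (v := T.anc (T.lca u v) v) (w := v)
    have h6 := T.lca_le_right u v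
    omega

theorem exists_center_of_pairwise (hG : G.Connected) (r : ℕ) (S : Finset V)
    (h : ∀ u ∈ S, ∀ v ∈ S, T.depth u + T.depth v ≤ 2 * r + 2 * T.lca u v) :
    ∃ c, ∀ v ∈ S, G.dist c v ≤ r := by
  rcases S.eq_empty_or_nonempty with rfl | hS
  · obtain ⟨c⟩ := hG.nonempty
    exact ⟨c, by simp⟩
  · obtain ⟨u, hu, hmax⟩ := S.exists_max_image T.depth hS
    exact T.exists_center hG r S u hmax (h u hu)

/-- A set of vertices closed under taking parents. -/
def AncClosed (S : Finset V) : Prop := ∀ v ∈ S, T.par v ∈ S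

variable {T} in
theorem AncClosed.anc_mem {S : Finset V} (hS : T.AncClosed S) {v : V} (hv : v ∈ S) (m : ℕ) :
    T.anc m v ∈ S := by
  rw [anc]
  induction T.depth v - m with
  | zero => exact hv
  | succ i ih => rw [Function.iterate_succ_apply']; exact hS _ ih

open Classical in
/-- The descendants in `S` of a vertex `c` of depth `m`. -/
noncomputable def sub (S : Finset V) (m : ℕ) (c : V) : Finset V :=
  {v ∈ S | m ≤ T.depth v ∧ T.anc m v = c}

theorem mem_sub {S : Finset V} {m : ℕ} {c v : V} :
    v ∈ T.sub S m c ↔ v ∈ S ∧ m ≤ T.depth v ∧ T.anc m v = c := by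
  simp [sub]

variable {T} in
theorem AncClosed.sdiff_sub [DecidableEq V] {S : Finset V} (hS : T.AncClosed S) (m : ℕ) (c : V) :
    T.AncClosed (S \ T.sub S m c) := by
  intro v hv
  rw [Finset.mem_sdiff] at hv ⊢
  refine ⟨hS v hv.1, fun h => hv.2 ?_⟩
  rw [mem_sub] at h ⊢
  obtain ⟨_, h1, h2⟩ := h
  rw [T.depth_par] at h1
  rcases Nat.lt_or_ge m (T.depth v) with h3 | h3
  · exact ⟨hv.1, h3.le, by rw [← T.anc_par h3, h2]⟩
  · -- here `m = 0` and `v` is the root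
    have hm : m = 0 := by omega
    subst hm
    exact ⟨hv.1, Nat.zero_le _, by rw [T.anc_zero v (T.par v), h2]⟩

variable {T} in
theorem AncClosed.anc_mem_sub {S : Finset V} (hS : T.AncClosed S) {m j : ℕ} {c v : V}
    (hv : v ∈ T.sub S m c) (hmj : m ≤ j) : T.anc j v ∈ T.sub S m c := by
  rw [mem_sub] at hv ⊢
  refine ⟨hS.anc_mem hv.1 j, ?_, by rw [T.anc_anc hmj, hv.2.2]⟩
  rcases le_total j (T.depth v) with h | h
  · rwa [T.depth_anc h]
  · rw [T.anc_of_depth_le h]; exact hv.2.1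

variable {T} in
/-- A subtree contains the union of two of its root-to-vertex paths. -/
theorem AncClosed.card_sub_ge {S : Finset V} (hS : T.AncClosed S) {m : ℕ} {c u v : V}
    (hu : u ∈ T.sub S m c) (hv : v ∈ T.sub S m c) :
    (T.depth u + 1 - m) + (T.depth v - T.lca u v) ≤ (T.sub S m c).card := by
  classical
  have hu' := T.mem_sub.1 hu
  have hv' := T.mem_sub.1 hv
  have hml : m ≤ T.lca u v := T.le_lca hu'.2.1 hv'.2.1 (hu'.2.2.trans hv'.2.2.symm)
  set X := (Finset.Icc m (T.depth u)).image (fun j => T.anc j u) with hX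
  set Y := (Finset.Ioc (T.lca u v) (T.depth v)).image (fun j => T.anc j v) with hY
  have cX : X.card = T.depth u + 1 - m := by
    rw [hX, Finset.card_image_of_injOn, Nat.card_Icc]
    intro i hi j hj hij
    simp only [Finset.coe_Icc, Set.mem_Icc] at hi hj
    have := congrArg T.depth hij
    simpa only [T.depth_anc hi.2, T.depth_anc hj.2] using this
  have cY : Y.card = T.depth v - T.lca u v := by
    rw [hY, Finset.card_image_of_injOn, Nat.card_Ioc]
    intro i hi j hj hij
    simp only [Finset.coe_Ioc, Set.mem_Ioc] at hi hj
    have := congrArg T.depth hij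
    simpa only [T.depth_anc hi.2, T.depth_anc hj.2] using this
  have hd : Disjoint X Y := by
    rw [Finset.disjoint_left]
    intro y hyX hyY
    obtain ⟨i, hi, rfl⟩ := Finset.mem_image.1 hyX
    obtain ⟨j, hj, hij⟩ := Finset.mem_image.1 hyY
    rw [Finset.mem_Icc] at hi
    rw [Finset.mem_Ioc] at hj
    have h := congrArg T.depth hij
    rw [T.depth_anc hi.2, T.depth_anc hj.2] at h
    subst h
    have := T.le_lca hi.2 hj.2 hij.symm
    omega
  rw [← cX, ← cY, ← Finset.card_union_of_disjoint hd]
  apply Finset.card_le_card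
  intro y hy
  rcases Finset.mem_union.1 hy with hy | hy
  · obtain ⟨i, hi, rfl⟩ := Finset.mem_image.1 hy
    exact hS.anc_mem_sub hu (Finset.mem_Icc.1 hi).1
  · obtain ⟨i, hi, rfl⟩ := Finset.mem_image.1 hy
    exact hS.anc_mem_sub hv (hml.trans (Finset.mem_Ioc.1 hi).1.le)

variable {T} in
/-- The vertices of depth at least `h` in a subtree are covered by any ball of large enough
radius `s ≥ x`, where `x` is controlled by two branches of the subtree. -/
theorem AncClosed.exists_radius (hG : G.Connected) {S : Finset V} (hS : T.AncClosed S)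
    {m : ℕ} {c v : V} (hv : v ∈ T.sub S m c) (hmax : ∀ y ∈ T.sub S m c, T.depth y ≤ T.depth v)
    (h : ℕ) (hh : h ≤ T.depth v) :
    ∃ x l e : ℕ, m ≤ l ∧ l ≤ T.depth v ∧ l ≤ e ∧ h ≤ e ∧
      (T.depth v + 1 - m) + (e - l) ≤ (T.sub S m c).card ∧
      2 * x + 2 * l ≤ T.depth v + e + 1 ∧
      ∀ s, x ≤ s → ∃ q, ∀ y ∈ T.sub S m c, h ≤ T.depth y → G.dist q y ≤ s := by
  classical
  obtain ⟨y, hy, hymax⟩ := Finset.exists_max_image {y ∈ T.sub S m c | h ≤ T.depth y}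
    (fun y => T.depth v + T.depth y - 2 * T.lca v y) ⟨v, by simp [hv, hh]⟩
  rw [Finset.mem_filter] at hy
  have hv' := T.mem_sub.1 hv
  have hy' := T.mem_sub.1 hy.1
  have h1 := T.lca_le_left v y
  have h2 := T.lca_le_right v y
  refine ⟨(T.depth v + T.depth y - 2 * T.lca v y + 1) / 2, T.lca v y, T.depth y,
    T.le_lca hv'.2.1 hy'.2.1 (hv'.2.2.trans hy'.2.2.symm), h1, h2, hy.2,
    hS.card_sub_ge hv hy.1, by omega, fun s hs => ?_⟩
  obtain ⟨q, hq⟩ := T.exists_center hG s {y | y ∈ T.sub S m c ∧ h ≤ T.depth y} v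
    (fun t ht => hmax t ht.1) (fun t ht => by
      have := hymax t (Finset.mem_filter.2 ht)
      omega)
  exact ⟨q, fun t ht ht' => hq t ⟨ht, ht'⟩⟩

variable {T} in
/-- Given two sibling subtrees, the first one together with the vertices of the second one that are
at tree distance at most `2 * r` from the deepest vertex `u` of the first one is covered by a
ball of radius `r`. -/
theorem exists_center_union (hG : G.Connected) {S : Finset V} {r z : ℕ} {c d u : V}
    (hz : ∀ s ∈ S, ∀ t ∈ S, z < T.lca s t → T.depth s + T.depth t ≤ 2 * r + 2 * T.lca s t)
    (hcd : ∀ s ∈ T.sub S (z + 1) c, ∀ t ∈ T.sub S (z + 1) d, z ≤ T.lca s t)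
    (humax : ∀ y ∈ T.sub S (z + 1) c, T.depth y ≤ T.depth u) :
    ∃ q, ∀ y, (y ∈ T.sub S (z + 1) c ∨
      y ∈ T.sub S (z + 1) d ∧ ¬ 2 * r + 2 * z + 1 - T.depth u ≤ T.depth y) → G.dist q y ≤ r := by
  classical
  have same : ∀ c, ∀ s ∈ T.sub S (z + 1) c, ∀ t ∈ T.sub S (z + 1) c,
      T.depth s + T.depth t ≤ 2 * r + 2 * T.lca s t := by
    intro c s hs t ht
    rw [mem_sub] at hs ht
    exact hz s hs.1 t ht.1 (T.le_lca hs.2.1 ht.2.1 (hs.2.2.trans ht.2.2.symm))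
  have comm : ∀ s t, T.lca s t = T.lca t s := by
    intro s t
    exact le_antisymm
      (T.le_lca (T.lca_le_right s t) (T.lca_le_left s t) (T.anc_lca s t).symm)
      (T.le_lca (T.lca_le_right t s) (T.lca_le_left t s) (T.anc_lca t s).symm)
  have cross : ∀ s ∈ T.sub S (z + 1) c, ∀ t ∈ T.sub S (z + 1) d,
      ¬ 2 * r + 2 * z + 1 - T.depth u ≤ T.depth t →
      T.depth s + T.depth t ≤ 2 * r + 2 * T.lca s t := by
    intro s hs t ht h
    have h1 := humax s hs
    have h2 := hcd s hs t ht
    omega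
  obtain ⟨q, hq⟩ := T.exists_center_of_pairwise hG r
    (T.sub S (z + 1) c ∪
      {y ∈ T.sub S (z + 1) d | ¬ 2 * r + 2 * z + 1 - T.depth u ≤ T.depth y}) (by
      intro s hs t ht
      rw [Finset.mem_union, Finset.mem_filter] at hs ht
      rcases hs with hs | hs <;> rcases ht with ht | ht
      · exact same c s hs t ht
      · exact cross s hs t ht.1 ht.2
      · have := cross t ht s hs.1 hs.2
        rw [comm] at this
        omega
      · exact same d s hs.1 t ht.1)
  exact ⟨q, fun y hy => hq y (by rwa [Finset.mem_union, Finset.mem_filter])⟩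

variable {T} in
/-- A parent-closed set is covered by a ball of radius `r`, or one can remove from it a large part
which is covered either by a ball of radius `r`, or by two balls of radii `r` and `s ≥ x`. -/
theorem AncClosed.exists_removable [DecidableEq V] (hG : G.Connected) {S : Finset V}
    (hS : T.AncClosed S) (r : ℕ) :
    (∃ q, ∀ y ∈ S, G.dist q y ≤ r) ∨
    (∃ B ⊆ S, T.AncClosed (S \ B) ∧ 2 * r + 1 ≤ B.card ∧ ∃ q, ∀ y ∈ B, G.dist q y ≤ r) ∨
    ∃ x : ℕ,
      (∃ B ⊆ S, T.AncClosed (S \ B) ∧ r + 1 ≤ B.card ∧ 2 * x ≤ B.card ∧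
        ∃ q, ∀ y ∈ B, G.dist q y ≤ r) ∧
      (∃ B ⊆ S, T.AncClosed (S \ B) ∧ 2 * r + 2 * x ≤ B.card ∧
        ∀ s, x ≤ s → ∃ q q', ∀ y ∈ B, G.dist q y ≤ r ∨ G.dist q' y ≤ s) := by
  by_cases hcov : ∀ u ∈ S, ∀ v ∈ S, T.depth u + T.depth v ≤ 2 * r + 2 * T.lca u v
  · exact Or.inl (T.exists_center_of_pairwise hG r S hcov)
  right
  push Not at hcov
  obtain ⟨u₁, hu₁, v₁, hv₁, h₁⟩ := hcov
  obtain ⟨⟨u₀, v₀⟩, hmem, hmax⟩ := Finset.exists_max_image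
    {p ∈ S ×ˢ S | 2 * r + 2 * T.lca p.1 p.2 < T.depth p.1 + T.depth p.2}
    (fun p => T.lca p.1 p.2) ⟨(u₁, v₁), by simp [hu₁, hv₁, h₁]⟩
  simp only [Finset.mem_filter, Finset.mem_product] at hmem hmax
  obtain ⟨⟨hu₀, hv₀⟩, h₀⟩ := hmem
  obtain ⟨z, hzdef⟩ : ∃ z, z = T.lca u₀ v₀ := ⟨_, rfl⟩
  rw [← hzdef] at h₀ hmax
  have hz : ∀ s ∈ S, ∀ t ∈ S, z < T.lca s t →
      T.depth s + T.depth t ≤ 2 * r + 2 * T.lca s t := by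
    intro s hs t ht hst
    by_contra hlt
    have := hmax (s, t) ⟨⟨hs, ht⟩, by simpa using hlt⟩
    simp only at this
    omega
  have hzu : z ≤ T.depth u₀ := hzdef ▸ T.lca_le_left u₀ v₀
  have hzv : z ≤ T.depth v₀ := hzdef ▸ T.lca_le_right u₀ v₀
  have cover : ∀ c, ∃ q, ∀ y ∈ T.sub S (z + 1) c, G.dist q y ≤ r := by
    intro c
    apply T.exists_center_of_pairwise hG
    intro s hs t ht
    rw [mem_sub] at hs ht
    exact hz s hs.1 t ht.1 (T.le_lca hs.2.1 ht.2.1 (hs.2.2.trans ht.2.2.symm))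
  have sub_subset : ∀ c, T.sub S (z + 1) c ⊆ S := fun c y hy => (T.mem_sub.1 hy).1
  have long : ∀ t ∈ S, 2 * r + 1 + z ≤ T.depth t →
      ∃ B ⊆ S, T.AncClosed (S \ B) ∧ 2 * r + 1 ≤ B.card ∧ ∃ q, ∀ y ∈ B, G.dist q y ≤ r := by
    intro t ht hle
    have htm : t ∈ T.sub S (z + 1) (T.anc (z + 1) t) := T.mem_sub.2 ⟨ht, by omega, rfl⟩
    have := hS.card_sub_ge htm htm
    exact ⟨T.sub S (z + 1) (T.anc (z + 1) t), sub_subset _, hS.sdiff_sub _ _, by omega, cover _⟩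
  rcases hzu.eq_or_lt with hzu' | hzu'
  · exact Or.inl (long v₀ hv₀ (by omega))
  rcases hzv.eq_or_lt with hzv' | hzv'
  · exact Or.inl (long u₀ hu₀ (by omega))
  right
  obtain ⟨c, hc⟩ : ∃ c, c = T.anc (z + 1) u₀ := ⟨_, rfl⟩
  obtain ⟨d, hd⟩ : ∃ d, d = T.anc (z + 1) v₀ := ⟨_, rfl⟩
  have hcd : c ≠ d := by
    intro h
    have := T.le_lca hzu' hzv' (hc.symm.trans (h.trans hd))
    omega
  have hmu : u₀ ∈ T.sub S (z + 1) c := T.mem_sub.2 ⟨hu₀, hzu', hc.symm⟩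
  have hmv : v₀ ∈ T.sub S (z + 1) d := T.mem_sub.2 ⟨hv₀, hzv', hd.symm⟩
  obtain ⟨u, hu, humax⟩ := Finset.exists_max_image _ T.depth ⟨u₀, hmu⟩
  obtain ⟨v, hv, hvmax⟩ := Finset.exists_max_image _ T.depth ⟨v₀, hmv⟩
  have hanc : T.anc z c = T.anc z d := by
    rw [hc, hd, T.anc_anc (Nat.le_succ z), T.anc_anc (Nat.le_succ z)]
    exact T.anc_eq_of_le_lca hzdef.le
  have anc_z : ∀ b, ∀ s ∈ T.sub S (z + 1) b, z ≤ T.depth s ∧ T.anc z s = T.anc z b := by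
    intro b s hs
    rw [mem_sub] at hs
    exact ⟨by omega, by rw [← hs.2.2, T.anc_anc (Nat.le_succ z)]⟩
  have hlca : ∀ s ∈ T.sub S (z + 1) c, ∀ t ∈ T.sub S (z + 1) d, z ≤ T.lca s t := by
    intro s hs t ht
    obtain ⟨h1, h2⟩ := anc_z c s hs
    obtain ⟨h3, h4⟩ := anc_z d t ht
    exact T.le_lca h1 h3 (by rw [h2, h4, hanc])
  have hlca' : ∀ s ∈ T.sub S (z + 1) d, ∀ t ∈ T.sub S (z + 1) c, z ≤ T.lca s t := by
    intro s hs t ht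
    obtain ⟨h1, h2⟩ := anc_z d s hs
    obtain ⟨h3, h4⟩ := anc_z c t ht
    exact T.le_lca h1 h3 (by rw [h2, h4, hanc])
  have hu1 := humax u₀ hmu
  have hv1 := hvmax v₀ hmv
  obtain ⟨xa, la, ea, ha1, ha2, ha3, ha4, ha5, ha6, ha7⟩ := hS.exists_radius hG hu humax
    (2 * r + 2 * z + 1 - T.depth v) (by omega)
  obtain ⟨xb, lb, eb, hb1, hb2, hb3, hb4, hb5, hb6, hb7⟩ := hS.exists_radius hG hv hvmax
    (2 * r + 2 * z + 1 - T.depth u) (by omega)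
  have single : ∀ x, 2 * x ≤ max (T.sub S (z + 1) c).card (T.sub S (z + 1) d).card →
      ∃ B ⊆ S, T.AncClosed (S \ B) ∧ r + 1 ≤ B.card ∧ 2 * x ≤ B.card ∧
        ∃ q, ∀ y ∈ B, G.dist q y ≤ r := by
    intro x hx
    rcases le_total (T.sub S (z + 1) c).card (T.sub S (z + 1) d).card with h | h
    · exact ⟨_, sub_subset d, hS.sdiff_sub _ _, by omega, by omega, cover d⟩
    · exact ⟨_, sub_subset c, hS.sdiff_sub _ _, by omega, by omega, cover c⟩
  have hdisj : Disjoint (T.sub S (z + 1) c) (T.sub S (z + 1) d) := by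
    rw [Finset.disjoint_left]
    intro y hy hy'
    rw [mem_sub] at hy hy'
    exact hcd (hy.2.2.symm.trans hy'.2.2)
  have hcard := Finset.card_union_of_disjoint hdisj
  have hclosed : T.AncClosed (S \ (T.sub S (z + 1) c ∪ T.sub S (z + 1) d)) := by
    intro y hy
    have h1 := hS.sdiff_sub (z + 1) c y
    have h2 := hS.sdiff_sub (z + 1) d y
    simp only [Finset.mem_sdiff, Finset.mem_union, not_or] at hy h1 h2 ⊢
    exact ⟨(h1 ⟨hy.1, hy.2.1⟩).1, (h1 ⟨hy.1, hy.2.1⟩).2, (h2 ⟨hy.1, hy.2.2⟩).2⟩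
  have hsub : T.sub S (z + 1) c ∪ T.sub S (z + 1) d ⊆ S :=
    Finset.union_subset (sub_subset c) (sub_subset d)
  rcases le_total (T.depth v + la) (T.depth u + lb) with hle | hle
  · refine ⟨xb, single xb (by omega), _, hsub, hclosed, by omega, fun s hs => ?_⟩
    obtain ⟨q, hq⟩ := exists_center_union hG hz hlca humax
    obtain ⟨q', hq'⟩ := hb7 s hs
    refine ⟨q, q', fun y hy => ?_⟩
    rcases Finset.mem_union.1 hy with hy | hy
    · exact Or.inl (hq y (Or.inl hy))
    · by_cases hp : 2 * r + 2 * z + 1 - T.depth u ≤ T.depth y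
      · exact Or.inr (hq' y hy hp)
      · exact Or.inl (hq y (Or.inr ⟨hy, hp⟩))
  · refine ⟨xa, single xa (by omega), _, hsub, hclosed, by omega, fun s hs => ?_⟩
    obtain ⟨q, hq⟩ := exists_center_union hG hz hlca' hvmax
    obtain ⟨q', hq'⟩ := ha7 s hs
    refine ⟨q, q', fun y hy => ?_⟩
    rcases Finset.mem_union.1 hy with hy | hy
    · by_cases hp : 2 * r + 2 * z + 1 - T.depth v ≤ T.depth y
      · exact Or.inr (hq' y hy hp)
      · exact Or.inl (hq y (Or.inr ⟨hy, hp⟩))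
    · exact Or.inl (hq y (Or.inl hy))

end RootedSpanningTree

/-- The first element of the maximal interval of integers missing from `R` that ends at `t - 1`
(it is `t` if that interval is empty). -/
def gapStart (R : Finset ℕ) : ℕ → ℕ
  | 0 => 0
  | t + 1 => if t ∈ R then t + 1 else gapStart R t

theorem gapStart_le (R : Finset ℕ) (t : ℕ) : gapStart R t ≤ t := by
  induction t with
  | zero => simp [gapStart]
  | succ t ih => rw [gapStart]; split_ifs <;> omega

theorem gapStart_erase_le (R : Finset ℕ) (s t : ℕ) :
    gapStart (R.erase s) t ≤ gapStart R t := by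
  induction t with
  | zero => simp [gapStart]
  | succ t ih =>
    have := gapStart_le (R.erase s) t
    rw [gapStart, gapStart]
    by_cases h : t ∈ R
    · rw [if_pos h]; split_ifs <;> omega
    · rw [if_neg h, if_neg (fun h' => h (Finset.mem_of_mem_erase h'))]; exact ih

theorem gapStart_eq_of_forall_notMem {R : Finset ℕ} {x t : ℕ} (hxt : x ≤ t)
    (h : ∀ i, x ≤ i → i < t → i ∉ R) : gapStart R t = gapStart R x := by
  induction t, hxt using Nat.le_induction with
  | base => rfl
  | succ t hxt ih =>
    rw [gapStart, if_neg (h t hxt (Nat.lt_succ_self t))]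
    exact ih fun i hi hit => h i hi (by omega)

/-- Contribution of the radius `t < m` to the potential, where `R` is the set of radii that have not
been used as a second radius. -/
def radiusWeight (m : ℕ) (R : Finset ℕ) (t : ℕ) : ℤ :=
  if t ∈ R then 3 * t else 2 * t - 3 * gapStart R t - m

/-- The radii of `R` smaller than `m` suffice to cover half as many vertices. -/
def burningPotential (m : ℕ) (R : Finset ℕ) : ℤ :=
  ∑ t ∈ Finset.range m, radiusWeight m R t

theorem sum_radiusWeight_succ_le (r j : ℕ) (R : Finset ℕ) :
    ∑ t ∈ Finset.range j, radiusWeight (r + 1) R t ≤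
      ∑ t ∈ Finset.range j, radiusWeight r R t - (j - gapStart R j) := by
  induction j with
  | zero => simp [gapStart]
  | succ j ih =>
    rw [Finset.sum_range_succ, Finset.sum_range_succ, gapStart]
    have := gapStart_le R j
    unfold radiusWeight at ih ⊢
    by_cases h : j ∈ R
    · simp only [if_pos h]; push_cast at *; linarith
    · simp only [if_neg h]; push_cast at *; linarith

theorem burningPotential_succ_of_mem {r : ℕ} {R : Finset ℕ} (hr : r ∈ R) :
    burningPotential (r + 1) R + (r - gapStart R r) ≤ burningPotential r R + 3 * r := by
  have := sum_radiusWeight_succ_le r r R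
  rw [burningPotential, burningPotential, Finset.sum_range_succ]
  have h2 : radiusWeight (r + 1) R r = 3 * r := if_pos hr
  linarith

theorem burningPotential_succ_of_notMem {r : ℕ} {R : Finset ℕ} (hr : r ∉ R) :
    burningPotential (r + 1) R + (2 * gapStart R r + 1) ≤ burningPotential r R := by
  have := sum_radiusWeight_succ_le r r R
  rw [burningPotential, burningPotential, Finset.sum_range_succ]
  have h2 : radiusWeight (r + 1) R r = 2 * r - 3 * gapStart R r - (r + 1 : ℕ) := if_neg hr
  push_cast at h2
  linarith

theorem burningPotential_le_of_forall_notMem {R : Finset ℕ} {x r : ℕ} (hxr : x ≤ r)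
    (h : ∀ i, x ≤ i → i < r → i ∉ R) :
    burningPotential r R + (r - x) * (2 * gapStart R x + 1) ≤ burningPotential x R := by
  induction r, hxr using Nat.le_induction with
  | base => simp
  | succ r hxr ih =>
    have h1 := ih fun i hi hir => h i hi (by omega)
    have h2 := burningPotential_succ_of_notMem (h r hxr (Nat.lt_succ_self r))
    rw [gapStart_eq_of_forall_notMem hxr fun i hi hir => h i hi (by omega)] at h2
    push_cast
    linarith

theorem burningPotential_erase {R : Finset ℕ} {r s x : ℕ} (hr : r ∈ R) (hs : s ∈ R) (hsr : s < r)
    (hxs : x ≤ s) (h : ∀ i, x ≤ i → i < s → i ∉ R) :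
    burningPotential (r + 1) R ≤ burningPotential r (R.erase s) + 4 * r + 4 * x := by
  have hgap : gapStart R s ≤ x := by
    rw [gapStart_eq_of_forall_notMem hxs h]; exact gapStart_le R x
  have low : ∀ t < s, ∀ m, radiusWeight m (R.erase s) t = radiusWeight m R t := by
    intro t ht m
    have hg : ∀ t, t ≤ s → gapStart (R.erase s) t = gapStart R t := by
      intro t ht
      induction t with
      | zero => rfl
      | succ t ih =>
        rw [gapStart, gapStart, ih (by omega)]
        have : t ∈ R.erase s ↔ t ∈ R := by
          rw [Finset.mem_erase]; exact and_iff_right (by omega)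
        simp only [this]
    have : t ∈ R.erase s ↔ t ∈ R := by
      rw [Finset.mem_erase]; exact and_iff_right (by omega)
    simp only [radiusWeight, this, hg t ht.le]
  have high : ∀ t, t ≠ s → radiusWeight (r + 1) R t ≤ radiusWeight r (R.erase s) t := by
    intro t ht
    have hmem : t ∈ R.erase s ↔ t ∈ R := by
      rw [Finset.mem_erase]; exact and_iff_right ht
    have := gapStart_erase_le R s t
    simp only [radiusWeight, hmem]
    split_ifs <;> push_cast <;> omega
  have mid : radiusWeight (r + 1) R s + (2 * s - 3 * gapStart R s - r) ≤
      radiusWeight r (R.erase s) s + 3 * s := by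
    have := gapStart_erase_le R s s
    simp only [radiusWeight, if_pos hs, if_neg (Finset.notMem_erase s R)]
    omega
  have split : ∀ w : ℕ → ℤ, ∑ t ∈ Finset.range r, w t =
      ∑ t ∈ Finset.range s, w t + w s + ∑ t ∈ Finset.Ico (s + 1) r, w t := by
    intro w
    rw [← Finset.sum_range_succ, Finset.sum_range_add_sum_Ico _ (by omega)]
  have h1 := sum_radiusWeight_succ_le r s R
  have h2 : ∑ t ∈ Finset.Ico (s + 1) r, radiusWeight (r + 1) R t ≤
      ∑ t ∈ Finset.Ico (s + 1) r, radiusWeight r (R.erase s) t :=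
    Finset.sum_le_sum fun t ht => high t (by rw [Finset.mem_Ico] at ht; omega)
  have h3 : ∑ t ∈ Finset.range s, radiusWeight r (R.erase s) t =
      ∑ t ∈ Finset.range s, radiusWeight r R t :=
    Finset.sum_congr rfl fun t ht => low t (Finset.mem_range.1 ht) r
  have h4 : radiusWeight (r + 1) R r = 3 * r := if_pos hr
  rw [burningPotential, burningPotential, Finset.sum_range_succ, split, split, h3, h4]
  have : (gapStart R s : ℤ) ≤ x := by exact_mod_cast hgap
  linarith

/-- If the potential of a set of radii is large enough, then balls of these radii can be placed to
cover a given parent-closed set. -/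
theorem RootedSpanningTree.AncClosed.exists_cover {V : Type*} {G : SimpleGraph V}
    {T : RootedSpanningTree G} (hG : G.Connected) (m : ℕ) :
    ∀ (R : Finset ℕ) (S : Finset V), T.AncClosed S → 2 * (S.card : ℤ) ≤ burningPotential m R →
      ∃ c : ℕ → V, ∀ y ∈ S, ∃ t ∈ R, t < m ∧ G.dist (c t) y ≤ t := by
  classical
  induction m using Nat.strong_induction_on with
  | _ m ih =>
  intro R S hS hcard
  obtain ⟨p₀⟩ := hG.nonempty
  rcases m with _ | r
  · have : S = ∅ := by
      rw [burningPotential, Finset.sum_range_zero] at hcard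
      exact Finset.card_eq_zero.1 (by omega)
    exact ⟨fun _ => p₀, by simp [this]⟩
  by_cases hr : r ∈ R
  swap
  · have := burningPotential_succ_of_notMem hr
    obtain ⟨c, hc⟩ := ih r (Nat.lt_succ_self r) R S hS (by linarith)
    refine ⟨c, fun y hy => ?_⟩
    obtain ⟨t, ht, htr, hd⟩ := hc y hy
    exact ⟨t, ht, by omega, hd⟩
  have hgr : (gapStart R r : ℤ) ≤ r := by exact_mod_cast gapStart_le R r
  have hstep := burningPotential_succ_of_mem hr
  have single : ∀ B ⊆ S, T.AncClosed (S \ B) → (∃ q, ∀ y ∈ B, G.dist q y ≤ r) →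
      ∀ j ≤ r, burningPotential (r + 1) R ≤ burningPotential j R + 2 * B.card →
      ∃ c : ℕ → V, ∀ y ∈ S, ∃ t ∈ R, t < r + 1 ∧ G.dist (c t) y ≤ t := by
    rintro B hBS hB ⟨q, hq⟩ j hj hpot
    have hsd := Finset.card_sdiff_add_card_eq_card hBS
    obtain ⟨c, hc⟩ := ih j (by omega) R (S \ B) hB (by zify at hsd; linarith)
    refine ⟨Function.update c r q, fun y hy => ?_⟩
    by_cases hyB : y ∈ B
    · exact ⟨r, hr, Nat.lt_succ_self r, by simpa using hq y hyB⟩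
    · obtain ⟨t, ht, htj, hd⟩ := hc y (Finset.mem_sdiff.2 ⟨hy, hyB⟩)
      exact ⟨t, ht, by omega, by rwa [Function.update_of_ne (by omega)]⟩
  rcases hS.exists_removable hG r with ⟨q, hq⟩ | ⟨B, hBS, hB, hBc, hq⟩ |
    ⟨x, ⟨B₁, hBS₁, hB₁, hBr, hBx, hq₁⟩, B, hBS, hB, hBc, hq⟩
  · exact ⟨fun _ => q, fun y hy => ⟨r, hr, Nat.lt_succ_self r, hq y hy⟩⟩
  · exact single B hBS hB hq r le_rfl (by zify at hBc; linarith)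
  by_cases hx : r ≤ x
  · exact single B₁ hBS₁ hB₁ hq₁ r le_rfl (by zify at hBx hx; linarith)
  by_cases hex : ∃ s, s ∈ R ∧ s < r ∧ x ≤ s
  · obtain ⟨hsR, hsr, hxs⟩ := Nat.find_spec hex
    have hmin : ∀ i, x ≤ i → i < Nat.find hex → i ∉ R := fun i hi his hiR =>
      Nat.find_min hex his ⟨hiR, by omega, hi⟩
    generalize Nat.find hex = s at hsR hsr hxs hmin
    have hpot := burningPotential_erase hr hsR hsr hxs hmin
    obtain ⟨q, q', hqq⟩ := hq s hxs
    have hsd := Finset.card_sdiff_add_card_eq_card hBS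
    obtain ⟨c, hc⟩ := ih r (Nat.lt_succ_self r) (R.erase s) (S \ B) hB
      (by zify at hsd hBc; linarith)
    refine ⟨Function.update (Function.update c s q') r q, fun y hy => ?_⟩
    by_cases hyB : y ∈ B
    · rcases hqq y hyB with h | h
      · exact ⟨r, hr, Nat.lt_succ_self r, by simpa using h⟩
      · refine ⟨s, hsR, by omega, ?_⟩
        rwa [Function.update_of_ne (by omega), Function.update_self]
    · obtain ⟨t, ht, htr, hd⟩ := hc y (Finset.mem_sdiff.2 ⟨hy, hyB⟩)
      rw [Finset.mem_erase] at ht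
      refine ⟨t, ht.2, by omega, ?_⟩
      rwa [Function.update_of_ne (by omega), Function.update_of_ne ht.1]
  · have hgap : ∀ i, x ≤ i → i < r → i ∉ R := fun i hi hir hiR => hex ⟨i, hiR, hir, hi⟩
    have hpot := burningPotential_le_of_forall_notMem (not_le.1 hx).le hgap
    rw [gapStart_eq_of_forall_notMem (not_le.1 hx).le hgap] at hstep
    have hgx : (gapStart R x : ℤ) ≤ x := by exact_mod_cast gapStart_le R x
    refine single B₁ hBS₁ hB₁ hq₁ x (not_le.1 hx).le ?_
    have hxr : (x : ℤ) < r := by exact_mod_cast not_le.1 hx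
    zify at hBx hBr
    rcases Nat.eq_zero_or_pos (gapStart R x) with h0 | h0
    · rw [h0] at hpot hstep
      push_cast at hpot hstep
      linarith
    · have h1 : (1 : ℤ) ≤ gapStart R x := by exact_mod_cast h0
      nlinarith [mul_nonneg (sub_nonneg.2 hxr.le) (sub_nonneg.2 h1)]

theorem burningPotential_range (k : ℕ) :
    2 * burningPotential k (Finset.range k) = 3 * (k * (k - 1)) := by
  have h : burningPotential k (Finset.range k) = ∑ t ∈ Finset.range k, (3 * t : ℤ) :=
    Finset.sum_congr rfl fun t ht => if_pos ht
  rw [h]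
  clear h
  induction k with
  | zero => simp
  | succ k ih =>
    rw [Finset.sum_range_succ, mul_add, ih]
    push_cast
    ring

theorem SimpleGraph.Connected.burnable_of_le {V : Type*} [Fintype V] {G : SimpleGraph V}
    (hG : G.Connected) (k : ℕ) (h : 4 * (Fintype.card V : ℤ) ≤ 3 * (k * (k - 1))) :
    Burnable G k := by
  obtain ⟨T⟩ := hG.exists_rootedSpanningTree
  have hT : T.AncClosed Finset.univ := fun v _ => Finset.mem_univ _
  have hpot := burningPotential_range k
  obtain ⟨c, hc⟩ := hT.exists_cover hG k (Finset.range k) Finset.univ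
    (by rw [Finset.card_univ]; linarith)
  refine ⟨fun i => c (k - 1 - i), fun u => ?_⟩
  obtain ⟨t, -, htk, hd⟩ := hc u (Finset.mem_univ u)
  refine ⟨⟨k - 1 - t, by omega⟩, hG _ _, ?_⟩
  have : k - 1 - (k - 1 - t) = t := by omega
  simpa only [this] using hd

theorem burning_four_thirds {V : Type*} [Fintype V] (G : SimpleGraph V)
    (hG : G.Connected) :
    burningNumber G ≤ ⌈Real.sqrt (4 * Fintype.card V / 3)⌉₊ + 1 := by
  refine Nat.sInf_le (hG.burnable_of_le _ ?_)
  have h1 := Nat.le_ceil (Real.sqrt (4 * Fintype.card V / 3))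
  generalize ⌈Real.sqrt (4 * Fintype.card V / 3)⌉₊ = k at h1
  have h2 : (4 * Fintype.card V / 3 : ℝ) ≤ k ^ 2 := Real.sqrt_le_left (by positivity) |>.1 h1
  have h3 : 4 * Fintype.card V ≤ 3 * k ^ 2 := by
    have : (4 * Fintype.card V : ℝ) ≤ 3 * k ^ 2 := by linarith
    exact_mod_cast this
  zify at h3
  push_cast
  nlinarith
end
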